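/- Let n >= 2 and let phi be an automorphism of the free group F_n. Then the semidirect product F_n ⋊_phi Z is acylindrically hyperbolic if and only if the image of phi in Out(F_n) has infinite order. -/

import Mathlib

noncomputable section

open Metric Set

universe u v

/-- A geodesic metric space: any two points are joined by an isometrically
parametrized segment. -/
def GeodesicSpace (Y : Type*) [MetricSpace Y] : Prop :=
  ∀ x y : Y, ∃ f : ℝ → Y, f 0 = x ∧ f (dist x y) = y ∧
    ∀ s ∈ Set.Icc (0:ℝ) (dist x y), ∀ t ∈ Set.Icc (0:ℝ) (dist x y),
      dist (f s) (f t) = |s - t|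

/-- Gromov hyperbolicity (four-point condition) with constant `δ`. -/
def GromovHyperbolic (Y : Type*) [MetricSpace Y] (δ : ℝ) : Prop :=
  ∀ x y z w : Y, dist x y + dist z w ≤ max (dist x z + dist y w) (dist x w + dist y z) + 2 * δ

/-- A Gromov hyperbolic geodesic metric space. -/
def HyperbolicGeodesicSpace (Y : Type*) [MetricSpace Y] : Prop :=
  GeodesicSpace Y ∧ ∃ δ : ℝ, 0 ≤ δ ∧ GromovHyperbolic Y δ

/-- An isometric action `ρ` of `G` on `Y` is acylindrical if for every `R > 0` there are
`L > 0` and `N` such that for any two points at distance `> L`, at most `N` elements of `G`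
move both points by less than `R`. -/
def IsAcylindrical {G : Type*} [Group G] {Y : Type*} [MetricSpace Y] (ρ : G →* (Y ≃ᵢ Y)) : Prop :=
  ∀ R : ℝ, 0 < R → ∃ L : ℝ, 0 < L ∧ ∃ N : ℕ, ∀ x y : Y, L < dist x y →
    ∃ s : Finset G, s.card ≤ N ∧
      ∀ g : G, dist x (ρ g x) < R → dist y (ρ g y) < R → g ∈ s

/-- A group is virtually cyclic if it has a cyclic subgroup of finite index. -/
def VirtuallyCyclic (G : Type*) [Group G] : Prop :=
  ∃ H : Subgroup G, H.FiniteIndex ∧ IsCyclic ↥H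

/-- A group is acylindrically hyperbolic if it is not virtually cyclic and admits an
acylindrical isometric action with unbounded orbits on a Gromov hyperbolic geodesic space
(this is equivalent to admitting a nonelementary acylindrical action on such a space). -/
def AcylindricallyHyperbolic (G : Type u) [Group G] : Prop :=
  ¬ VirtuallyCyclic G ∧
    ∃ (Y : Type u) (_ : MetricSpace Y) (ρ : G →* (Y ≃ᵢ Y)),
      HyperbolicGeodesicSpace Y ∧ IsAcylindrical ρ ∧
      ∃ y : Y, ¬ Bornology.IsBounded (Set.range fun g : G => ρ g y)

set_option linter.unusedVariables false
set_option linter.unusedSectionVars false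
set_option linter.unusedSimpArgs false

section TightSpan
variable {X : Type u} [PseudoMetricSpace X]

def TSA (f : X → ℝ) : Prop := ∀ x y, dist x y ≤ f x + f y

@[ext] structure TSpan (X : Type u) [PseudoMetricSpace X] : Type u where
  f : X → ℝ
  p : TSA f ∧ ∀ x, ∀ ε > 0, ∃ z, f x + f z < dist x z + ε

def tsStar (f : X → ℝ) (x : X) : ℝ := ⨆ z, (dist x z - f z)

lemma tsBdd {f : X → ℝ} (hf : TSA f) (x : X) : BddAbove (range fun z => dist x z - f z) := by
  refine ⟨f x, ?_⟩
  rintro _ ⟨z, rfl⟩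
  have := hf x z
  simp only; linarith

lemma tsStar_ge {f : X → ℝ} (hf : TSA f) (x z : X) : dist x z - f z ≤ tsStar f x :=
  le_ciSup (tsBdd hf x) z

lemma tsStar_le {f : X → ℝ} (x : X) (C : ℝ) (h : ∀ z, dist x z - f z ≤ C) : tsStar f x ≤ C := by
  have : Nonempty X := ⟨x⟩
  exact ciSup_le h

lemma tsStar_le_self {f : X → ℝ} (hf : TSA f) (x : X) : tsStar f x ≤ f x :=
  tsStar_le x _ fun z => by have := hf x z; linarith

lemma tsA_nonneg {f : X → ℝ} (hf : TSA f) (x : X) : 0 ≤ f x := by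
  have := hf x x; rw [dist_self] at this; linarith

def tsQ (f : X → ℝ) (x : X) : ℝ := (f x + tsStar f x) / 2

lemma tsQ_A {f : X → ℝ} (hf : TSA f) : TSA (tsQ f) := by
  intro x y
  have h1 := tsStar_ge hf x y
  have h2 := tsStar_ge hf y x
  rw [dist_comm y x] at h2
  simp only [tsQ]; linarith

lemma tsQ_le {f : X → ℝ} (hf : TSA f) (x : X) : tsQ f x ≤ f x := by
  have := tsStar_le_self hf x
  simp only [tsQ]; linarith

def tsIt (f : X → ℝ) : ℕ → X → ℝ
  | 0 => f
  | n+1 => tsQ (tsIt f n)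

lemma tsIt_A {f : X → ℝ} (hf : TSA f) : ∀ n, TSA (tsIt f n)
  | 0 => hf
  | n+1 => tsQ_A (tsIt_A hf n)

lemma tsIt_gap {f : X → ℝ} (hf : TSA f) (x : X) (n : ℕ) :
    tsIt f n x - tsStar (tsIt f n) x ≤ (f x - tsStar f x) / 2 ^ n := by
  induction n with
  | zero => simp [tsIt]
  | succ n ih =>
    have h1 : tsStar (tsIt f n) x ≤ tsStar (tsIt f (n+1)) x := by
      apply tsStar_le
      intro z
      refine le_trans ?_ (tsStar_ge (tsIt_A hf (n+1)) x z)
      have := tsQ_le (tsIt_A hf n) z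
      simp only [tsIt]; linarith
    have h2 : tsIt f (n+1) x = (tsIt f n x + tsStar (tsIt f n) x)/2 := rfl
    rw [h2, pow_succ, ← div_div]
    linarith

def tsP (f : X → ℝ) (x : X) : ℝ := ⨅ n, tsIt f n x

lemma tsP_bdd {f : X → ℝ} (hf : TSA f) (x : X) : BddBelow (range fun n => tsIt f n x) := by
  refine ⟨0, ?_⟩
  rintro _ ⟨n, rfl⟩
  exact tsA_nonneg (tsIt_A hf n) x

lemma tsP_le {f : X → ℝ} (hf : TSA f) (n : ℕ) (x : X) : tsP f x ≤ tsIt f n x :=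
  ciInf_le (tsP_bdd hf x) n

lemma tsIt_anti {f : X → ℝ} (hf : TSA f) (x : X) : Antitone fun n => tsIt f n x :=
  antitone_nat_of_succ_le fun n => tsQ_le (tsIt_A hf n) x

lemma tsP_mem {f : X → ℝ} (hf : TSA f) :
    TSA (tsP f) ∧ ∀ x, ∀ ε > 0, ∃ z, tsP f x + tsP f z < dist x z + ε := by
  constructor
  · intro x y
    have h1 : ∀ n, dist x y - tsIt f n y ≤ tsP f x := by
      intro n
      apply le_ciInf
      intro m
      have h := tsIt_A hf (max n m) x y
      have h2 := tsIt_anti hf x (le_max_right n m)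
      have h3 := tsIt_anti hf y (le_max_left n m)
      simp only at h2 h3
      linarith
    have h2 : dist x y - tsP f x ≤ tsP f y := by
      apply le_ciInf
      intro n; have := h1 n; linarith
    linarith
  · intro x ε hε
    have : Nonempty X := ⟨x⟩
    obtain ⟨n, hn⟩ : ∃ n : ℕ, (f x - tsStar f x) / 2 ^ n < ε / 2 := by
      have : Filter.Tendsto (fun n : ℕ => (f x - tsStar f x) * (1/2 : ℝ) ^ n) Filter.atTop (nhds ((f x - tsStar f x) * 0)) :=
        (tendsto_pow_atTop_nhds_zero_of_lt_one (by norm_num) (by norm_num)).const_mul _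
      rw [mul_zero] at this
      obtain ⟨n, hn⟩ := (this.eventually (gt_mem_nhds (show (0:ℝ) < ε/2 by linarith))).exists
      refine ⟨n, ?_⟩
      rw [one_div, inv_pow] at hn
      rwa [div_eq_mul_inv]
    have h1 := tsIt_gap hf x n
    obtain ⟨z, hz⟩ := exists_lt_of_lt_ciSup (show tsStar (tsIt f n) x - ε/2 < ⨆ z, (dist x z - tsIt f n z) by
      have : tsStar (tsIt f n) x = ⨆ z, (dist x z - tsIt f n z) := rfl
      linarith)
    refine ⟨z, ?_⟩
    have h2 := tsP_le hf n x
    have h3 := tsP_le hf n z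
    linarith

lemma tsStar_lip {f g : X → ℝ} (hg : TSA g) (C : ℝ) (h : ∀ x, g x ≤ f x + C) (x : X) :
    tsStar f x ≤ tsStar g x + C := by
  apply tsStar_le
  intro z
  have := tsStar_ge hg x z
  have := h z
  linarith

lemma tsIt_lip {f g : X → ℝ} (hf : TSA f) (hg : TSA g) (C : ℝ) (h : ∀ x, f x ≤ g x + C)
    (h' : ∀ x, g x ≤ f x + C) (n : ℕ) : (∀ x, tsIt f n x ≤ tsIt g n x + C) ∧
      (∀ x, tsIt g n x ≤ tsIt f n x + C) := by
  induction n with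
  | zero => exact ⟨h, h'⟩
  | succ n ih =>
    constructor
    · intro x
      have h1 := ih.1 x
      have h2 := tsStar_lip (tsIt_A hg n) C ih.2 x
      simp only [tsIt, tsQ]; linarith
    · intro x
      have h1 := ih.2 x
      have h2 := tsStar_lip (tsIt_A hf n) C ih.1 x
      simp only [tsIt, tsQ]; linarith

lemma tsP_lip {f g : X → ℝ} (hf : TSA f) (hg : TSA g) (C : ℝ) (h : ∀ x, |f x - g x| ≤ C) (x : X) :
    |tsP f x - tsP g x| ≤ C := by
  have h0 := fun n => tsIt_lip hf hg C (fun x => by have := abs_le.1 (h x); linarith)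
    (fun x => by have := abs_le.1 (h x); linarith) n
  rw [abs_le]
  constructor
  · have : tsP g x - C ≤ tsP f x := by
      apply le_ciInf; intro n
      have := tsP_le hg n x
      have := (h0 n).2 x
      linarith
    linarith
  · have : tsP f x - C ≤ tsP g x := by
      apply le_ciInf; intro n
      have := tsP_le hf n x
      have := (h0 n).1 x
      linarith
    linarith

lemma tsP_fix (f : TSpan X) : tsP f.1 = f.1 := by
  have h1 : tsStar f.1 = f.1 := by
    funext x
    apply le_antisymm (tsStar_le_self f.2.1 x)
    apply le_of_forall_pos_le_add
    intro ε hε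
    obtain ⟨z, hz⟩ := f.2.2 x ε hε
    have := tsStar_ge f.2.1 x z
    linarith
  have h2 : ∀ n, tsIt f.1 n = f.1 := by
    intro n
    induction n with
    | zero => rfl
    | succ n ih => funext x; simp only [tsIt, tsQ, ih, h1]; ring
  funext x
  simp [tsP, h2]

lemma ts_lip (f : TSpan X) (x y : X) : f.1 x ≤ f.1 y + dist x y := by
  apply le_of_forall_pos_le_add
  intro ε hε
  obtain ⟨z, hz⟩ := f.2.2 x ε hε
  have h1 := f.2.1 y z
  have h2 := dist_triangle x y z
  linarith

lemma ts_bdd (f g : TSpan X) : BddAbove (range fun x => |f.1 x - g.1 x|) := by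
  rcases isEmpty_or_nonempty X with h | ⟨⟨x0⟩⟩
  · exact ⟨0, by rintro _ ⟨x, rfl⟩; exact (h.false x).elim⟩
  refine ⟨f.1 x0 + g.1 x0, ?_⟩
  rintro _ ⟨x, rfl⟩
  simp only
  have h1 := ts_lip f x x0
  have h2 := ts_lip g x x0
  have h3 := f.2.1 x x0
  have h4 := g.2.1 x x0
  rw [abs_le]; constructor <;> linarith

instance TSpan.metric [Nonempty X] : MetricSpace (TSpan X) where
  dist f g := ⨆ x, |f.1 x - g.1 x|
  dist_self f := by simp
  dist_comm f g := by simp only [abs_sub_comm]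
  dist_triangle f g h := by
    apply ciSup_le
    intro x
    have h1 := le_ciSup (ts_bdd f g) x
    have h2 := le_ciSup (ts_bdd g h) x
    have h3 := abs_sub_le (f.1 x) (g.1 x) (h.1 x)
    linarith
  eq_of_dist_eq_zero := by
    intro f g h
    apply TSpan.ext
    funext x
    have h1 := le_ciSup (ts_bdd f g) x
    have h2 : (⨆ x, |f.1 x - g.1 x|) = 0 := h
    rw [h2] at h1
    have := abs_nonpos_iff.1 h1
    linarith

variable [Nonempty X]

lemma ts_dist_ge (f g : TSpan X) (x : X) : |f.1 x - g.1 x| ≤ dist f g := le_ciSup (ts_bdd f g) x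

lemma ts_dist_le (f g : TSpan X) (C : ℝ) (h : ∀ x, |f.1 x - g.1 x| ≤ C) : dist f g ≤ C :=
  ciSup_le h

lemma ts_geodesic : GeodesicSpace (TSpan X) := by
  intro f g
  by_cases hD : dist f g = 0
  · refine ⟨fun _ => f, rfl, dist_eq_zero.1 hD, ?_⟩
    intro s hs t ht
    rw [hD] at hs ht
    have h1 : s = 0 := le_antisymm hs.2 hs.1
    have h2 : t = 0 := le_antisymm ht.2 ht.1
    simp [h1, h2]
  have hD' : 0 < dist f g := lt_of_le_of_ne dist_nonneg (Ne.symm hD)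
  set D := dist f g with hDdef
  let c : ℝ → X → ℝ := fun s x => (1 - s / D) * f.1 x + (s / D) * g.1 x
  have hc : ∀ s ∈ Icc 0 D, TSA (c s) := by
    intro s hs x y
    have h1 := f.2.1 x y
    have h2 := g.2.1 x y
    have h3 : 0 ≤ s / D := div_nonneg hs.1 hD'.le
    have h4 : 0 ≤ 1 - s / D := by
      have : s / D ≤ 1 := by rw [div_le_one hD']; exact hs.2
      linarith
    have := mul_le_mul_of_nonneg_left h1 h4
    have := mul_le_mul_of_nonneg_left h2 h3
    simp only [c]
    nlinarith
  have hl : ∀ s t x, |c s x - c t x| ≤ |s - t| := by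
    intro s t x
    have : c s x - c t x = (s - t) * ((g.1 x - f.1 x) / D) := by
      simp only [c]; field_simp; ring
    rw [this, abs_mul, abs_div, abs_of_pos hD']
    have h1 := ts_dist_ge f g x
    rw [abs_sub_comm] at h1
    have : |g.1 x - f.1 x| / D ≤ 1 := by rw [div_le_one hD']; exact h1
    calc |s - t| * (|g.1 x - f.1 x| / D) ≤ |s - t| * 1 := by gcongr
      _ = _ := mul_one _
  let γ : ℝ → TSpan X := fun s => if h : s ∈ Icc 0 D then ⟨tsP (c s), tsP_mem (hc s h)⟩ else f
  have hγ : ∀ s, ∀ h : s ∈ Icc 0 D, γ s = ⟨tsP (c s), tsP_mem (hc s h)⟩ := fun s h => dif_pos h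
  have h0m : (0:ℝ) ∈ Icc 0 D := ⟨le_rfl, hD'.le⟩
  have hDm : D ∈ Icc 0 D := ⟨hD'.le, le_rfl⟩
  have e0 : γ 0 = f := by
    rw [hγ 0 h0m]
    apply TSpan.ext
    have : c 0 = f.1 := by funext x; simp [c]
    simp only [this, tsP_fix]
  have eD : γ D = g := by
    rw [hγ D hDm]
    apply TSpan.ext
    have : c D = g.1 := by funext x; simp [c, div_self hD]
    simp only [this, tsP_fix]
  have hle : ∀ s ∈ Icc 0 D, ∀ t ∈ Icc 0 D, dist (γ s) (γ t) ≤ |s - t| := by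
    intro s hs t ht
    rw [hγ s hs, hγ t ht]
    apply ts_dist_le
    intro x
    exact tsP_lip (hc s hs) (hc t ht) _ (hl s t) x
  have hlt : ∀ s ∈ Icc 0 D, ∀ t ∈ Icc 0 D, s ≤ t → dist (γ s) (γ t) = t - s := by
    intro s hs t ht hst
    apply le_antisymm
    · have := hle s hs t ht
      rwa [abs_sub_comm, abs_of_nonneg (by linarith)] at this
    · have h1 := hle 0 h0m s hs
      have h2 := hle t ht D hDm
      rw [e0, abs_sub_comm, sub_zero, abs_of_nonneg hs.1] at h1
      rw [eD, abs_sub_comm, abs_of_nonneg (by linarith [ht.2])] at h2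
      have h3 := dist_triangle4 f (γ s) (γ t) g
      linarith
  refine ⟨γ, e0, eD, ?_⟩
  intro s hs t ht
  rcases le_total s t with h | h
  · rw [hlt s hs t ht h, abs_sub_comm, abs_of_nonneg (by linarith)]
  · rw [dist_comm, hlt t ht s hs h, abs_of_nonneg (by linarith)]

lemma ts_dist_approx (f g : TSpan X) (ε : ℝ) (hε : 0 < ε) :
    ∃ x y, dist f g ≤ dist x y - f.1 x - g.1 y + ε := by
  obtain ⟨x, hx⟩ := exists_lt_of_lt_ciSup (show dist f g - ε/2 < ⨆ x, |f.1 x - g.1 x| by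
      have : dist f g = ⨆ x, |f.1 x - g.1 x| := rfl
      linarith)
  rcases le_total (f.1 x) (g.1 x) with h | h
  · rw [abs_of_nonpos (by linarith)] at hx
    obtain ⟨z, hz⟩ := g.2.2 x (ε/2) (by linarith)
    exact ⟨x, z, by linarith⟩
  · rw [abs_of_nonneg (by linarith)] at hx
    obtain ⟨z, hz⟩ := f.2.2 x (ε/2) (by linarith)
    refine ⟨z, x, ?_⟩
    rw [dist_comm z x]; linarith

lemma ts_dist_lower (f g : TSpan X) (x y : X) : dist x y - f.1 x - g.1 y ≤ dist f g := by
  have h1 := abs_le.1 (ts_dist_ge f g x)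
  have h2 := g.2.1 x y
  linarith

lemma ts_hyp (δ : ℝ) (h4 : ∀ x y z w : X, dist x y + dist z w ≤
    max (dist x z + dist y w) (dist x w + dist y z) + 2 * δ) : GromovHyperbolic (TSpan X) δ := by
  intro f1 f2 f3 f4
  apply le_of_forall_pos_le_add
  intro ε hε
  obtain ⟨x, y, h1⟩ := ts_dist_approx f1 f2 (ε/2) (by linarith)
  obtain ⟨z, w, h2⟩ := ts_dist_approx f3 f4 (ε/2) (by linarith)
  have h := h4 x y z w
  have a1 := ts_dist_lower f1 f3 x z
  have a2 := ts_dist_lower f2 f4 y w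
  have a3 := ts_dist_lower f1 f4 x w
  have a4 := ts_dist_lower f2 f3 y z
  rcases max_cases (dist x z + dist y w) (dist x w + dist y z) with ⟨e, _⟩ | ⟨e, _⟩ <;> rw [e] at h
  · have := le_max_left (dist f1 f3 + dist f2 f4) (dist f1 f4 + dist f2 f3)
    linarith
  · have := le_max_right (dist f1 f3 + dist f2 f4) (dist f1 f4 + dist f2 f3)
    linarith

def tsPt (x : X) : TSpan X := ⟨fun y => dist x y, fun a b => by
    have := dist_triangle_left a b x; exact this, fun a ε hε => ⟨x, by
    simp only [dist_self, dist_comm a x]; linarith⟩⟩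

lemma tsPt_dist (f : TSpan X) (x : X) : dist f (tsPt x) ≤ f.1 x := by
  apply ts_dist_le
  intro y
  have h1 := ts_lip f y x
  have h2 := f.2.1 x y
  rw [dist_comm y x] at h1
  simp only [tsPt]
  rw [abs_le]; constructor <;> linarith

lemma tsPt_dist_pt (x y : X) : dist (tsPt x) (tsPt y) = dist x y := by
  apply le_antisymm
  · exact tsPt_dist (tsPt x) y
  · have := ts_dist_lower (tsPt x) (tsPt y) x y
    simpa [tsPt] using this

lemma ts_cobdd (δ c : ℝ) (hδ : 0 ≤ δ) (hc : 0 ≤ c) (h4 : ∀ x y z w : X, dist x y + dist z w ≤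
    max (dist x z + dist y w) (dist x w + dist y z) + 2 * δ)
    (hgeo : ∀ (x y : X) (s : ℝ), 0 ≤ s → s ≤ dist x y → ∃ z, dist x z ≤ s + c ∧
      dist z y ≤ dist x y - s + c) (f : TSpan X) : ∃ z, dist f (tsPt z) ≤ c + 2 * δ + 2 := by
  obtain ⟨x⟩ : Nonempty X := inferInstance
  obtain ⟨y, hy⟩ := f.2.2 x 1 one_pos
  have fx := tsA_nonneg f.2.1 x
  have fy := tsA_nonneg f.2.1 y
  have fxy := f.2.1 x y
  obtain ⟨z, hz1, hz2⟩ := hgeo x y (min (f.1 x) (dist x y)) (le_min fx dist_nonneg) (min_le_right _ _)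
  refine ⟨z, (tsPt_dist f z).trans ?_⟩
  obtain ⟨w, hw⟩ := f.2.2 z 1 one_pos
  have h := h4 z w x y
  have a1 : dist x z ≤ f.1 x + c := hz1.trans (by have := min_le_left (f.1 x) (dist x y); linarith)
  have a2 : dist z y ≤ f.1 y + c := by
    rcases min_cases (f.1 x) (dist x y) with ⟨e, _⟩ | ⟨e, _⟩ <;> rw [e] at hz2 <;> linarith
  have b1 := f.2.1 w y
  have b2 := f.2.1 w x
  rw [dist_comm z x] at h
  rcases max_cases (dist x z + dist w y) (dist z y + dist w x) with ⟨e, _⟩ | ⟨e, _⟩ <;> rw [e] at h <;>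
    linarith

end TightSpan

section TSAction
variable {G : Type u} [Group G] [PseudoMetricSpace G]

def tsActFun (hinv : ∀ g x y : G, dist (g * x) (g * y) = dist x y) (g : G) (f : TSpan G) : TSpan G :=
  ⟨fun x => f.1 (g⁻¹ * x), fun x y => by
    rw [← hinv g⁻¹ x y]; exact f.2.1 _ _, fun x ε hε => by
    obtain ⟨z, hz⟩ := f.2.2 (g⁻¹ * x) ε hε
    refine ⟨g * z, ?_⟩
    rw [← hinv g⁻¹ x (g * z)]; simp only [inv_mul_cancel_left]; exact hz⟩

def tsAct (hinv : ∀ g x y : G, dist (g * x) (g * y) = dist x y) : G →* (TSpan G ≃ᵢ TSpan G) where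
  toFun g :=
    { toFun := tsActFun hinv g
      invFun := tsActFun hinv g⁻¹
      left_inv := fun f => by apply TSpan.ext; funext x; simp [tsActFun]
      right_inv := fun f => by apply TSpan.ext; funext x; simp [tsActFun]
      isometry_toFun := by
        apply Isometry.of_dist_eq
        intro f h
        exact (Equiv.mulLeft g⁻¹).iSup_comp (g := fun x => |f.1 x - h.1 x|) }
  map_one' := by
    apply IsometryEquiv.ext; intro f; apply TSpan.ext; funext x; simp [tsActFun]
  map_mul' a b := by
    apply IsometryEquiv.ext; intro f; apply TSpan.ext; funext x
    change f.1 ((a*b)⁻¹ * x) = f.1 (b⁻¹ * (a⁻¹ * x))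
    rw [mul_inv_rev, mul_assoc]

lemma tsAct_pt (hinv : ∀ g x y : G, dist (g * x) (g * y) = dist x y) (g x : G) :
    tsAct hinv g (tsPt x) = tsPt (g * x) := by
  apply TSpan.ext; funext y
  change dist x (g⁻¹ * y) = dist (g * x) y
  rw [← hinv g, mul_inv_cancel_left]

theorem ts_main (hinv : ∀ g x y : G, dist (g * x) (g * y) = dist x y)
    (δ c : ℝ) (hδ : 0 ≤ δ) (hc : 0 ≤ c) (h4 : ∀ x y z w : G, dist x y + dist z w ≤
    max (dist x z + dist y w) (dist x w + dist y z) + 2 * δ)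
    (hgeo : ∀ (x y : G) (s : ℝ), 0 ≤ s → s ≤ dist x y → ∃ z, dist x z ≤ s + c ∧
      dist z y ≤ dist x y - s + c)
    (hac : ∀ R : ℝ, ∃ L : ℝ, ∃ N : ℕ, ∀ x y : G, L < dist x y → ∃ s : Finset G, s.card ≤ N ∧
      ∀ g : G, dist x (g * x) < R → dist y (g * y) < R → g ∈ s)
    (hunb : ∀ B : ℝ, ∃ g : G, B < dist 1 g) :
    ∃ (Y : Type u) (_ : MetricSpace Y) (ρ : G →* (Y ≃ᵢ Y)),
      HyperbolicGeodesicSpace Y ∧ IsAcylindrical ρ ∧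
      ∃ y : Y, ¬ Bornology.IsBounded (Set.range fun g : G => ρ g y) := by
  refine ⟨TSpan G, inferInstance, tsAct hinv, ⟨ts_geodesic, δ, hδ, ts_hyp δ h4⟩, ?_, tsPt 1, ?_⟩
  · intro R hR
    set C := c + 2 * δ + 2
    obtain ⟨L, N, h⟩ := hac (R + 2 * C)
    refine ⟨max L 0 + 2 * C + 1, by positivity, N, ?_⟩
    intro x y hxy
    obtain ⟨a, ha⟩ := ts_cobdd δ c hδ hc h4 hgeo x
    obtain ⟨b, hb⟩ := ts_cobdd δ c hδ hc h4 hgeo y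
    have hab : L < dist a b := by
      rw [← tsPt_dist_pt]
      have := dist_triangle4 x (tsPt a) (tsPt b) y
      rw [dist_comm (tsPt b) y] at this
      have := le_max_left L 0
      linarith
    obtain ⟨s, hs, hs'⟩ := h a b hab
    have key : ∀ (x : TSpan G) (a : G), dist x (tsPt a) ≤ C → ∀ g, dist x (tsAct hinv g x) < R →
        dist a (g * a) < R + 2 * C := by
      intro x a ha g hg
      have h1 := dist_triangle4 (tsPt a) x (tsAct hinv g x) (tsAct hinv g (tsPt a))
      rw [(tsAct hinv g).isometry.dist_eq, tsAct_pt, tsPt_dist_pt, dist_comm (tsPt a) x] at h1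
      linarith
    exact ⟨s, hs, fun g h1 h2 => hs' g (key x a ha g h1) (key y b hb g h2)⟩
  · intro hb
    obtain ⟨B, hB⟩ := Metric.isBounded_iff.1 hb
    obtain ⟨g, hg⟩ := hunb B
    have := hB ⟨1, rfl⟩ ⟨g, rfl⟩
    simp only [tsAct_pt, tsPt_dist_pt, mul_one] at this
    linarith

end TSAction

section Walls
variable {G : Type u} {S : Type v}

structure CutSys (C : Set (Set G)) : Prop where
  nest : ∀ E ∈ C, ∀ E' ∈ C, E ⊆ E' ∨ E' ⊆ E ∨ (∀ x, ¬ (x ∈ E ∧ x ∈ E')) ∨ (∀ x, x ∈ E ∨ x ∈ E')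
  fin : ∀ x y, {E | E ∈ C ∧ x ∉ E ∧ y ∈ E}.Finite
  c3 : ∀ E ∈ C, ∀ x y, x ∉ E → y ∈ E → ∃ z, ∀ E' ∈ C,
    (z ∈ E' → x ∉ E' → E ⊆ E') ∧ (z ∉ E' → y ∈ E' → E' ⊆ E)

structure ThickW (C : Set (Set G)) (U V e : S → Set G) (bar : S → S) : Prop extends CutSys C where
  eC : ∀ σ, e σ ∈ C
  Ve : ∀ σ, V σ ⊆ e σ
  eU : ∀ σ, e σ ⊆ U σ
  ne : ∀ σ, ¬ U σ ⊆ e σ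
  barU : ∀ σ, U (bar σ) = (V σ)ᶜ
  barV : ∀ σ, V (bar σ) = (U σ)ᶜ

def wLt (U V : S → Set G) (σ τ : S) : Prop := U τ ⊆ V σ

def WChain (U V : S → Set G) (x y : G) (l : List S) : Prop :=
  l.Pairwise (wLt U V) ∧ ∀ σ ∈ l, x ∉ U σ ∧ y ∈ V σ

def wD (U V : S → Set G) (x y : G) : ℕ := sSup {n | ∃ l, WChain U V x y l ∧ l.length = n}

variable {C : Set (Set G)} {U V e : S → Set G} {bar : S → S}

lemma ThickW.bdd (W : ThickW C U V e bar) (x y : G) :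
    BddAbove {n | ∃ l, WChain U V x y l ∧ l.length = n} := by
  classical
  refine ⟨(W.fin x y).toFinset.card, ?_⟩
  rintro _ ⟨l, hl, rfl⟩
  have hn : (l.map e).Nodup := by
    rw [List.Nodup, List.pairwise_map]
    refine hl.1.imp ?_
    intro a b hab heq
    apply W.ne b
    rw [← heq]
    exact hab.trans (W.Ve a)
  have : (l.map e).toFinset ⊆ (W.fin x y).toFinset := by
    intro E hE
    simp only [List.mem_toFinset, List.mem_map] at hE
    obtain ⟨σ, hσ, rfl⟩ := hE
    simp only [Finite.mem_toFinset, mem_ofPred_eq]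
    exact ⟨W.eC σ, fun h => (hl.2 σ hσ).1 (W.eU σ h), W.Ve σ (hl.2 σ hσ).2⟩
  have h2 := Finset.card_le_card this
  rwa [List.toFinset_card_of_nodup hn, List.length_map] at h2

lemma ThickW.le_D (W : ThickW C U V e bar) {x y : G} {l : List S} (h : WChain U V x y l) :
    l.length ≤ wD U V x y := le_csSup (W.bdd x y) ⟨l, h, rfl⟩

lemma ThickW.exists_D (W : ThickW C U V e bar) (x y : G) :
    ∃ l, WChain U V x y l ∧ l.length = wD U V x y :=
  Nat.sSup_mem (s := {n | ∃ l, WChain U V x y l ∧ l.length = n})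
    ⟨0, [], ⟨List.Pairwise.nil, by simp⟩, rfl⟩ (W.bdd x y)

lemma ThickW.VU (W : ThickW C U V e bar) (σ : S) : V σ ⊆ U σ := (W.Ve σ).trans (W.eU σ)

lemma ThickW.D_symm_le (W : ThickW C U V e bar) (x y : G) : wD U V x y ≤ wD U V y x := by
  obtain ⟨l, hl, hlen⟩ := W.exists_D x y
  rw [← hlen]
  have : WChain U V y x (l.map bar).reverse := by
    constructor
    · rw [List.pairwise_reverse, List.pairwise_map]
      refine hl.1.imp ?_
      intro a b hab
      rw [wLt, W.barU, W.barV, compl_subset_compl]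
      exact hab
    · intro σ hσ
      simp only [List.mem_reverse, List.mem_map] at hσ
      obtain ⟨a, ha, rfl⟩ := hσ
      rw [W.barU, W.barV]
      have := hl.2 a ha
      simp [this.1, this.2]
  simpa using W.le_D this

lemma ThickW.D_symm (W : ThickW C U V e bar) (x y : G) : wD U V x y = wD U V y x :=
  le_antisymm (W.D_symm_le x y) (W.D_symm_le y x)

lemma WChain.sub {x y : G} {l l' : List S} (h : l.Pairwise (wLt U V)) (hs : l'.Sublist l)
    (h2 : ∀ σ ∈ l', x ∉ U σ ∧ y ∈ V σ) : WChain U V x y l' := ⟨h.sublist hs, h2⟩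

lemma filter3 {α : Type*} (p q r : α → Bool) (l : List α) (h : ∀ a ∈ l, p a = true ∨ q a = true ∨ r a = true) :
    l.length ≤ (l.filter p).length + (l.filter q).length + (l.filter r).length := by
  induction l with
  | nil => simp
  | cons a l ih =>
    have h1 := ih fun b hb => h b (List.mem_cons_of_mem _ hb)
    have h2 := h a List.mem_cons_self
    simp only [List.filter_cons, List.length_cons]
    have k1 : (List.filter p l).length ≤ (if p a = true then a :: List.filter p l else List.filter p l).length := by split <;> simp
    have k2 : (List.filter q l).length ≤ (if q a = true then a :: List.filter q l else List.filter q l).length := by split <;> simp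
    have k3 : (List.filter r l).length ≤ (if r a = true then a :: List.filter r l else List.filter r l).length := by split <;> simp
    rcases h2 with h2 | h2 | h2
    · rw [if_pos h2] at k1 ⊢; simp only [List.length_cons] at *; omega
    · rw [if_pos h2] at k2 ⊢; simp only [List.length_cons] at *; omega
    · rw [if_pos h2] at k3 ⊢; simp only [List.length_cons] at *; omega

lemma ThickW.D_tri (W : ThickW C U V e bar) (x m y : G) :
    wD U V x y ≤ wD U V x m + wD U V m y + 1 := by
  classical
  obtain ⟨l, hl, hlen⟩ := W.exists_D x y
  have h0 := filter3 (fun σ => decide (m ∈ V σ)) (fun σ => decide (m ∉ U σ))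
    (fun σ => decide (m ∈ U σ ∧ m ∉ V σ)) l (by intro a _; simp only [decide_eq_true_eq]; tauto)
  have h1 := W.le_D (WChain.sub (x := x) (y := m) hl.1 (List.filter_sublist (p := fun σ => decide (m ∈ V σ)))
    (by intro σ hσ; rw [List.mem_filter] at hσ; exact ⟨(hl.2 σ hσ.1).1, by simpa using hσ.2⟩))
  have h2 := W.le_D (WChain.sub (x := m) (y := y) hl.1 (List.filter_sublist (p := fun σ => decide (m ∉ U σ)))
    (by intro σ hσ; rw [List.mem_filter] at hσ; exact ⟨by simpa using hσ.2, (hl.2 σ hσ.1).2⟩))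
  have h3 : (l.filter (fun σ => decide (m ∈ U σ ∧ m ∉ V σ))).length ≤ 1 := by
    have hp := hl.1.sublist (List.filter_sublist (p := (fun σ => decide (m ∈ U σ ∧ m ∉ V σ))))
    have hm : ∀ σ ∈ l.filter (fun σ => decide (m ∈ U σ ∧ m ∉ V σ)), m ∈ U σ ∧ m ∉ V σ := by
      intro σ hσ; rw [List.mem_filter] at hσ; simpa using hσ.2
    generalize l.filter (fun σ => decide (m ∈ U σ ∧ m ∉ V σ)) = l3 at hp hm
    match l3, hp, hm with
    | [], _, _ => simp
    | [a], _, _ => simp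
    | a :: b :: t, hp, hm =>
      exfalso
      have hab : wLt U V a b := (List.pairwise_cons.1 hp).1 b (by simp)
      exact (hm a (by simp)).2 (hab (hm b (by simp)).1)
  omega

lemma dropLast_rel {α : Type*} {R : α → α → Prop} {l : List α} (h : l.Pairwise R) :
    ∀ a ∈ l.dropLast, ∃ b ∈ l, R a b := by
  rcases List.eq_nil_or_concat l with rfl | ⟨l', b, rfl⟩
  · simp
  · intro a ha
    rw [List.concat_eq_append, List.dropLast_concat] at ha
    rw [List.concat_eq_append, List.pairwise_append] at h
    exact ⟨b, by simp, h.2.2 a ha b (by simp)⟩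

lemma tail_rel {α : Type*} {R : α → α → Prop} {l : List α} (h : l.Pairwise R) :
    ∀ b ∈ l.tail, ∃ a ∈ l, R a b := by
  cases l with
  | nil => simp
  | cons a l => intro b hb; exact ⟨a, by simp, (List.pairwise_cons.1 h).1 b hb⟩

lemma ThickW.join (W : ThickW C U V e bar) {x y : G} {l1 l2 : List S} (h1 : l1.Pairwise (wLt U V))
    (h2 : l2.Pairwise (wLt U V)) (a1 : ∀ a ∈ l1, x ∉ U a ∧ y ∈ e a) (a2 : ∀ b ∈ l2, x ∉ e b ∧ y ∈ V b)
    (a3 : ∀ a ∈ l1, ∀ b ∈ l2, e b ⊆ e a) : l1.length + l2.length ≤ wD U V x y + 2 := by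
  have key : WChain U V x y (l1.dropLast ++ l2.tail) := by
    constructor
    · rw [List.pairwise_append]
      refine ⟨h1.sublist (List.dropLast_sublist _), h2.sublist (List.tail_sublist _), ?_⟩
      intro a ha b hb
      obtain ⟨a', ha', haa⟩ := dropLast_rel h1 a ha
      obtain ⟨b0, hb0, hbb⟩ := tail_rel h2 b hb
      exact (((hbb.trans (W.Ve b0)).trans (a3 a' ha' b0 hb0)).trans (W.eU a')).trans haa
    · intro σ hσ
      rcases List.mem_append.1 hσ with h | h
      · obtain ⟨a', ha', haa⟩ := dropLast_rel h1 σ h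
        exact ⟨(a1 σ (List.mem_of_mem_dropLast h)).1, haa (W.eU a' (a1 a' ha').2)⟩
      · obtain ⟨b0, hb0, hbb⟩ := tail_rel h2 σ h
        exact ⟨fun hx => (a2 b0 hb0).1 (W.Ve b0 (hbb hx)), (a2 σ (List.mem_of_mem_tail h)).2⟩
  have := W.le_D key
  simp only [List.length_append, List.length_dropLast, List.length_tail] at this
  omega

lemma filter2 {α : Type*} (p q : α → Bool) (l : List α) (h : ∀ a ∈ l, p a = true ∨ q a = true) :
    l.length ≤ (l.filter p).length + (l.filter q).length := by
  have := filter3 p q (fun _ => false) l (by intro a ha; have := h a ha; tauto)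
  simpa using this

lemma CutSys.sub (W : CutSys C) {E E' : Set G} (hE : E ∈ C) (hE' : E' ∈ C) {x y w : G} (hy : y ∈ E' ∧ y ∉ E)
    (hw : w ∈ E ∧ w ∈ E') (hx : x ∉ E ∧ x ∉ E') : E ⊆ E' := by
  rcases W.nest E hE E' hE' with h | h | h | h
  · exact h
  · exact absurd (h hy.1) hy.2
  · exact absurd hw (h w)
  · have := h x; tauto

lemma ThickW.four_aux (W : ThickW C U V e bar) (x y z w : G)
    (h : ∀ E ∈ C, ¬ (y ∈ E ∧ z ∈ E ∧ x ∉ E ∧ w ∉ E) ∧ ¬ (x ∈ E ∧ w ∈ E ∧ y ∉ E ∧ z ∉ E)) :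
    wD U V x y + wD U V z w ≤ wD U V x w + wD U V z y + 4 := by
  classical
  obtain ⟨l, hl, hlen⟩ := W.exists_D x y
  obtain ⟨l', hl', hlen'⟩ := W.exists_D z w
  have g : ∀ a ∈ l, x ∉ U a ∧ x ∉ e a ∧ y ∈ V a ∧ y ∈ e a := fun a ha =>
    ⟨(hl.2 a ha).1, fun h => (hl.2 a ha).1 (W.eU a h), (hl.2 a ha).2, W.Ve a (hl.2 a ha).2⟩
  have g' : ∀ a ∈ l', z ∉ U a ∧ z ∉ e a ∧ w ∈ V a ∧ w ∈ e a := fun a ha =>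
    ⟨(hl'.2 a ha).1, fun h => (hl'.2 a ha).1 (W.eU a h), (hl'.2 a ha).2, W.Ve a (hl'.2 a ha).2⟩
  have f1 : ∀ a ∈ l.filter (fun σ => decide (w ∈ e σ)), a ∈ l ∧ w ∈ e a := by
    intro a ha; rw [List.mem_filter] at ha; simpa using ha
  have f2 : ∀ a ∈ l.filter (fun σ => decide (w ∉ e σ)), a ∈ l ∧ w ∉ e a := by
    intro a ha; rw [List.mem_filter] at ha; simpa using ha
  have f1' : ∀ a ∈ l'.filter (fun σ => decide (y ∈ e σ)), a ∈ l' ∧ y ∈ e a := by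
    intro a ha; rw [List.mem_filter] at ha; simpa using ha
  have f2' : ∀ a ∈ l'.filter (fun σ => decide (y ∉ e σ)), a ∈ l' ∧ y ∉ e a := by
    intro a ha; rw [List.mem_filter] at ha; simpa using ha
  have j1 := W.join (x := x) (y := w) (hl.1.sublist (List.filter_sublist (p := (fun σ => decide (w ∈ e σ)))))
    (hl'.1.sublist (List.filter_sublist (p := (fun σ => decide (y ∉ e σ)))))
    (fun a ha => ⟨(g a (f1 a ha).1).1, (f1 a ha).2⟩)
    (fun b hb => by
      have h1 := f2' b hb
      have h2 := g' b h1.1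
      have h3 := h (e b) (W.eC b)
      exact ⟨by tauto, by tauto⟩)
    (fun a ha b hb => by
      have h1 := f2' b hb
      have h2 := g' b h1.1
      have h3 := h (e b) (W.eC b)
      have h4 := g a (f1 a ha).1
      have h5 := f1 a ha
      exact W.sub (x := x) (y := y) (w := w) (W.eC b) (W.eC a) (by tauto) (by tauto) (by tauto))
  have j2 := W.join (x := z) (y := y)
    (hl'.1.sublist (List.filter_sublist (p := (fun σ => decide (y ∈ e σ)))))
    (hl.1.sublist (List.filter_sublist (p := (fun σ => decide (w ∉ e σ)))))
    (fun a ha => ⟨(g' a (f1' a ha).1).1, (f1' a ha).2⟩)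
    (fun b hb => by
      have h1 := f2 b hb
      have h2 := g b h1.1
      have h3 := h (e b) (W.eC b)
      exact ⟨by tauto, by tauto⟩)
    (fun a ha b hb => by
      have h1 := f2 b hb
      have h2 := g b h1.1
      have h3 := h (e b) (W.eC b)
      have h4 := g' a (f1' a ha).1
      have h5 := f1' a ha
      exact W.sub (x := z) (y := w) (w := y) (W.eC b) (W.eC a) (by tauto) (by tauto) (by tauto))
  have k1 := filter2 (fun σ => decide (w ∈ e σ)) (fun σ => decide (w ∉ e σ)) l
    (by intro a _; simp only [decide_eq_true_eq]; tauto)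
  have k2 := filter2 (fun σ => decide (y ∈ e σ)) (fun σ => decide (y ∉ e σ)) l'
    (by intro a _; simp only [decide_eq_true_eq]; tauto)
  omega

lemma ThickW.four (W : ThickW C U V e bar) (x y z w : G) :
    wD U V x y + wD U V z w ≤ max (wD U V x z + wD U V y w) (wD U V x w + wD U V y z) + 4 := by
  by_cases h : ∀ E ∈ C, ¬ (y ∈ E ∧ z ∈ E ∧ x ∉ E ∧ w ∉ E) ∧ ¬ (x ∈ E ∧ w ∈ E ∧ y ∉ E ∧ z ∉ E)
  · have := W.four_aux x y z w h
    have := W.D_symm y z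
    omega
  · have h' : ∀ E ∈ C, ¬ (y ∈ E ∧ w ∈ E ∧ x ∉ E ∧ z ∉ E) ∧ ¬ (x ∈ E ∧ z ∈ E ∧ y ∉ E ∧ w ∉ E) := by
      push Not at h
      obtain ⟨E, hE, hh⟩ := h
      intro E' hE'
      rcases W.nest E hE E' hE' with h | h | h | h
      · have h1 := @h x; have h2 := @h y; have h3 := @h z; have h4 := @h w; tauto
      · have h1 := @h x; have h2 := @h y; have h3 := @h z; have h4 := @h w; tauto
      · have h1 := h x; have h2 := h y; have h3 := h z; have h4 := h w; tauto
      · have h1 := h x; have h2 := h y; have h3 := h z; have h4 := h w; tauto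
    have := W.four_aux x y w z h'
    have := W.D_symm w z
    have := W.D_symm y w
    omega

lemma ThickW.geo (W : ThickW C U V e bar) (x y : G) (i : ℕ) (hi : i < wD U V x y) :
    ∃ z, wD U V x z ≤ i + 2 ∧ wD U V z y + i ≤ wD U V x y + 1 := by
  obtain ⟨l, hl, hlen⟩ := W.exists_D x y
  have hil : i < l.length := by omega
  have g : ∀ a ∈ l, x ∉ U a ∧ x ∉ e a ∧ y ∈ V a ∧ y ∈ e a := fun a ha =>
    ⟨(hl.2 a ha).1, fun h => (hl.2 a ha).1 (W.eU a h), (hl.2 a ha).2, W.Ve a (hl.2 a ha).2⟩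
  have gi := g l[i] (List.getElem_mem _)
  obtain ⟨z, hz⟩ := W.c3 (e l[i]) (W.eC _) x y gi.2.1 gi.2.2.2
  have hmono : ∀ j k (hj : j < l.length) (hk : k < l.length), j ≤ k → e l[k] ⊆ e l[j] := by
    intro j k hj hk hjk
    rcases hjk.eq_or_lt with rfl | hlt
    · exact subset_rfl
    · exact ((W.eU _).trans (List.pairwise_iff_getElem.1 hl.1 j k hj hk hlt)).trans (W.Ve _)
  refine ⟨z, ?_, ?_⟩
  · obtain ⟨m, hm, hmlen⟩ := W.exists_D x z
    have hE : ∀ a ∈ m, e l[i] ⊆ e a := fun a ha => (hz (e a) (W.eC a)).1 (W.Ve a (hm.2 a ha).2)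
      (fun h => (hm.2 a ha).1 (W.eU a h))
    have := W.join (x := x) (y := y) hm.1 (hl.1.sublist (List.drop_sublist i l))
      (fun a ha => ⟨(hm.2 a ha).1, hE a ha gi.2.2.2⟩)
      (fun b hb => ⟨(g b (List.mem_of_mem_drop hb)).2.1, (g b (List.mem_of_mem_drop hb)).2.2.1⟩)
      (fun a ha b hb => by
        obtain ⟨k, hk, rfl⟩ := List.mem_drop_iff_getElem.1 hb
        exact (hmono i (i + k) hil (by omega) (by omega)).trans (hE a ha))
    rw [List.length_drop] at this
    omega
  · obtain ⟨m, hm, hmlen⟩ := W.exists_D z y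
    have hE : ∀ a ∈ m, e a ⊆ e l[i] := fun a ha => (hz (e a) (W.eC a)).2
      (fun h => (hm.2 a ha).1 (W.eU a h)) (W.Ve a (hm.2 a ha).2)
    have := W.join (x := x) (y := y) (hl.1.sublist (List.take_sublist (i+1) l)) hm.1
      (fun b hb => ⟨(g b (List.mem_of_mem_take hb)).1, (g b (List.mem_of_mem_take hb)).2.2.2⟩)
      (fun a ha => ⟨fun h => gi.2.1 (hE a ha h), (hm.2 a ha).2⟩)
      (fun a ha b hb => by
        obtain ⟨k, hk, rfl⟩ := List.mem_take_iff_getElem.1 ha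
        exact (hE b hb).trans (hmono k i (by omega) hil (by omega)))
    rw [List.length_take] at this
    omega

lemma ThickW.D_self (W : ThickW C U V e bar) (x : G) : wD U V x x = 0 := by
  obtain ⟨l, hl, hlen⟩ := W.exists_D x x
  cases l with
  | nil => simpa using hlen.symm
  | cons a t => have := hl.2 a (by simp); exact absurd (W.VU a this.2) this.1

open Classical in
@[reducible] def ThickW.pm (W : ThickW C U V e bar) : PseudoMetricSpace G where
  dist x y := if x = y then 0 else (wD U V x y : ℝ) + 1
  dist_self x := if_pos rfl
  dist_comm x y := by
    by_cases h : x = y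
    · simp [h]
    · rw [if_neg h, if_neg (Ne.symm h), W.D_symm]
  dist_triangle x y z := by
    by_cases h1 : x = y
    · simp [h1]
    by_cases h2 : y = z
    · simp [h2]
    rw [if_neg h1, if_neg h2]
    have := W.D_tri x y z
    have h3 : (wD U V x z : ℝ) ≤ wD U V x y + wD U V y z + 1 := by exact_mod_cast this
    split_ifs
    · positivity
    · linarith

theorem ThickW.main [Group G] (W : ThickW C U V e bar) (act : G → S → S)
    (hU : ∀ g σ x, g * x ∈ U (act g σ) ↔ x ∈ U σ) (hV : ∀ g σ x, g * x ∈ V (act g σ) ↔ x ∈ V σ)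
    (hac : ∀ R : ℕ, ∃ L N : ℕ, ∀ x y : G, L < wD U V x y → ∃ s : Finset G, s.card ≤ N ∧
      ∀ g : G, wD U V x (g * x) ≤ R → wD U V y (g * y) ≤ R → g ∈ s)
    (hunb : ∀ B : ℕ, ∃ g : G, B < wD U V 1 g) :
    ∃ (Y : Type u) (_ : MetricSpace Y) (ρ : G →* (Y ≃ᵢ Y)),
      HyperbolicGeodesicSpace Y ∧ IsAcylindrical ρ ∧
      ∃ y : Y, ¬ Bornology.IsBounded (Set.range fun g : G => ρ g y) := by
  classical
  have hDle : ∀ g x y, wD U V x y ≤ wD U V (g * x) (g * y) := by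
    intro g x y
    obtain ⟨l, hl, hlen⟩ := W.exists_D x y
    rw [← hlen]
    have : WChain U V (g * x) (g * y) (l.map (act g)) := by
      constructor
      · rw [List.pairwise_map]
        refine hl.1.imp ?_
        intro a b hab z hz
        have h1 := hU g b (g⁻¹ * z)
        have h2 := hV g a (g⁻¹ * z)
        rw [mul_inv_cancel_left] at h1 h2
        exact h2.2 (hab (h1.1 hz))
      · intro σ hσ
        obtain ⟨a, ha, rfl⟩ := List.mem_map.1 hσ
        rw [hU, hV]; exact hl.2 a ha
    simpa using W.le_D this
  have hD : ∀ g x y, wD U V (g * x) (g * y) = wD U V x y := by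
    intro g x y
    apply le_antisymm _ (hDle g x y)
    simpa using hDle g⁻¹ (g * x) (g * y)
  let _ := W.pm
  have hdist : ∀ x y : G, dist x y = if x = y then 0 else (wD U V x y : ℝ) + 1 := by
    intro x y; exact if_congr Iff.rfl rfl rfl
  have hle : ∀ x y : G, dist x y ≤ wD U V x y + 1 := by
    intro x y; rw [hdist]; split_ifs
    · positivity
    · exact le_rfl
  have hge : ∀ x y : G, (wD U V x y : ℝ) ≤ dist x y := by
    intro x y; rw [hdist]; split_ifs with h
    · rw [h, W.D_self]; simp
    · linarith
  refine ts_main ?_ 3 4 (by norm_num) (by norm_num) ?_ ?_ ?_ ?_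
  · intro g x y
    rw [hdist, hdist, hD]; simp
  · intro x y z w
    have h := W.four x y z w
    have h' : (wD U V x y : ℝ) + wD U V z w ≤ max ((wD U V x z : ℝ) + wD U V y w) ((wD U V x w : ℝ) + wD U V y z) + 4 := by
      exact_mod_cast h
    have := hle x y
    have := hle z w
    have : max ((wD U V x z : ℝ) + wD U V y w) ((wD U V x w : ℝ) + wD U V y z) ≤
        max (dist x z + dist y w) (dist x w + dist y z) :=
      max_le_max (add_le_add (hge _ _) (hge _ _)) (add_le_add (hge _ _) (hge _ _))
    linarith
  · intro x y s hs0 hs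
    have hxy := hle x y
    have hxy' := hge x y
    by_cases h0 : wD U V x y = 0
    · refine ⟨x, ?_, ?_⟩
      · rw [dist_self]; linarith
      · rw [h0, Nat.cast_zero] at hxy
        linarith
    · set r := wD U V x y with hr
      obtain ⟨z, h1, h2⟩ := W.geo x y (min ⌊s⌋₊ (r - 1)) (by omega)
      refine ⟨z, ?_, ?_⟩
      · have a1 : (wD U V x z : ℝ) ≤ (⌊s⌋₊ : ℝ) + 2 := by
          have : wD U V x z ≤ ⌊s⌋₊ + 2 := by omega
          exact_mod_cast this
        have := Nat.floor_le hs0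
        have := hle x z
        linarith
      · have a := hle z y
        rcases le_total ⌊s⌋₊ (r-1) with hc | hc
        · rw [min_eq_left hc] at h2
          have b : (wD U V z y : ℝ) + ⌊s⌋₊ ≤ r + 1 := by exact_mod_cast h2
          have := Nat.lt_floor_add_one s
          linarith
        · rw [min_eq_right hc] at h2
          have : wD U V z y ≤ 2 := by omega
          have b : (wD U V z y : ℝ) ≤ 2 := by exact_mod_cast this
          linarith
  · intro R
    obtain ⟨L, N, h⟩ := hac ⌈R⌉₊
    refine ⟨L + 1, N, ?_⟩
    intro x y hxy
    have : L < wD U V x y := by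
      have := hle x y
      have : (L : ℝ) < wD U V x y := by linarith
      exact_mod_cast this
    obtain ⟨s, hs, hs'⟩ := h x y this
    refine ⟨s, hs, fun g h1 h2 => hs' g ?_ ?_⟩
    · have : (wD U V x (g * x) : ℝ) ≤ ⌈R⌉₊ := ((hge _ _).trans h1.le).trans (Nat.le_ceil R)
      exact_mod_cast this
    · have : (wD U V y (g * y) : ℝ) ≤ ⌈R⌉₊ := ((hge _ _).trans h2.le).trans (Nat.le_ceil R)
      exact_mod_cast this
  · intro B
    obtain ⟨g, hg⟩ := hunb ⌈B⌉₊
    refine ⟨g, ?_⟩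
    have h1 : (⌈B⌉₊ : ℝ) < wD U V 1 g := by exact_mod_cast hg
    have := Nat.le_ceil B
    have := hge 1 g
    linarith

end Walls

section Acyl
variable {G : Type u} {S : Type v} {C : Set (Set G)} {U V e : S → Set G} {bar : S → S}

def wSep (U V : S → Set G) (x y : G) (σ : S) : Prop := x ∉ U σ ∧ y ∈ V σ

lemma ThickW.lt_trans (W : ThickW C U V e bar) {a b c : S} (h1 : wLt U V a b) (h2 : wLt U V b c) :
    wLt U V a c := (h2.trans (W.VU b)).trans h1

lemma ThickW.lt_irrefl (W : ThickW C U V e bar) (a : S) : ¬ wLt U V a a :=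
  fun h => W.ne a (h.trans (W.Ve a))

lemma ThickW.extract (W : ThickW C U V e bar) (c r : ℕ) (hc : 0 < c) (T : Finset S)
    (hT : ∀ a ∈ T, {b | b ∈ T ∧ ¬ wLt U V a b ∧ ¬ wLt U V b a}.encard ≤ c) (hr : c * r ≤ T.card) :
    ∃ l : List S, l.Pairwise (wLt U V) ∧ (∀ a ∈ l, a ∈ T) ∧ r ≤ l.length := by
  classical
  induction r generalizing T with
  | zero => exact ⟨[], List.Pairwise.nil, by simp, by simp⟩
  | succ r ih =>
    have hne : T.Nonempty := by
      rw [← Finset.card_pos]; nlinarith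
    obtain ⟨a, ha⟩ := hne
    set I := T.filter (fun b => ¬ wLt U V a b ∧ ¬ wLt U V b a) with hI
    have hIc : I.card ≤ c := by
      have := hT a ha
      have e1 : {b | b ∈ T ∧ ¬ wLt U V a b ∧ ¬ wLt U V b a} = (I : Set S) := by
        ext b; simp [hI]
      rw [e1, Set.encard_coe_eq_coe_finsetCard] at this
      exact_mod_cast this
    set T' := T.filter (fun b => ¬ (¬ wLt U V a b ∧ ¬ wLt U V b a)) with hT'
    have hcard : I.card + T'.card = T.card := Finset.card_filter_add_card_filter_not _
    obtain ⟨l, hl, hlT, hlen⟩ := ih T' (by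
      intro b hb
      refine le_trans (Set.encard_le_encard ?_) (hT b (Finset.mem_filter.1 hb).1)
      intro d hd
      exact ⟨(Finset.mem_filter.1 hd.1).1, hd.2⟩) (by rw [Nat.mul_succ] at hr; omega)
    have hcmp : ∀ b ∈ l, wLt U V a b ∨ wLt U V b a := by
      intro b hb
      have := (Finset.mem_filter.1 (hlT b hb)).2
      tauto
    refine ⟨l.filter (fun b => decide (wLt U V b a)) ++ a :: l.filter (fun b => decide (wLt U V a b)), ?_, ?_, ?_⟩
    · rw [List.pairwise_append, List.pairwise_cons]
      refine ⟨hl.sublist List.filter_sublist, ⟨?_, hl.sublist List.filter_sublist⟩, ?_⟩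
      · intro b hb; simpa using (List.mem_filter.1 hb).2
      · intro b hb d hd
        have h1 : wLt U V b a := by simpa using (List.mem_filter.1 hb).2
        rcases List.mem_cons.1 hd with rfl | hd
        · exact h1
        · exact W.lt_trans h1 (by simpa using (List.mem_filter.1 hd).2)
    · intro b hb
      rcases List.mem_append.1 hb with h | h
      · exact (Finset.mem_filter.1 (hlT b (List.mem_filter.1 h).1)).1
      · rcases List.mem_cons.1 h with rfl | h
        · exact ha
        · exact (Finset.mem_filter.1 (hlT b (List.mem_filter.1 h).1)).1
    · have := filter2 (fun b => decide (wLt U V b a)) (fun b => decide (wLt U V a b)) l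
        (by intro b hb; have := hcmp b hb; simp only [decide_eq_true_eq]; tauto)
      simp only [List.length_append, List.length_cons]
      omega

lemma range_chain {w : ℕ → S} {n : ℕ} {R : S → S → Prop} (hw : ∀ i j, i < j → j < n → R (w i) (w j))
    (a k : ℕ) (h : a + k ≤ n) : ((List.range' a k).map w).Pairwise R := by
  rw [List.pairwise_map]
  refine List.Pairwise.imp_of_mem ?_ (List.pairwise_lt_range' (s := a) (n := k))
  intro i j hi hj hij
  rw [List.mem_range'_1] at hj
  exact hw i j hij (by omega)

theorem ThickW.acyl [Group G] (W : ThickW C U V e bar) (act : G → S → S)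
    (hU : ∀ g σ x, g * x ∈ U (act g σ) ↔ x ∈ U σ) (hV : ∀ g σ x, g * x ∈ V (act g σ) ↔ x ∈ V σ)
    (hfree : ∀ g g' σ, act g σ = act g' σ → g = g') (c : ℕ) (hc : 0 < c)
    (hinc : ∀ x y σ, wSep U V x y σ →
      {τ | wSep U V x y τ ∧ ¬ wLt U V σ τ ∧ ¬ wLt U V τ σ}.encard ≤ c) :
    ∀ R : ℕ, ∃ L N : ℕ, ∀ x y : G, L < wD U V x y → ∃ s : Finset G, s.card ≤ N ∧
      ∀ g : G, wD U V x (g * x) ≤ R → wD U V y (g * y) ≤ R → g ∈ s := by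
  classical
  intro R
  have hDle : ∀ g x y, wD U V x y ≤ wD U V (g * x) (g * y) := by
    intro g x y
    obtain ⟨l, hl, hlen⟩ := W.exists_D x y
    rw [← hlen]
    have : WChain U V (g * x) (g * y) (l.map (act g)) := by
      constructor
      · rw [List.pairwise_map]
        refine hl.1.imp ?_
        intro a b hab z hz
        have h1 := hU g b (g⁻¹ * z)
        have h2 := hV g a (g⁻¹ * z)
        rw [mul_inv_cancel_left] at h1 h2
        exact h2.2 (hab (h1.1 hz))
      · intro σ hσ
        obtain ⟨a, ha, rfl⟩ := List.mem_map.1 hσ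
        rw [hU, hV]; exact hl.2 a ha
    simpa using W.le_D this
  set R' := R + c + 1 with hR'
  refine ⟨4 * (R + R' + c + 5), c * (2 * R'), ?_⟩
  intro x y hxy
  obtain ⟨l0, hl0, hlen0⟩ := W.exists_D x y
  set n := wD U V x y with hn
  have hpos : 0 < l0.length := by omega
  obtain ⟨w, hw, hws⟩ : ∃ w : ℕ → S, (∀ i j, i < j → j < n → wLt U V (w i) (w j)) ∧
      ∀ i < n, wSep U V x y (w i) := by
    refine ⟨fun i => if h : i < l0.length then l0[i] else l0[0], ?_, ?_⟩
    · intro i j hij hj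
      have h1 : i < l0.length := by omega
      have h2 : j < l0.length := by omega
      simp only [h1, h2, dif_pos]
      exact List.pairwise_iff_getElem.1 hl0.1 i j h1 h2 hij
    · intro i hi
      have h1 : i < l0.length := by omega
      simp only [h1, dif_pos]
      exact hl0.2 _ (List.getElem_mem _)
  have hw' : ∀ i j, i ≤ j → j < n → ∀ τ, wLt U V (w j) τ → wLt U V (w i) τ := by
    intro i j hij hj τ h
    rcases hij.eq_or_lt with rfl | h'
    · exact h
    · exact W.lt_trans (hw i j h' hj) h
  have hw'' : ∀ i j, i ≤ j → j < n → ∀ τ, wLt U V τ (w i) → wLt U V τ (w j) := by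
    intro i j hij hj τ h
    rcases hij.eq_or_lt with rfl | h'
    · exact h
    · exact W.lt_trans h (hw i j h' hj)
  have seg1 : ∀ x', wD U V x x' ≤ R → ∀ j, R + 1 ≤ j → j < n → x' ∉ U (w j) := by
    intro x' hx' j hj hjn hmem
    have : WChain U V x x' ((List.range' 0 j).map w) := by
      refine ⟨range_chain hw 0 j (by omega), ?_⟩
      intro σ hσ
      obtain ⟨i, hi, rfl⟩ := List.mem_map.1 hσ
      rw [List.mem_range'_1] at hi
      exact ⟨(hws i (by omega)).1, hw i j (by omega) hjn hmem⟩
    have := W.le_D this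
    simp at this
    omega
  have seg2 : ∀ y', wD U V y' y ≤ R → ∀ j, j + R + 1 < n → y' ∈ V (w j) := by
    intro y' hy' j hj
    by_contra hmem
    have : WChain U V y' y ((List.range' (j+1) (n - (j+1))).map w) := by
      refine ⟨range_chain hw _ _ (by omega), ?_⟩
      intro σ hσ
      obtain ⟨i, hi, rfl⟩ := List.mem_map.1 hσ
      rw [List.mem_range'_1] at hi
      exact ⟨fun h => hmem (hw j i (by omega) (by omega) h), (hws i (by omega)).2⟩
    have := W.le_D this
    simp at this
    omega
  have cmp : ∀ τ, wSep U V x y τ → ∀ a, a + c < n → wLt U V (w a) τ ∨ wLt U V τ (w (a + c)) := by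
    intro τ hτ a ha
    by_contra hcon
    push Not at hcon
    have hinj : Set.InjOn w (Set.Icc a (a+c)) := by
      intro i hi j hj hij
      by_contra hne
      rcases Nat.lt_or_gt_of_ne hne with h | h
      · have := hw i j h (by have := hj.2; omega)
        rw [hij] at this; exact W.lt_irrefl _ this
      · have := hw j i h (by have := hi.2; omega)
        rw [hij] at this; exact W.lt_irrefl _ this
    have hsub : w '' (Set.Icc a (a+c)) ⊆ {σ | wSep U V x y σ ∧ ¬ wLt U V τ σ ∧ ¬ wLt U V σ τ} := by
      rintro _ ⟨j, hj, rfl⟩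
      have hjn : j < n := by have := hj.2; omega
      refine ⟨hws j hjn, ?_, ?_⟩
      · exact fun h => hcon.2 (hw'' j (a+c) hj.2 ha τ h)
      · exact fun h => hcon.1 (hw' a j hj.1 hjn τ h)
    have h1 := (Set.encard_le_encard hsub).trans (hinc x y τ hτ)
    rw [hinj.encard_image] at h1
    have h2 : (Set.Icc a (a+c)) = ((Finset.Icc a (a+c) : Finset ℕ) : Set ℕ) := by simp
    rw [h2, Set.encard_coe_eq_coe_finsetCard, Nat.card_Icc] at h1
    have : a + c + 1 - a ≤ c := by exact_mod_cast h1
    omega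
  set Q : Set G := {q | wD U V x (q * x) ≤ R ∧ wD U V y (q * y) ≤ R} with hQ
  set m := R + R' + 2 with hm
  -- properties of q
  have qlt : ∀ q, ∀ σ τ, wLt U V σ τ → wLt U V (act q σ) (act q τ) := by
    intro g a b hab z hz
    have h1 := hU g b (g⁻¹ * z)
    have h2 := hV g a (g⁻¹ * z)
    rw [mul_inv_cancel_left] at h1 h2
    exact h2.2 (hab (h1.1 hz))
  have qsep : ∀ q ∈ Q, ∀ j, R + 1 ≤ j → j + R + 1 < n → wSep U V x y (act q (w j)) := by
    intro q hq j h1 h2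
    constructor
    · have := seg1 (q⁻¹ * x) (by
        have := hDle q x (q⁻¹ * x)
        rw [mul_inv_cancel_left] at this
        rw [W.D_symm] at this
        have a := hDle q⁻¹ x (q * x)
        have b := hDle q (q⁻¹ * x) x
        rw [mul_inv_cancel_left] at b
        have := hq.1
        have d := W.D_symm (q⁻¹ * x) x
        omega) j h1 (by omega)
      rwa [← hU q, mul_inv_cancel_left] at this
    · have := seg2 (q⁻¹ * y) (by
        have b := hDle q (q⁻¹ * y) y
        rw [mul_inv_cancel_left] at b
        have := hq.2
        omega) j h2
      rwa [← hV q, mul_inv_cancel_left] at this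
  have cl : ∀ q ∈ Q, wLt U V (w (m - R')) (act q (w m)) ∧ wLt U V (act q (w m)) (w (m + R')) := by
    intro q hq
    have hs := qsep q hq m (by omega) (by omega)
    constructor
    · rcases cmp _ hs (m - R') (by omega) with h | h
      · exact h
      · exfalso
        have : WChain U V x y (((List.range' (R+1) (m - R)).map (fun i => act q (w i))) ++
            ((List.range' (m - R' + c) (n - (m - R' + c))).map w)) := by
          constructor
          · rw [List.pairwise_append]
            refine ⟨range_chain (n := n) (fun i j h1 h2 => qlt q _ _ (hw i j h1 h2)) _ _ (by omega),
              range_chain hw _ _ (by omega), ?_⟩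
            intro a ha b hb
            obtain ⟨i, hi, rfl⟩ := List.mem_map.1 ha
            obtain ⟨j, hj, rfl⟩ := List.mem_map.1 hb
            rw [List.mem_range'_1] at hi hj
            have h1 := hw'' _ j hj.1 (by omega) _ h
            rcases (show i ≤ m by omega).eq_or_lt with rfl | hlt
            · exact h1
            · exact W.lt_trans (qlt q _ _ (hw i m hlt (by omega))) h1
          · intro σ hσ
            rcases List.mem_append.1 hσ with h | h
            · obtain ⟨i, hi, rfl⟩ := List.mem_map.1 h
              rw [List.mem_range'_1] at hi
              exact qsep q hq i (by omega) (by omega)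
            · obtain ⟨i, hi, rfl⟩ := List.mem_map.1 h
              rw [List.mem_range'_1] at hi
              exact hws i (by omega)
        have := W.le_D this
        simp at this
        omega
    · rcases cmp _ hs (m + R' - c) (by omega) with h | h
      · exfalso
        have : WChain U V x y (((List.range' 0 (m + R' - c + 1)).map w) ++
            ((List.range' m (n - R - 1 - m)).map (fun i => act q (w i)))) := by
          constructor
          · rw [List.pairwise_append]
            refine ⟨range_chain hw _ _ (by omega),
              range_chain (n := n) (fun i j h1 h2 => qlt q _ _ (hw i j h1 h2)) _ _ (by omega), ?_⟩
            intro a ha b hb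
            obtain ⟨i, hi, rfl⟩ := List.mem_map.1 ha
            obtain ⟨j, hj, rfl⟩ := List.mem_map.1 hb
            rw [List.mem_range'_1] at hi hj
            have h1 := hw' i _ (show i ≤ m + R' - c by omega) (by omega) _ h
            rcases hj.1.eq_or_lt with rfl | hlt
            · exact h1
            · exact W.lt_trans h1 (qlt q _ _ (hw m j hlt (by omega)))
          · intro σ hσ
            rcases List.mem_append.1 hσ with h | h
            · obtain ⟨i, hi, rfl⟩ := List.mem_map.1 h
              rw [List.mem_range'_1] at hi
              exact hws i (by omega)
            · obtain ⟨i, hi, rfl⟩ := List.mem_map.1 h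
              rw [List.mem_range'_1] at hi
              exact qsep q hq i (by omega) (by omega)
        have := W.le_D this
        simp at this
        omega
      · rwa [show m + R' - c + c = m + R' by omega] at h
  have bound : ∀ s : Finset G, (∀ q ∈ s, q ∈ Q) → s.card < c * (2 * R') := by
    intro s hs
    by_contra hcon
    push Not at hcon
    have hcard : (s.image (fun q => act q (w m))).card = s.card :=
      Finset.card_image_of_injective _ (fun a b h => hfree a b _ h)
    obtain ⟨l, hl, hlT, hlen⟩ := W.extract c (2 * R') hc (s.image (fun q => act q (w m))) (by
      intro a ha
      obtain ⟨q, hq, rfl⟩ := Finset.mem_image.1 ha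
      refine le_trans (Set.encard_le_encard ?_) (hinc x y _ (qsep q (hs q hq) m (by omega) (by omega)))
      intro b hb
      obtain ⟨q', hq', rfl⟩ := Finset.mem_image.1 hb.1
      exact ⟨qsep q' (hs q' hq') m (by omega) (by omega), hb.2⟩) (by rw [hcard]; exact hcon)
    have hl' : ∀ a ∈ l, ∃ q ∈ Q, a = act q (w m) := by
      intro a ha
      obtain ⟨q, hq, rfl⟩ := Finset.mem_image.1 (hlT a ha)
      exact ⟨q, hs q hq, rfl⟩
    have : WChain U V x y (((List.range' 0 (m - R' + 1)).map w) ++ (l ++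
            ((List.range' (m + R') (n - (m + R'))).map w))) := by
      constructor
      · rw [List.pairwise_append, List.pairwise_append]
        refine ⟨range_chain hw _ _ (by omega), ⟨hl, range_chain hw _ _ (by omega), ?_⟩, ?_⟩
        · intro a ha b hb
          obtain ⟨q, hq, rfl⟩ := hl' a ha
          obtain ⟨j, hj, rfl⟩ := List.mem_map.1 hb
          rw [List.mem_range'_1] at hj
          exact hw'' _ j hj.1 (by omega) _ (cl q hq).2
        · intro a ha b hb
          obtain ⟨i, hi, rfl⟩ := List.mem_map.1 ha
          rw [List.mem_range'_1] at hi
          rcases List.mem_append.1 hb with hb | hb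
          · obtain ⟨q, hq, rfl⟩ := hl' b hb
            exact hw' i _ (show i ≤ m - R' by omega) (by omega) _ (cl q hq).1
          · obtain ⟨j, hj, rfl⟩ := List.mem_map.1 hb
            rw [List.mem_range'_1] at hj
            exact hw i j (by omega) (by omega)
      · intro σ hσ
        rcases List.mem_append.1 hσ with h | h
        · obtain ⟨i, hi, rfl⟩ := List.mem_map.1 h
          rw [List.mem_range'_1] at hi
          exact hws i (by omega)
        rcases List.mem_append.1 h with h | h
        · obtain ⟨q, hq, rfl⟩ := hl' σ h
          exact qsep q hq m (by omega) (by omega)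
        · obtain ⟨i, hi, rfl⟩ := List.mem_map.1 h
          rw [List.mem_range'_1] at hi
          exact hws i (by omega)
    have := W.le_D this
    simp at this
    omega
  have hfin : Q.Finite := by
    by_contra hinf
    obtain ⟨s, hs, hsc⟩ := Set.Infinite.exists_subset_card_eq hinf (c * (2 * R'))
    have := bound s (fun q hq => hs hq)
    omega
  refine ⟨hfin.toFinset, (bound _ (fun q hq => by simpa using hq)).le, ?_⟩
  intro g h1 h2
  rw [Set.Finite.mem_toFinset]
  exact ⟨h1, h2⟩

/-- counting incomparable walls -/
theorem inc_bound {L : Type*} (h : S → ℤ → Set G) (lev : S → L) (anti : ∀ σ, Antitone (h σ))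
    (N1 : ∀ σ τ i j x y, x ∉ h σ i → y ∈ h σ (i+1) → x ∉ h τ j → y ∈ h τ j →
      h σ (i+1) ⊆ h τ j ∨ h τ j ⊆ h σ i)
    (N0 : ∀ σ τ i j x y, lev σ = lev τ → x ∉ h σ i → y ∈ h σ i → x ∉ h τ j → y ∈ h τ j →
      h σ i ⊆ h τ j ∨ h τ j ⊆ h σ i) (M : ℕ)
    (P0 : ∀ σ τ j a b, lev σ ≠ lev τ → h τ j ⊆ h σ a → h σ b ⊆ h τ (j + M) → False)
    (c1 : ℕ) (F1 : ∀ σ, {τ | lev τ = lev σ ∧ h σ (3 * M + 4) ⊆ h τ 0 ∧ h τ 0 ⊆ h σ 0}.encard ≤ c1)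
    (F2 : ∀ σ, {τ | lev τ = lev σ ∧ h τ (3 * M + 4) ⊆ h σ 0 ∧ h σ 0 ⊆ h τ 0}.encard ≤ c1) (x y : G) (σ : S)
    (hσ : wSep (fun σ => h σ 0) (fun σ => h σ (3 * M + 4)) x y σ) :
    {τ | wSep (fun σ => h σ 0) (fun σ => h σ (3 * M + 4)) x y τ ∧
      ¬ wLt (fun σ => h σ 0) (fun σ => h σ (3 * M + 4)) σ τ ∧
      ¬ wLt (fun σ => h σ 0) (fun σ => h σ (3 * M + 4)) τ σ}.encard ≤ ((6 * c1 : ℕ) : ℕ∞) := by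
  set K : ℤ := 3 * M + 4 with hK
  set Sep := wSep (fun σ => h σ 0) (fun σ => h σ K) x y with hSep
  have sx : ∀ σ, Sep σ → ∀ i, 0 ≤ i → x ∉ h σ i := fun σ hs i hi hx => hs.1 (anti σ hi hx)
  have sy : ∀ σ, Sep σ → ∀ i, i ≤ K → y ∈ h σ i := fun σ hs i hi => anti σ hi hs.2
  let m : ℤ := 2 * M + 2
  let A : S → S → Prop := fun σ τ => h τ 0 ⊆ h σ m ∧ h τ m ⊆ h σ K
  have ordA : ∀ σ τ, Sep σ → Sep τ → lev σ ≠ lev τ → h τ 1 ⊆ h σ 0 → A σ τ := by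
    intro σ τ hs ht hl h1
    have h2 : h τ (M+1) ⊆ h σ (K-1) := by
      rcases N1 σ τ (K-1) (M+1) x y (sx σ hs _ (by omega)) (sy σ hs _ (by omega)) (sx τ ht _ (by omega))
        (sy τ ht _ (by omega)) with h | h
      · exact (P0 σ τ 1 0 _ hl h1 (by rw [add_comm (1:ℤ)]; exact h)).elim
      · exact h
    constructor
    · rcases N1 σ τ m 0 x y (sx σ hs _ (by omega)) (sy σ hs _ (by omega)) (sx τ ht _ (by omega))
        (sy τ ht _ (by omega)) with h | h
      · refine (P0 τ σ (m+1) 0 (M+1) (Ne.symm hl) h ?_).elim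
        rw [show m + 1 + M = K - 1 by omega]; exact h2
      · exact h
    · rcases N1 τ σ (m-1) K x y (sx τ ht _ (by omega)) (sy τ ht _ (by omega)) (sx σ hs _ (by omega))
        (sy σ hs _ (by omega)) with h | h
      · rwa [show m - 1 + 1 = m by omega] at h
      · refine (P0 σ τ (M+1) (K-1) K hl h2 ?_).elim
        rw [show (M:ℤ) + 1 + M = m - 1 by omega]; exact h
  have ord : ∀ σ τ, Sep σ → Sep τ → lev σ ≠ lev τ → A σ τ ∨ A τ σ := by
    intro σ τ hs ht hl
    rcases N1 σ τ 0 1 x y (sx σ hs _ (by omega)) (sy σ hs _ (by omega)) (sx τ ht _ (by omega))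
        (sy τ ht _ (by omega)) with h | h
    · refine Or.inr (ordA τ σ ht hs (Ne.symm hl) ?_)
      exact h.trans (anti τ (by omega))
    · exact Or.inl (ordA σ τ hs ht hl h)
  let lt : S → S → Prop := wLt (fun σ => h σ 0) (fun σ => h σ K)
  have same : ∀ σ, Sep σ → {τ | lev τ = lev σ ∧ Sep τ ∧ ¬ lt σ τ ∧ ¬ lt τ σ}.encard ≤ ((2 * c1 : ℕ) : ℕ∞) := by
    intro σ hs
    have : {τ | lev τ = lev σ ∧ Sep τ ∧ ¬ lt σ τ ∧ ¬ lt τ σ} ⊆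
        {τ | lev τ = lev σ ∧ h σ K ⊆ h τ 0 ∧ h τ 0 ⊆ h σ 0} ∪
        {τ | lev τ = lev σ ∧ h τ K ⊆ h σ 0 ∧ h σ 0 ⊆ h τ 0} := by
      rintro τ ⟨hl, ht, n1, n2⟩
      have a1 : h σ K ⊆ h τ 0 := by
        rcases N0 σ τ K 0 x y hl.symm (sx σ hs _ (by omega)) (sy σ hs _ (by omega)) (sx τ ht _ (by omega))
          (sy τ ht _ (by omega)) with h | h
        · exact h
        · exact absurd h n1
      have a2 : h τ K ⊆ h σ 0 := by
        rcases N0 τ σ K 0 x y hl (sx τ ht _ (by omega)) (sy τ ht _ (by omega)) (sx σ hs _ (by omega))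
          (sy σ hs _ (by omega)) with h | h
        · exact h
        · exact absurd h n2
      rcases N0 σ τ 0 0 x y hl.symm (sx σ hs _ (by omega)) (sy σ hs _ (by omega)) (sx τ ht _ (by omega))
          (sy τ ht _ (by omega)) with h | h
      · exact Or.inr ⟨hl, a2, h⟩
      · exact Or.inl ⟨hl, a1, h⟩
    refine (Set.encard_le_encard this).trans ((Set.encard_union_le _ _).trans ?_)
    rw [two_mul, Nat.cast_add]
    exact add_le_add (F1 σ) (F2 σ)
  have grp : ∀ T : Set S, (∀ τ ∈ T, Sep τ) → (∀ τ ∈ T, ∀ τ' ∈ T, lev τ = lev τ' ∧ ¬ lt τ τ') →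
      T.encard ≤ ((2 * c1 : ℕ) : ℕ∞) := by
    intro T hT hT'
    rcases T.eq_empty_or_nonempty with rfl | ⟨τ, ht⟩
    · simp
    · refine (Set.encard_le_encard ?_).trans (same τ (hT τ ht))
      intro τ' ht'
      exact ⟨(hT' τ' ht' τ ht).1, hT τ' ht', (hT' τ ht τ' ht').2, (hT' τ' ht' τ ht).2⟩
  have hsub : {τ | Sep τ ∧ ¬ lt σ τ ∧ ¬ lt τ σ} ⊆
      {τ | lev τ = lev σ ∧ Sep τ ∧ ¬ lt σ τ ∧ ¬ lt τ σ} ∪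
      ({τ | Sep τ ∧ ¬ lt σ τ ∧ A σ τ} ∪ {τ | Sep τ ∧ ¬ lt τ σ ∧ A τ σ}) := by
    rintro τ ⟨ht, n1, n2⟩
    by_cases hl : lev τ = lev σ
    · exact Or.inl ⟨hl, ht, n1, n2⟩
    · rcases ord σ τ hσ ht (Ne.symm hl) with h | h
      · exact Or.inr (Or.inl ⟨ht, n1, h⟩)
      · exact Or.inr (Or.inr ⟨ht, n2, h⟩)
  refine (Set.encard_le_encard hsub).trans ((Set.encard_union_le _ _).trans ?_)
  rw [show 6 * c1 = 2 * c1 + (2 * c1 + 2 * c1) by ring, Nat.cast_add, Nat.cast_add]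
  refine add_le_add (same σ hσ) ((Set.encard_union_le _ _).trans (add_le_add ?_ ?_))
  · apply grp
    · exact fun τ ht => ht.1
    · have key : ∀ τ τ', Sep τ → Sep τ' → ¬ lt σ τ → A σ τ → ¬ lt σ τ' → A σ τ' → A τ τ' → False := by
        intro τ τ' _ _ n a n' a' b
        exact n' (b.1.trans a.2)
      intro τ ht τ' ht'
      constructor
      · by_contra hl
        rcases ord τ τ' ht.1 ht'.1 hl with h | h
        · exact key τ τ' ht.1 ht'.1 ht.2.1 ht.2.2 ht'.2.1 ht'.2.2 h
        · exact key τ' τ ht'.1 ht.1 ht'.2.1 ht'.2.2 ht.2.1 ht.2.2 h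
      · intro hlt
        exact ht'.2.1 ((hlt.trans (anti τ (by omega))).trans ht.2.2.2)
  · apply grp
    · exact fun τ ht => ht.1
    · have key : ∀ τ τ', ¬ lt τ σ → A τ' σ → A τ τ' → False := by
        intro τ τ' n a b
        exact n (a.1.trans b.2)
      intro τ ht τ' ht'
      constructor
      · by_contra hl
        rcases ord τ τ' ht.1 ht'.1 hl with h | h
        · exact key τ τ' ht.2.1 ht'.2.2 h
        · exact key τ' τ ht'.2.1 ht.2.2 h
      · intro hlt
        exact ht.2.1 ((ht'.2.2.1.trans (anti τ' (by omega))).trans hlt)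
end Acyl

section Tree
variable {α : Type} [DecidableEq α]

def il (s : α × Bool) : α × Bool := (s.1, !s.2)
@[simp] lemma il_il (s : α × Bool) : il (il s) = s := by simp [il]
lemma il_ne (s : α × Bool) : il s ≠ s := by
  intro h; have := congrArg Prod.snd h; simp [il] at this
lemma il_inj {s t : α × Bool} (h : il s = il t) : s = t := by
  rw [← il_il s, h, il_il]

def ltr (s : α × Bool) : FreeGroup α := FreeGroup.mk [s]

lemma ltr_il (s : α × Bool) : ltr (il s) = (ltr s)⁻¹ := by
  simp [ltr, il, FreeGroup.inv_mk, FreeGroup.invRev]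

lemma ltr_word (s : α × Bool) : (ltr s).toWord = [s] := by
  simp [ltr, FreeGroup.toWord_mk, FreeGroup.reduce_singleton]

def Hf (s : α × Bool) : Set (FreeGroup α) := {w | w.toWord.head? = some s}

lemma mem_Hf {s : α × Bool} {w : FreeGroup α} : w ∈ Hf s ↔ w.toWord.head? = some s := Iff.rfl

lemma red_cons {a : α × Bool} {t : List (α × Bool)} (ht : FreeGroup.IsReduced t)
    (h : t.head? ≠ some (il a)) : FreeGroup.IsReduced (a :: t) := by
  cases t with
  | nil => simp [FreeGroup.IsReduced]
  | cons b t =>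
    rw [FreeGroup.isReduced_cons_cons]
    refine ⟨fun h1 => ?_, ht⟩
    by_contra h2
    apply h
    simp only [List.head?_cons, il, Option.some.injEq]
    ext
    · exact h1.symm
    · simp only; revert h2; cases a.2 <;> cases b.2 <;> simp

lemma head_of_red {a : α × Bool} {t : List (α × Bool)} (ht : FreeGroup.IsReduced (a :: t)) :
    t.head? ≠ some (il a) := by
  cases t with
  | nil => simp
  | cons b t =>
    rw [FreeGroup.isReduced_cons_cons] at ht
    intro h
    simp only [List.head?_cons, Option.some.injEq] at h
    subst h
    have := ht.1 rfl
    simp [il] at this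

lemma red_tail {a : α × Bool} {t : List (α × Bool)} (ht : FreeGroup.IsReduced (a :: t)) :
    FreeGroup.IsReduced t := ht.infix ⟨[a], [], by simp⟩

lemma word_mk {t : List (α × Bool)} (ht : FreeGroup.IsReduced t) : (FreeGroup.mk t).toWord = t := by
  rw [FreeGroup.toWord_mk, ht.reduce_eq]

lemma ltr_mul_word {s : α × Bool} {w : FreeGroup α} (h : w ∉ Hf (il s)) :
    (ltr s * w).toWord = s :: w.toWord := by
  rw [FreeGroup.toWord_mul, ltr_word]
  exact (red_cons FreeGroup.isReduced_toWord h).reduce_eq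

lemma Hf_decomp {s : α × Bool} {w : FreeGroup α} (h : w ∈ Hf s) :
    ∃ w0, w = ltr s * w0 ∧ w0 ∉ Hf (il s) ∧ w.toWord = s :: w0.toWord := by
  have hr := FreeGroup.isReduced_toWord (x := w)
  have hw := FreeGroup.mk_toWord (x := w)
  rw [mem_Hf] at h
  cases hT : w.toWord with
  | nil => rw [hT] at h; simp at h
  | cons a t =>
    rw [hT] at h hr hw
    simp only [List.head?_cons, Option.some.injEq] at h
    subst h
    have h1 := word_mk (red_tail hr)
    refine ⟨FreeGroup.mk t, ?_, ?_, ?_⟩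
    · rw [← hw, ltr, FreeGroup.mul_mk]; simp
    · rw [mem_Hf, h1]; exact head_of_red hr
    · rw [h1]

lemma indL {P : FreeGroup α → Prop} (h1 : P 1) (h2 : ∀ a w, w ∉ Hf (il a) → P w → P (ltr a * w))
    (w : FreeGroup α) : P w := by
  induction hn : w.toWord.length generalizing w with
  | zero =>
    have : w = 1 := by
      rw [← FreeGroup.toWord_eq_nil_iff]; exact List.length_eq_zero_iff.1 hn
    rw [this]; exact h1
  | succ n ih =>
    cases hT : w.toWord with
    | nil => rw [hT] at hn; simp at hn
    | cons a t =>
      obtain ⟨w0, rfl, h3, h4⟩ := Hf_decomp (s := a) (w := w) (by rw [mem_Hf, hT]; rfl)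
      refine h2 a w0 h3 (ih w0 ?_)
      rw [h4] at hn; simpa using hn

lemma indR {P : FreeGroup α → Prop} (h1 : P 1) (h2 : ∀ w r, P w → P (w * ltr r))
    (w : FreeGroup α) : P w := by
  rw [← FreeGroup.mk_toWord (x := w)]
  induction w.toWord using List.reverseRecOn with
  | nil => exact h1
  | append_singleton t a ih =>
    rw [← FreeGroup.mul_mk]; exact h2 _ a ih

lemma one_notin_Hf (s : α × Bool) : (1 : FreeGroup α) ∉ Hf s := by simp [mem_Hf]

lemma ltr_mem_Hf (s : α × Bool) : ltr s ∈ Hf s := by simp [mem_Hf, ltr_word]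

lemma ltr_mem_Hf_iff (s r : α × Bool) : ltr s ∈ Hf r ↔ s = r := by simp [mem_Hf, ltr_word]

lemma Hf_unique {s r : α × Bool} {w : FreeGroup α} (h1 : w ∈ Hf s) (h2 : w ∈ Hf r) : s = r := by
  rw [mem_Hf] at h1 h2; rw [h1] at h2; exact Option.some.inj h2

lemma mul_mem_Hf (s : α × Bool) (w : FreeGroup α) : ltr s * w ∈ Hf s ↔ w ∉ Hf (il s) := by
  constructor
  · intro h h'
    obtain ⟨w0, rfl, h3, -⟩ := Hf_decomp h'
    rw [ltr_il, mul_inv_cancel_left] at h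
    rw [il_il] at h3
    exact h3 h
  · intro h
    rw [mem_Hf, ltr_mul_word h]; rfl

lemma edgeL {w : FreeGroup α} {s r : α × Bool} (h1 : w ∉ Hf s) (h2 : w * ltr r ∈ Hf s) :
    w = 1 ∧ r = s := by
  induction w using indL generalizing s with
  | h1 => rw [one_mul, ltr_mem_Hf_iff] at h2; exact ⟨rfl, h2⟩
  | h2 a w hw ih =>
    exfalso
    have ha : ltr a * w ∈ Hf a := (mul_mem_Hf a w).2 hw
    have hne : a ≠ s := by rintro rfl; exact h1 ha
    rw [mul_assoc] at h2
    by_cases h : w * ltr r ∈ Hf (il a)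
    · obtain ⟨rfl, rfl⟩ := ih hw h
      rw [one_mul, ltr_il, mul_inv_cancel] at h2
      exact one_notin_Hf s h2
    · exact hne (Hf_unique ((mul_mem_Hf a _).2 h) h2)

def HT (v : FreeGroup α) (s : α × Bool) : Set (FreeGroup α) := {w | v⁻¹ * w ∈ Hf s}

lemma mem_HT {v w : FreeGroup α} {s : α × Bool} : w ∈ HT v s ↔ v⁻¹ * w ∈ Hf s := Iff.rfl

lemma HT_one (s : α × Bool) : HT 1 s = Hf s := by ext w; simp [mem_HT]

lemma HT_mul (u v w : FreeGroup α) (s : α × Bool) : w ∈ HT (u * v) s ↔ u⁻¹ * w ∈ HT v s := by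
  rw [mem_HT, mem_HT, mul_inv_rev, mul_assoc]

lemma HT_compl (v : FreeGroup α) (s : α × Bool) : (HT v s)ᶜ = HT (v * ltr s) (il s) := by
  ext w
  rw [HT_mul, mem_compl_iff, mem_HT, mem_HT]
  have := mul_mem_Hf (il s) (v⁻¹ * w)
  rw [il_il] at this
  rw [← this, ltr_il]

lemma HT_base (v : FreeGroup α) (s : α × Bool) : v ∉ HT v s := by
  rw [mem_HT, inv_mul_cancel]; exact one_notin_Hf s

lemma HT_tip (v : FreeGroup α) (s : α × Bool) : v * ltr s ∈ HT v s := by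
  rw [mem_HT, inv_mul_cancel_left]; exact ltr_mem_Hf s

lemma edgeHT {v w : FreeGroup α} {s r : α × Bool} (h1 : w ∉ HT v s) (h2 : w * ltr r ∈ HT v s) :
    w = v ∧ r = s := by
  rw [mem_HT] at h1 h2
  rw [← mul_assoc] at h2
  obtain ⟨h, rfl⟩ := edgeL h1 h2
  exact ⟨(inv_mul_eq_one.1 h).symm, rfl⟩

lemma HT_inj {v v' : FreeGroup α} {s s' : α × Bool} (h : HT v s = HT v' s') : v = v' ∧ s = s' :=
  edgeHT (h ▸ HT_base v s) (h ▸ HT_tip v s)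

lemma HT_sub {v : FreeGroup α} {s r : α × Bool} (h : r ≠ il s) : HT (v * ltr s) r ⊆ HT v s := by
  intro w hw
  by_contra hn
  have : w ∈ HT (v * ltr s) (il s) := by rw [← HT_compl]; exact hn
  exact h (Hf_unique hw this)

lemma HT_disj {v : FreeGroup α} {s r : α × Bool} (h : r ≠ s) {w : FreeGroup α} (h1 : w ∈ HT v s) :
    w ∉ HT v r := fun h2 => h (Hf_unique h2 h1)

lemma HT_cover (v w : FreeGroup α) (h : w ≠ v) : ∃ s, w ∈ HT v s := by
  cases hT : (v⁻¹ * w).toWord with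
  | nil =>
    rw [FreeGroup.toWord_eq_nil_iff] at hT
    exact absurd (inv_mul_eq_one.1 hT).symm h
  | cons a t => exact ⟨a, by rw [mem_HT, mem_Hf, hT]; rfl⟩

def Cyl (t : List (α × Bool)) : Set (FreeGroup α) := {w | t <+: w.toWord}

lemma mem_Cyl {t : List (α × Bool)} {w : FreeGroup α} : w ∈ Cyl t ↔ t <+: w.toWord := Iff.rfl

lemma Cyl_head {b : α × Bool} {t : List (α × Bool)} {w : FreeGroup α} (h : w ∈ Cyl (b :: t)) :
    w ∈ Hf b := by
  obtain ⟨t', ht⟩ := h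
  rw [mem_Hf, ← ht]; rfl

lemma Cyl_single (s : α × Bool) : Cyl [s] = Hf s := by
  ext w
  refine ⟨Cyl_head, fun h => ?_⟩
  obtain ⟨w0, -, -, h⟩ := Hf_decomp h
  exact ⟨w0.toWord, by rw [h]; rfl⟩

lemma Cyl_cons {a b : α × Bool} {t : List (α × Bool)} (hb : b ≠ il a) (w : FreeGroup α) :
    ltr a * w ∈ Cyl (a :: b :: t) ↔ w ∈ Cyl (b :: t) := by
  by_cases h : w ∈ Hf (il a)
  · constructor
    · intro h'; exact absurd h ((mul_mem_Hf a w).1 (Cyl_head h'))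
    · intro h'; exact absurd (Hf_unique (Cyl_head h') h) hb
  · rw [mem_Cyl, mem_Cyl, ltr_mul_word h, List.cons_prefix_cons]; simp

lemma HT_form (v : FreeGroup α) (s : α × Bool) : ∃ t, FreeGroup.IsReduced t ∧ t ≠ [] ∧
    (HT v s = Cyl t ∨ HT v s = (Cyl t)ᶜ) := by
  induction v using indL with
  | h1 => exact ⟨[s], by simp [FreeGroup.IsReduced], by simp, Or.inl (by rw [HT_one, Cyl_single])⟩
  | h2 a v hv ih =>
    obtain ⟨t, ht, hne, h⟩ := ih
    -- reduce to Cyl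
    suffices H : ∃ t', FreeGroup.IsReduced t' ∧ t' ≠ [] ∧
        ((∀ w, (ltr a)⁻¹ * w ∈ Cyl t ↔ w ∈ Cyl t') ∨ (∀ w, (ltr a)⁻¹ * w ∈ Cyl t ↔ w ∉ Cyl t')) by
      obtain ⟨t', h1, h2, h3⟩ := H
      refine ⟨t', h1, h2, ?_⟩
      have e : ∀ w, w ∈ HT (ltr a * v) s ↔ (ltr a)⁻¹ * w ∈ HT v s := fun w => HT_mul _ _ _ _
      rcases h with h | h <;> rcases h3 with h3 | h3
      · left; ext w; rw [e, h, h3]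
      · right; ext w; rw [e, h, h3]; rfl
      · right; ext w; rw [e, h, mem_compl_iff, h3]; rfl
      · left; ext w; rw [e, h, mem_compl_iff, h3, not_not]
    match t, ht, hne with
    | b :: t1, ht, _ =>
      by_cases hb : b = il a
      · subst hb
        match t1, ht with
        | [], _ =>
          refine ⟨[a], by simp [FreeGroup.IsReduced], by simp, Or.inr fun w => ?_⟩
          rw [Cyl_single, Cyl_single]
          have := mul_mem_Hf (il a) w
          rwa [il_il, ltr_il] at this
        | c :: t2, ht =>
          refine ⟨c :: t2, red_tail ht, by simp, Or.inl fun w => ?_⟩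
          have hc := head_of_red ht
          rw [← ltr_il]
          exact Cyl_cons (by simpa using hc) w
      · refine ⟨a :: b :: t1, red_cons ht (by simpa using hb), by simp, Or.inl fun w => ?_⟩
        have := Cyl_cons (t := t1) hb ((ltr a)⁻¹ * w)
        rw [mul_inv_cancel_left] at this
        exact this.symm

lemma Cyl_nest (t t' : List (α × Bool)) : Cyl t ⊆ Cyl t' ∨ Cyl t' ⊆ Cyl t ∨
    (∀ x, ¬ (x ∈ Cyl t ∧ x ∈ Cyl t')) := by
  by_cases h : ∃ x, x ∈ Cyl t ∧ x ∈ Cyl t'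
  · obtain ⟨x, h1, h2⟩ := h
    rcases List.prefix_or_prefix_of_prefix h1 h2 with h | h
    · exact Or.inr (Or.inl fun w hw => h.trans hw)
    · exact Or.inl fun w hw => h.trans hw
  · push Not at h
    exact Or.inr (Or.inr fun x hx => h x hx.1 hx.2)

lemma HT_nest (v v' : FreeGroup α) (s s' : α × Bool) : HT v s ⊆ HT v' s' ∨ HT v' s' ⊆ HT v s ∨
    (∀ x, ¬ (x ∈ HT v s ∧ x ∈ HT v' s')) ∨ (∀ x, x ∈ HT v s ∨ x ∈ HT v' s') := by
  obtain ⟨t, -, -, h⟩ := HT_form v s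
  obtain ⟨t', -, -, h'⟩ := HT_form v' s'
  rcases h with h | h <;> rcases h' with h' | h' <;> rw [h, h'] <;>
    rcases Cyl_nest t t' with k | k | k
  · exact Or.inl k
  · exact Or.inr (Or.inl k)
  · exact Or.inr (Or.inr (Or.inl k))
  · refine Or.inr (Or.inr (Or.inl fun x hx => hx.2 (k hx.1)))
  · exact Or.inr (Or.inr (Or.inr fun x => by by_cases h : x ∈ Cyl t; exact Or.inl h; exact Or.inr fun h' => h (k h')))
  · exact Or.inl fun x hx hx' => k x ⟨hx, hx'⟩
  · exact Or.inr (Or.inr (Or.inr fun x => by by_cases h : x ∈ Cyl t'; exact Or.inr h; exact Or.inl fun h' => h (k h')))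
  · refine Or.inr (Or.inr (Or.inl fun x hx => hx.1 (k hx.2)))
  · exact Or.inr (Or.inl fun x hx hx' => k x ⟨hx', hx⟩)
  · exact Or.inr (Or.inl (compl_subset_compl.2 k))
  · exact Or.inl (compl_subset_compl.2 k)
  · refine Or.inr (Or.inr (Or.inr fun x => ?_))
    have := k x
    simp only [mem_compl_iff]; tauto

/-- almost invariant sets -/
def AI (P : Set (FreeGroup α)) : Prop := ∀ u, {w | ¬ (w ∈ P ↔ w * u ∈ P)}.Finite

lemma AI_of_letters {P : Set (FreeGroup α)} (h : ∀ r, {w | ¬ (w ∈ P ↔ w * ltr r ∈ P)}.Finite) : AI P := by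
  intro u
  induction u using indR with
  | h1 => simp
  | h2 u r ih =>
    refine (ih.union ((h r).preimage (f := fun w => w * u) (mul_left_injective u).injOn)).subset ?_
    intro w hw
    by_contra hc
    simp only [mem_union, mem_preimage, mem_ofPred_eq, not_or, not_not] at hc hw
    rw [← mul_assoc] at hw
    tauto

lemma AI_HT (v : FreeGroup α) (s : α × Bool) : AI (HT v s) := by
  apply AI_of_letters
  intro r
  refine (Set.toFinite {v, v * (ltr r)⁻¹}).subset ?_
  intro w hw
  simp only [mem_ofPred_eq] at hw
  by_cases h : w ∈ HT v s
  · have h2 : w * ltr r ∉ HT v s := by tauto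
    have := edgeHT (w := w * ltr r) (r := il r) h2 (by rw [ltr_il, mul_inv_cancel_right]; exact h)
    right
    rw [mem_singleton_iff, ← this.1, mul_inv_cancel_right]
  · have h2 : w * ltr r ∈ HT v s := by tauto
    left
    exact (edgeHT h h2).1

lemma AI.compl {P : Set (FreeGroup α)} (h : AI P) : AI Pᶜ := by
  intro u
  refine (h u).subset ?_
  intro w hw
  simp only [mem_ofPred_eq, mem_compl_iff] at *
  tauto

lemma AI.affine {P : Set (FreeGroup α)} (h : AI P) (f : FreeGroup α) (ψ : MulAut (FreeGroup α)) :
    AI {w | f * ψ w ∈ P} := by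
  intro u
  refine ((h (ψ u)).preimage (f := fun w => f * ψ w)
    (fun a _ b _ hab => ψ.injective (mul_left_cancel hab))).subset ?_
  intro w hw
  simp only [mem_preimage, mem_ofPred_eq, map_mul] at *
  rwa [mul_assoc]

lemma pow_inj' {u : FreeGroup α} (hu : u ≠ 1) (h : FreeGroup α) :
    Function.Injective fun N : ℕ => h * u ^ N := by
  intro a b hab
  have h1 := mul_left_cancel hab
  have : Function.Injective (fun n : ℕ => u ^ n) :=
    injective_pow_iff_not_isOfFinOrder.2 (by
      rw [isOfFinOrder_iff_pow_eq_one]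
      rintro ⟨n, hn, h⟩
      exact hu ((pow_eq_one_iff_left (by omega)).1 h))
  exact this h1

lemma AI.ends {P : Set (FreeGroup α)} (hP : AI P) {u : FreeGroup α} (hu : u ≠ 1) (h : FreeGroup α) :
    (∀ᶠ N : ℕ in Filter.atTop, h * u ^ N ∈ P) ∨ (∀ᶠ N : ℕ in Filter.atTop, h * u ^ N ∉ P) := by
  have hf := (hP u).preimage (f := fun N : ℕ => h * u ^ N) (pow_inj' hu h).injOn
  obtain ⟨B, hB⟩ := hf.bddAbove
  have hstep : ∀ N, B < N → (h * u ^ N ∈ P ↔ h * u ^ (N+1) ∈ P) := by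
    intro N hN
    by_contra hc
    have := hB (show N ∈ _ from by
      simp only [mem_preimage, mem_ofPred_eq]
      rwa [pow_succ, ← mul_assoc] at hc)
    omega
  have hall : ∀ k, (h * u ^ (B + 1 + k) ∈ P ↔ h * u ^ (B + 1) ∈ P) := by
    intro k
    induction k with
    | zero => simp
    | succ k ih => rw [← ih, hstep (B + 1 + k) (by omega)]; rfl
  by_cases h0 : h * u ^ (B+1) ∈ P
  · left
    filter_upwards [Filter.eventually_ge_atTop (B+1)] with N hN
    obtain ⟨k, rfl⟩ := Nat.exists_eq_add_of_le hN
    exact (hall k).2 h0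
  · right
    filter_upwards [Filter.eventually_ge_atTop (B+1)] with N hN
    obtain ⟨k, rfl⟩ := Nat.exists_eq_add_of_le hN
    exact fun h => h0 ((hall k).1 h)

lemma finite_ends {P : Set (FreeGroup α)} (hP : P.Finite) {u : FreeGroup α} (hu : u ≠ 1) (h : FreeGroup α) :
    ∀ᶠ N : ℕ in Filter.atTop, h * u ^ N ∉ P := by
  have hf := hP.preimage (f := fun N : ℕ => h * u ^ N) (pow_inj' hu h).injOn
  obtain ⟨B, hB⟩ := hf.bddAbove
  filter_upwards [Filter.eventually_gt_atTop B] with N hN hmem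
  have := hB hmem
  omega

/-- connectivity of cylinders -/
lemma Cyl_conn {t : List (α × Bool)} {P : Set (FreeGroup α)} (ht : FreeGroup.IsReduced t)
    (h : ∀ w ∈ Cyl t, ∀ r, w * ltr r ∈ Cyl t → (w ∈ P ↔ w * ltr r ∈ P)) (w : FreeGroup α) (hw : w ∈ Cyl t) :
    w ∈ P ↔ FreeGroup.mk t ∈ P := by
  obtain ⟨t', ht'⟩ := hw
  have hr : FreeGroup.IsReduced (t ++ t') := by rw [ht']; exact FreeGroup.isReduced_toWord
  rw [← FreeGroup.mk_toWord (x := w), ← ht']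
  clear ht'
  induction t' using List.reverseRecOn with
  | nil => simp
  | append_singleton t1 a ih =>
    have hr1 : FreeGroup.IsReduced (t ++ t1) := hr.infix ⟨[], [a], by simp⟩
    refine Iff.trans ?_ (ih hr1)
    have e : FreeGroup.mk (t ++ (t1 ++ [a])) = FreeGroup.mk (t ++ t1) * ltr a := by
      rw [ltr, FreeGroup.mul_mk, List.append_assoc]
    rw [e]
    refine (h _ ?_ a ?_).symm
    · rw [mem_Cyl, word_mk hr1]; exact List.prefix_append _ _
    · rw [← e, mem_Cyl, word_mk hr]; exact List.prefix_append _ _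

end Tree

section WallMain
variable {Q : Type u} [Group Q]

def tr (p : Q) (E : Set Q) : Set Q := {x | p⁻¹ * x ∈ E}

lemma mem_tr {p x : Q} {E : Set Q} : x ∈ tr p E ↔ p⁻¹ * x ∈ E := Iff.rfl
lemma tr_mul (p q : Q) (E : Set Q) : tr (p * q) E = tr p (tr q E) := by
  ext x; simp [mem_tr, mul_assoc]
lemma tr_one (E : Set Q) : tr 1 E = E := by ext x; simp [mem_tr]
lemma tr_mono {p : Q} {E E' : Set Q} : tr p E ⊆ tr p E' ↔ E ⊆ E' := by
  constructor
  · intro h x hx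
    have := @h (p * x) (by simpa [mem_tr] using hx)
    simpa [mem_tr] using this
  · intro h x hx; exact h hx
lemma tr_compl (p : Q) (E : Set Q) : tr p Eᶜ = (tr p E)ᶜ := rfl
lemma tr_inj {p : Q} {E E' : Set Q} (h : tr p E = tr p E') : E = E' :=
  (tr_mono.1 h.subset).antisymm (tr_mono.1 h.superset)

structure WallData {N : Type*} [Group N] (π : Q →* N) (C : Set (Set Q)) (H : Set Q) (g : Q) : Prop
    extends CutSys C where
  compl : ∀ E ∈ C, Eᶜ ∈ C
  trC : ∀ f E, π f = 1 → E ∈ C → tr f E ∈ C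
  stab : ∀ f E, π f = 1 → E ∈ C → tr f E = E → f = 1
  HC : H ∈ C
  pg : π g = 1
  gH : tr g H ⊆ H
  gH' : ¬ H ⊆ tr g H
  one : (1 : Q) ∉ H
  SW : ∀ q, ∃ E ∈ C, tr (q * g) H ⊆ E ∧ E ⊆ tr q H
  R : ∀ q, π q ≠ 1 → ∀ a b : ℤ, a ≠ 0 → b ≠ 0 → (q * g * q⁻¹) ^ a ≠ g ^ b

variable {N : Type*} [Group N] {π : Q →* N} {C : Set (Set Q)} {H : Set Q} {g : Q}

/-- thick walls -/
def hw (H : Set Q) (g : Q) (K : ℤ) (σ : Q × Bool) (i : ℤ) : Set Q :=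
  if σ.2 then tr (σ.1 * g ^ i) H else (tr (σ.1 * g ^ (K - i)) H)ᶜ

lemma hw_t (K : ℤ) (p : Q) (i : ℤ) : hw H g K (p, true) i = tr (p * g ^ i) H := rfl
lemma hw_f (K : ℤ) (p : Q) (i : ℤ) : hw H g K (p, false) i = (tr (p * g ^ (K - i)) H)ᶜ := rfl

lemma hw_tr (K : ℤ) (q p : Q) (b : Bool) (i : ℤ) : hw H g K (q * p, b) i = tr q (hw H g K (p, b) i) := by
  cases b
  · rw [hw_f, hw_f, tr_compl, ← tr_mul, mul_assoc]
  · rw [hw_t, hw_t, ← tr_mul, mul_assoc]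

lemma hw_bar (K : ℤ) (p : Q) (b : Bool) (i : ℤ) : hw H g K (p, !b) i = (hw H g K (p, b) (K - i))ᶜ := by
  cases b
  · simp [hw]
  · simp [hw]

namespace WallData
variable (W : WallData π C H g)
include W

lemma gpow_anti : Antitone (fun i : ℤ => tr (g ^ i) H) := by
  refine antitone_int_of_succ_le ?_
  intro i
  rw [zpow_add_one, tr_mul]
  exact tr_mono.2 W.gH

lemma gpow_strict (i : ℤ) : ¬ tr (g ^ i) H ⊆ tr (g ^ (i+1)) H := by
  rw [zpow_add_one, tr_mul, tr_mono]
  exact W.gH'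

lemma gpow_strict' {i j : ℤ} (h : tr (g ^ i) H ⊆ tr (g ^ j) H) : j ≤ i := by
  by_contra hc
  exact W.gpow_strict i (h.trans (W.gpow_anti (by omega)))

lemma hw_anti (K : ℤ) (σ : Q × Bool) : Antitone (hw H g K σ) := by
  obtain ⟨p, b⟩ := σ
  intro i j hij
  cases b
  · rw [hw_f, hw_f, tr_mul, tr_mul]
    exact compl_subset_compl.2 (tr_mono.2 (W.gpow_anti (by omega)))
  · rw [hw_t, hw_t, tr_mul, tr_mul]
    exact tr_mono.2 (W.gpow_anti hij)

lemma hw_strict (K : ℤ) (σ : Q × Bool) (i : ℤ) : ¬ hw H g K σ i ⊆ hw H g K σ (i+1) := by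
  obtain ⟨p, b⟩ := σ
  cases b
  · rw [hw_f, hw_f, tr_mul, tr_mul, compl_subset_compl, tr_mono]
    have := W.gpow_strict (K - (i+1))
    rwa [show K - (i+1) + 1 = K - i by ring] at this
  · rw [hw_t, hw_t, tr_mul, tr_mul, tr_mono]; exact W.gpow_strict i

lemma hw_SW (K : ℤ) (σ : Q × Bool) (i : ℤ) : ∃ E ∈ C, hw H g K σ (i+1) ⊆ E ∧ E ⊆ hw H g K σ i := by
  obtain ⟨p, b⟩ := σ
  cases b
  · obtain ⟨E, hE, h1, h2⟩ := W.SW (p * g ^ (K - (i+1)))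
    refine ⟨Eᶜ, W.compl E hE, ?_, ?_⟩
    · rw [hw_f]; exact compl_subset_compl.2 h2
    · rw [hw_f]; rw [mul_assoc, ← zpow_add_one, show K - (i+1) + 1 = K - i by ring] at h1
      exact compl_subset_compl.2 h1
  · obtain ⟨E, hE, h1, h2⟩ := W.SW (p * g ^ i)
    rw [mul_assoc, ← zpow_add_one] at h1
    exact ⟨E, hE, h1, h2⟩

lemma pgz (i : ℤ) : π (g ^ i) = 1 := by rw [map_zpow, W.pg, one_zpow]

lemma hw_C (K : ℤ) (p : Q) (hp : π p = 1) (b : Bool) (i : ℤ) : hw H g K (p, b) i ∈ C := by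
  cases b
  · rw [hw_f]; exact W.compl _ (W.trC _ _ (by rw [map_mul, hp, W.pgz, one_mul]) W.HC)
  · rw [hw_t]; exact W.trC _ _ (by rw [map_mul, hp, W.pgz, one_mul]) W.HC

lemma nest2 {E E' : Set Q} (hE : E ∈ C) (hE' : E' ∈ C) {x y : Q} (h1 : x ∉ E) (h2 : x ∉ E') (h3 : y ∈ E)
    (h4 : y ∈ E') : E ⊆ E' ∨ E' ⊆ E := by
  rcases W.nest E hE E' hE' with h | h | h | h
  · exact Or.inl h
  · exact Or.inr h
  · exact (h y ⟨h3, h4⟩).elim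
  · exact ((h x).elim h1 h2).elim

lemma Hne : ∃ y, y ∈ H := by
  by_contra h
  push Not at h
  exact W.gH' (fun y hy => (h y hy).elim)

lemma between_fin (K : ℤ) : {E | E ∈ C ∧ tr (g ^ K) H ⊆ E ∧ E ⊆ H}.Finite := by
  obtain ⟨y, hy⟩ := W.Hne
  refine (W.fin 1 (g ^ K * y)).subset ?_
  rintro E ⟨hE, h1, h2⟩
  exact ⟨hE, fun h => W.one (h2 h), h1 (by simpa [mem_tr] using hy)⟩

lemma orbit {E : Set Q} (hE : E ∈ C) : ∀ (k : ℕ) (a : ℤ), tr (g ^ (a + k)) H ⊆ E → E ⊆ tr (g ^ a) H →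
    ∃ c : ℤ, ∃ E' ∈ {E | E ∈ C ∧ tr (g ^ (1:ℤ)) H ⊆ E ∧ E ⊆ H}, E = tr (g ^ c) E' := by
  have fin : ∀ a : ℤ, tr (g ^ (a + 1)) H ⊆ E → E ⊆ tr (g ^ a) H →
      ∃ c : ℤ, ∃ E' ∈ {E | E ∈ C ∧ tr (g ^ (1:ℤ)) H ⊆ E ∧ E ⊆ H}, E = tr (g ^ c) E' := by
    intro a h1 h2
    refine ⟨a, tr (g ^ (-a)) E, ⟨W.trC _ _ (W.pgz _) hE, ?_, ?_⟩, ?_⟩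
    · rw [← tr_mono (p := g ^ a), ← tr_mul, ← tr_mul, ← zpow_add, ← zpow_add]; simpa [tr_one] using h1
    · rw [← tr_mono (p := g ^ a), ← tr_mul, ← zpow_add]; simpa [tr_one] using h2
    · rw [← tr_mul, ← zpow_add]; simp [tr_one]
  intro k
  induction k with
  | zero => 
    intro a h1 h2
    refine fin a ?_ h2
    refine (W.gpow_anti ?_).trans h1
    push_cast; omega
  | succ k ih =>
    intro a h1 h2
    obtain ⟨y, hy⟩ := W.Hne
    have hy1 : g ^ (a + (k + 1 : ℕ)) * y ∈ tr (g ^ (a + (k + 1 : ℕ))) H := by simpa [mem_tr] using hy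
    have hx1 : g ^ a ∉ tr (g ^ a) H := by rw [mem_tr, inv_mul_cancel]; exact W.one
    rcases W.nest2 hE (W.trC (g ^ (a+1)) H (W.pgz _) W.HC) (fun h => hx1 (h2 h))
      (fun h => hx1 (W.gpow_anti (by omega) h)) (h1 hy1) (W.gpow_anti (by push_cast; omega) hy1) with h | h
    · refine ih (a+1) ?_ h
      rw [show a + 1 + (k : ℤ) = a + ((k+1 : ℕ) : ℤ) by push_cast; ring]; exact h1
    · exact fin a h h2

lemma ginf {a : ℤ} (h : g ^ a = 1) : a = 0 := by
  have h1 : tr (g ^ a) H = H := by rw [h, tr_one]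
  have h2 : a ≤ 0 := W.gpow_strict' (i := 0) (by rw [h1, zpow_zero, tr_one])
  have h3 : 0 ≤ a := W.gpow_strict' (j := 0) (by rw [h1, zpow_zero, tr_one])
  omega

lemma hw_le (K : ℤ) (b : Bool) {i j : ℤ} (h : hw H g K (1, b) i ⊆ hw H g K (1, b) j) : j ≤ i := by
  cases b
  · rw [hw_f, hw_f, compl_subset_compl, one_mul, one_mul] at h
    have := W.gpow_strict' h; omega
  · rw [hw_t, hw_t, one_mul, one_mul] at h
    exact W.gpow_strict' h

lemma orbit' (K : ℤ) (b : Bool) {a a' : ℤ} {E : Set Q} (hE : E ∈ C) (h1 : hw H g K (1, b) a' ⊆ E)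
    (h2 : E ⊆ hw H g K (1, b) a) : ∃ c : ℤ, ∃ E' ∈ {E | E ∈ C ∧ tr (g ^ (1:ℤ)) H ⊆ E ∧ E ⊆ H},
      (if b then E else Eᶜ) = tr (g ^ c) E' := by
  have h3 := W.hw_le K b (h1.trans h2)
  cases b
  · rw [hw_f, one_mul] at h1 h2
    refine W.orbit (W.compl _ hE) (a' - a).toNat (K - a') ?_ ?_
    · rw [show K - a' + ((a' - a).toNat : ℤ) = K - a by omega]; exact subset_compl_comm.1 h2
    · exact compl_subset_comm.1 h1
  · rw [hw_t, one_mul] at h1 h2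
    refine W.orbit hE (a' - a).toNat a ?_ h2
    rw [show a + ((a' - a).toNat : ℤ) = a' by omega]; exact h1

lemma P0t (K : ℤ) (M : ℕ) (hM : (W.between_fin 1).toFinset.card < M) (p q : Q) (b : Bool) (j a a' : ℤ)
    (hl : π p ≠ π q) (h1 : hw H g K (q, true) j ⊆ hw H g K (p, b) a)
    (h2 : hw H g K (p, b) a' ⊆ hw H g K (q, true) (j + M)) : False := by
  classical
  -- translate to p = 1
  obtain ⟨q, rfl⟩ : ∃ q', q = p * q' := ⟨p⁻¹ * q, by simp⟩
  have hq : π q ≠ 1 := by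
    intro h; rw [map_mul, h, mul_one] at hl; exact hl rfl
  have ep : hw H g K (p, b) = fun i => tr p (hw H g K (1, b) i) := by
    funext i; rw [← hw_tr, mul_one]
  rw [ep, hw_tr, tr_mono] at h1 h2
  obtain ⟨E0, hE0, h3, h4⟩ := W.SW q
  set γ := q * g * q⁻¹ with hγ
  have hπγ : ∀ i : ℤ, π (γ ^ i) = 1 := by
    intro i; rw [map_zpow, hγ, map_mul, map_mul, W.pg]; simp
  have γi : ∀ i : ℤ, γ ^ i * q = q * g ^ i := by
    intro i; rw [hγ, conj_zpow]; group
  let E : ℕ → Set Q := fun i => tr (γ ^ (j + i)) E0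
  have E1 : ∀ i, i < M → E i ⊆ hw H g K (q, true) j := by
    intro i hi
    refine Subset.trans ?_ (W.hw_anti K (q, true) (show j ≤ j + (i : ℤ) by omega))
    rw [hw_t, ← γi, tr_mul]; exact tr_mono.2 h4
  have E2 : ∀ i, i < M → hw H g K (q, true) (j + M) ⊆ E i := by
    intro i hi
    refine Subset.trans (W.hw_anti K (q, true) (show j + (i : ℤ) + 1 ≤ j + M by omega)) ?_
    rw [hw_t, zpow_add_one, ← mul_assoc, ← γi, mul_assoc, tr_mul]; exact tr_mono.2 h3
  have key : ∀ i : Fin M, ∃ c : ℤ, ∃ E' ∈ (W.between_fin 1).toFinset,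
      (if b then E i else (E i)ᶜ) = tr (g ^ c) E' := by
    intro i
    obtain ⟨c, E', h, h'⟩ := W.orbit' K b (W.trC _ _ (hπγ (j + (i : ℕ))) hE0) (h2.trans (E2 i i.2)) ((E1 i i.2).trans h1)
    exact ⟨c, E', by simpa using h, h'⟩
  choose c E' hE' hc using key
  obtain ⟨i, -, i', -, hne, heq⟩ := Finset.exists_ne_map_eq_of_card_lt_of_maps_to (s := Finset.univ)
    (t := (W.between_fin 1).toFinset) (f := E') (by simpa using hM) (fun i _ => hE' i)
  have e1 : (if b then E i else (E i)ᶜ) = tr (g ^ (c i - c i')) (if b then E i' else (E i')ᶜ) := by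
    rw [hc i, hc i', heq, ← tr_mul, ← zpow_add]; congr 2; ring
  have e2 : E i = tr (g ^ (c i - c i')) (E i') := by
    cases b
    · simp only [Bool.false_eq_true, if_false, tr_compl] at e1; exact compl_injective e1
    · simpa using e1
  have e3 : tr (γ ^ (-(j + (i : ℕ))) * g ^ (c i - c i') * γ ^ (j + (i' : ℕ))) E0 = E0 := by
    rw [tr_mul, tr_mul]
    change tr _ (tr _ (E i')) = _
    rw [← e2]; change tr _ (tr _ E0) = _
    rw [← tr_mul, ← zpow_add]; simp [tr_one]
  have e4 := W.stab _ _ (by rw [map_mul, map_mul, hπγ, hπγ, W.pgz]; simp) hE0 e3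
  have e5 : γ ^ ((i : ℤ) - (i' : ℕ)) = g ^ (c i - c i') := by
    have : g ^ (c i - c i') = γ ^ (j + (i : ℕ)) * (γ ^ (-(j + (i : ℕ))) * g ^ (c i - c i') * γ ^ (j + (i' : ℕ))) *
      γ ^ (-(j + (i' : ℕ))) := by group
    rw [this, e4, mul_one, ← zpow_add]; congr 1; ring
  have hn1 : (i : ℤ) - (i' : ℕ) ≠ 0 := by
    intro h; apply hne; ext; omega
  refine W.R q hq _ _ hn1 ?_ e5
  intro h
  rw [h, zpow_zero, hγ, conj_zpow] at e5
  have : g ^ ((i : ℤ) - (i' : ℕ)) = 1 := by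
    have e6 : g ^ ((i : ℤ) - (i' : ℕ)) = q⁻¹ * (q * g ^ ((i : ℤ) - (i' : ℕ)) * q⁻¹) * q := by group
    rw [e6, e5]; simp
  exact hn1 (W.ginf this)

lemma P0 (K : ℤ) (M : ℕ) (hM : (W.between_fin 1).toFinset.card < M) (σ τ : Q × Bool) (j a a' : ℤ)
    (hl : π σ.1 ≠ π τ.1) (h1 : hw H g K τ j ⊆ hw H g K σ a)
    (h2 : hw H g K σ a' ⊆ hw H g K τ (j + M)) : False := by
  obtain ⟨p, b⟩ := σ
  obtain ⟨q, b'⟩ := τ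
  cases b'
  · refine W.P0t K M hM p q (!b) (K - (j + M)) (K - a') (K - a) hl ?_ ?_
    · have := hw_bar (H := H) (g := g) K q false (K - (j + M))
      simp only [Bool.not_false] at this
      rw [hw_bar, this, compl_subset_compl, sub_sub_cancel, sub_sub_cancel]; exact h2
    · have := hw_bar (H := H) (g := g) K q false (K - (j + M) + M)
      simp only [Bool.not_false] at this
      rw [hw_bar, this, compl_subset_compl, sub_sub_cancel, show K - (K - (j + M) + M) = j by ring]; exact h1
  · exact W.P0t K M hM p q b j a a' hl h1 h2

lemma hw_inj (K : ℤ) {p p' : Q} {b : Bool} {i : ℤ} (hp : π p = π p') (h : hw H g K (p, b) i = hw H g K (p', b) i) :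
    p = p' := by
  obtain ⟨f, rfl⟩ : ∃ f, p = p' * f := ⟨p'⁻¹ * p, by simp⟩
  have hf : π f = 1 := by rw [map_mul] at hp; simpa using hp
  have h1 : hw H g K (f, b) i = hw H g K (1, b) i := by
    refine tr_inj (p := p') ?_
    rw [← hw_tr, ← hw_tr, h, mul_one]
  have h2 : tr f (hw H g K (1, b) i) = hw H g K (1, b) i := by rw [← hw_tr, mul_one, h1]
  rw [W.stab f _ hf (W.hw_C K 1 (map_one _) b i) h2, mul_one]

end WallData
end WallMain

section WallMain2
variable {Q : Type u} [Group Q]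
variable {N : Type*} [Group N] {π : Q →* N} {C : Set (Set Q)} {H : Set Q} {g : Q}

lemma WallData.Fx (W : WallData π C H g) (K : ℤ) (T : Set (Q × Bool)) (X : Q × Bool → Set Q)
    (hX : ∀ τ ∈ T, X τ ∈ C ∧ tr (g ^ K) H ⊆ X τ ∧ X τ ⊆ H)
    (hi : ∀ τ ∈ T, ∀ τ' ∈ T, τ.2 = τ'.2 → X τ = X τ' → τ.1 = τ'.1) :
    T.encard ≤ ((({E | E ∈ C ∧ tr (g ^ K) H ⊆ E ∧ E ⊆ H} ×ˢ (univ : Set Bool)).ncard : ℕ) : ℕ∞) := by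
  rw [Set.Finite.cast_ncard_eq ((W.between_fin K).prod finite_univ)]
  refine encard_le_encard_of_injOn (f := fun τ => (X τ, τ.2)) ?_ ?_
  · intro τ hτ
    exact ⟨hX τ hτ, mem_univ _⟩
  · intro τ hτ τ' hτ' h
    simp only [Prod.mk.injEq] at h
    exact Prod.ext (hi τ hτ τ' hτ' h.2 h.1) h.2

lemma hw_norm (K : ℤ) (p : Q) (b : Bool) (Y : Set Q) (h1 : hw H g K (p, b) K ⊆ Y) (h2 : Y ⊆ hw H g K (p, b) 0) :
    tr (g ^ K) H ⊆ (if b then tr p⁻¹ Y else (tr p⁻¹ Y)ᶜ) ∧ (if b then tr p⁻¹ Y else (tr p⁻¹ Y)ᶜ) ⊆ H := by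
  cases b
  · rw [hw_f] at h1 h2
    simp only [sub_self, zpow_zero, mul_one, sub_zero] at h1 h2
    simp only [Bool.false_eq_true, if_false, ← tr_compl]
    rw [← tr_mono (p := p), ← tr_mono (E' := H) (p := p), ← tr_mul, ← tr_mul, mul_inv_cancel, tr_one]
    exact ⟨subset_compl_comm.1 h2, compl_subset_comm.1 h1⟩
  · rw [hw_t] at h1 h2
    simp only [zpow_zero, mul_one] at h1 h2
    simp only [if_true]
    rw [← tr_mono (p := p), ← tr_mono (E' := H) (p := p), ← tr_mul, ← tr_mul, mul_inv_cancel, tr_one]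
    exact ⟨h1, h2⟩

theorem WallData.main (W : WallData π C H g) :
    ∃ (Y : Type u) (_ : MetricSpace Y) (ρ : Q →* (Y ≃ᵢ Y)),
      HyperbolicGeodesicSpace Y ∧ IsAcylindrical ρ ∧
      ∃ y : Y, ¬ Bornology.IsBounded (Set.range fun g : Q => ρ g y) := by
  classical
  set M : ℕ := (W.between_fin 1).toFinset.card + 1 with hM
  set K : ℤ := 3 * M + 4 with hK
  set c1 := ({E | E ∈ C ∧ tr (g ^ K) H ⊆ E ∧ E ⊆ H} ×ˢ (univ : Set Bool)).ncard with hc1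
  have eC : ∀ (b : Bool) (E : Set Q), E ∈ C → (if b then E else Eᶜ) ∈ C := by
    intro b E hE; cases b
    · exact W.compl E hE
    · exact hE
  have einj : ∀ (b : Bool) (E E' : Set Q), (if b then E else Eᶜ) = (if b then E' else E'ᶜ) → E = E' := by
    intro b E E' h; cases b
    · exact compl_injective (by simpa using h)
    · simpa using h
  have lev1 : ∀ p p' : Q, π p' = π p → π (p⁻¹ * p') = 1 := by
    intro p p' h; rw [map_mul, map_inv, h, inv_mul_cancel]
  have F1 : ∀ σ : Q × Bool, {τ : Q × Bool | π τ.1 = π σ.1 ∧ hw H g K σ K ⊆ hw H g K τ 0 ∧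
      hw H g K τ 0 ⊆ hw H g K σ 0}.encard ≤ (c1 : ℕ∞) := by
    rintro ⟨p, b⟩
    refine W.Fx K _ (fun τ => if b then tr p⁻¹ (hw H g K τ 0) else (tr p⁻¹ (hw H g K τ 0))ᶜ) ?_ ?_
    · rintro ⟨p', b'⟩ ⟨h0, h1, h2⟩
      refine ⟨?_, hw_norm K p b _ h1 h2⟩
      rw [← hw_tr]
      exact eC b _ (W.hw_C K _ (lev1 _ _ h0) b' 0)
    · rintro ⟨p', b'⟩ ⟨h0, -⟩ ⟨p'', b''⟩ ⟨h0', -⟩ hb hX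
      simp only at hb h0 h0'
      subst hb
      exact W.hw_inj K (h0.trans h0'.symm) (tr_inj (einj b _ _ hX))
  have F2 : ∀ σ : Q × Bool, {τ : Q × Bool | π τ.1 = π σ.1 ∧ hw H g K τ K ⊆ hw H g K σ 0 ∧
      hw H g K σ 0 ⊆ hw H g K τ 0}.encard ≤ (c1 : ℕ∞) := by
    rintro ⟨p, b⟩
    refine W.Fx K _ (fun τ => if τ.2 then tr τ.1⁻¹ (hw H g K (p, b) 0) else (tr τ.1⁻¹ (hw H g K (p, b) 0))ᶜ) ?_ ?_
    · rintro ⟨p', b'⟩ ⟨h0, h1, h2⟩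
      refine ⟨?_, hw_norm K p' b' _ h1 h2⟩
      rw [← hw_tr]
      exact eC b' _ (W.hw_C K _ (lev1 _ _ h0.symm) b 0)
    · rintro ⟨p', b'⟩ ⟨h0, -⟩ ⟨p'', b''⟩ ⟨h0', -⟩ hb hX
      simp only at hb h0 h0' hX
      subst hb
      have := einj b' _ _ hX
      rw [← hw_tr, ← hw_tr] at this
      have := W.hw_inj K (by rw [lev1 _ _ h0.symm, lev1 _ _ h0'.symm]) this
      simpa using this
  have heq : ∀ i q (σ : Q × Bool) x, q * x ∈ hw H g K (q * σ.1, σ.2) i ↔ x ∈ hw H g K σ i := by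
    intro i q σ x
    rw [hw_tr, mem_tr, inv_mul_cancel_left]
  choose e he1 he2 he3 using fun σ => W.hw_SW K σ 1
  have N1 : ∀ (σ τ : Q × Bool) i j x y, x ∉ hw H g K σ i → y ∈ hw H g K σ (i+1) → x ∉ hw H g K τ j →
      y ∈ hw H g K τ j → hw H g K σ (i+1) ⊆ hw H g K τ j ∨ hw H g K τ j ⊆ hw H g K σ i := by
    rintro ⟨p, b⟩ ⟨q, b'⟩ i j x y hx hy hx' hy'
    obtain ⟨p, rfl⟩ : ∃ p', p = q * p' := ⟨q⁻¹ * p, by simp⟩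
    have eq : hw H g K (q, b') j = tr q (hw H g K (1, b') j) := by rw [← hw_tr, mul_one]
    rw [hw_tr] at hx
    rw [hw_tr] at hy
    rw [eq] at hx' hy'
    rw [hw_tr, hw_tr, eq, tr_mono, tr_mono]
    obtain ⟨E, hE, h1, h2⟩ := W.hw_SW K (p, b) i
    rcases W.nest2 hE (W.hw_C K 1 (map_one _) b' j) (fun h => hx (h2 h)) hx' (h1 hy) hy' with h | h
    · exact Or.inl (h1.trans h)
    · exact Or.inr (h.trans h2)
  have N0 : ∀ (σ τ : Q × Bool) i j x y, π σ.1 = π τ.1 → x ∉ hw H g K σ i → y ∈ hw H g K σ i → x ∉ hw H g K τ j →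
      y ∈ hw H g K τ j → hw H g K σ i ⊆ hw H g K τ j ∨ hw H g K τ j ⊆ hw H g K σ i := by
    rintro ⟨p, b⟩ ⟨q, b'⟩ i j x y hl hx hy hx' hy'
    obtain ⟨p, rfl⟩ : ∃ p', p = q * p' := ⟨q⁻¹ * p, by simp⟩
    have eq : hw H g K (q, b') j = tr q (hw H g K (1, b') j) := by rw [← hw_tr, mul_one]
    rw [hw_tr] at hx hy
    rw [eq] at hx' hy'
    rw [hw_tr, eq, tr_mono, tr_mono]
    have hp : π p = 1 := by simpa using hl
    exact W.nest2 (W.hw_C K p hp b i) (W.hw_C K 1 (map_one _) b' j) hx hx' hy hy'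
  have hinc := inc_bound (hw H g K) (fun σ => π σ.1) (W.hw_anti K) N1 N0 M
    (fun σ τ j a b => W.P0 K M (by omega) σ τ j a b) c1 F1 F2
  have TW : ThickW C (fun σ => hw H g K σ 0) (fun σ => hw H g K σ K) e (fun σ => (σ.1, !σ.2)) := 
    { nest := W.nest
      fin := W.fin
      c3 := W.c3
      eC := he1
      Ve := fun σ => (W.hw_anti K σ (show (1:ℤ) + 1 ≤ K by omega)).trans (he2 σ)
      eU := fun σ => (he3 σ).trans (W.hw_anti K σ (show (0:ℤ) ≤ 1 by omega))
      ne := fun σ h => W.hw_strict K σ 0 (h.trans (he3 σ))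
      barU := fun σ => by
        change hw H g K (σ.1, !σ.2) 0 = _
        rw [hw_bar, sub_zero]
      barV := fun σ => by
        change hw H g K (σ.1, !σ.2) K = _
        rw [hw_bar, sub_self] }
  refine TW.main (fun q σ => (q * σ.1, σ.2)) (heq 0) (heq K)
    (TW.acyl (fun q σ => (q * σ.1, σ.2)) (heq 0) (heq K) ?_ (6 * c1 + 1) (by omega) ?_) ?_
  · intro a a' σ h
    simpa using h
  · intro x y σ h
    refine (hinc x y σ h).trans ?_
    exact_mod_cast Nat.le_succ _
  · intro B
    obtain ⟨y, hy⟩ := W.Hne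
    refine ⟨g ^ (K * (B + 1)) * y, ?_⟩
    have hch : WChain (fun σ => hw H g K σ 0) (fun σ => hw H g K σ K) 1 (g ^ (K * (B + 1)) * y)
        ((List.range (B+1)).map (fun j : ℕ => ((g ^ (K * j), true) : Q × Bool))) := by
      constructor
      · rw [List.pairwise_map]
        refine List.pairwise_lt_range.imp ?_
        intro a b hab
        rw [wLt, hw_t, hw_t, ← zpow_add, ← zpow_add]
        refine W.gpow_anti ?_
        have : (a : ℤ) + 1 ≤ b := by exact_mod_cast hab
        nlinarith
      · intro σ hσ
        rw [List.mem_map] at hσ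
        obtain ⟨j, hj, rfl⟩ := hσ
        rw [List.mem_range] at hj
        beta_reduce
        rw [hw_t, hw_t, ← zpow_add, ← zpow_add]
        constructor
        · intro h
          have h' := W.gpow_anti (show (0:ℤ) ≤ K * j + 0 by positivity) h
          simp only [zpow_zero, tr_one] at h'
          exact W.one h'
        · refine W.gpow_anti (show K * j + K ≤ K * (B+1) from ?_) ?_
          · have : (j : ℤ) + 1 ≤ B + 1 := by exact_mod_cast hj
            nlinarith
          · simpa [mem_tr] using hy
    have := TW.le_D hch
    rw [List.length_map, List.length_range] at this
    omega
end WallMain2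

section Hats
variable {α : Type} [DecidableEq α] {N : Type} [Group N] (θ : N →* MulAut (FreeGroup α))

/-- affine action on the free group -/
def ac (q : FreeGroup α ⋊[θ] N) (x : FreeGroup α) : FreeGroup α := q.left * θ q.right x

lemma ac_mul (p q : FreeGroup α ⋊[θ] N) (x : FreeGroup α) : ac θ (p * q) x = ac θ p (ac θ q x) := by
  simp [ac, mul_assoc]
lemma ac_one (x : FreeGroup α) : ac θ 1 x = x := by simp [ac]
lemma ac_inl (v x : FreeGroup α) : ac θ (SemidirectProduct.inl v) x = v * x := by simp [ac]

def sm (q : FreeGroup α ⋊[θ] N) (P : Set (FreeGroup α)) : Set (FreeGroup α) := {w | ac θ q⁻¹ w ∈ P}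

variable {θ}
lemma mem_sm {q : FreeGroup α ⋊[θ] N} {P : Set (FreeGroup α)} {w} : w ∈ sm θ q P ↔ ac θ q⁻¹ w ∈ P := Iff.rfl

lemma AI.sm {P : Set (FreeGroup α)} (h : AI P) (q : FreeGroup α ⋊[θ] N) : AI (sm θ q P) :=
  h.affine _ _

lemma sm_HT (u v : FreeGroup α) (s : α × Bool) : sm θ (SemidirectProduct.inl u) (HT v s) = HT (u * v) s := by
  ext w; rw [mem_sm, HT_mul, ← map_inv, ac_inl]

variable (θ)
def En (ε : Fin 3 → α × Bool) (q : FreeGroup α ⋊[θ] N) (i : Fin 3) (P : Set (FreeGroup α)) : Prop :=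
  ∀ᶠ M : ℕ in Filter.atTop, ac θ q (ltr (ε i) ^ M) ∈ P

def hat (ε : Fin 3 → α × Bool) (P : Set (FreeGroup α)) : Set (FreeGroup α ⋊[θ] N) :=
  {q | ∃ i j, i ≠ j ∧ En θ ε q i P ∧ En θ ε q j P}
variable {θ} {ε : Fin 3 → α × Bool}

lemma ltr_ne (s : α × Bool) : ltr s ≠ 1 := by
  intro h
  have := ltr_mem_Hf s
  rw [h] at this
  exact one_notin_Hf s this

lemma ac_pow (q : FreeGroup α ⋊[θ] N) (s : α × Bool) (M : ℕ) :
    ac θ q (ltr s ^ M) = q.left * (θ q.right (ltr s)) ^ M := by rw [ac, map_pow]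

lemma thne (q : FreeGroup α ⋊[θ] N) (s : α × Bool) : θ q.right (ltr s) ≠ 1 := by
  intro h
  exact ltr_ne s ((map_eq_one_iff _ (θ q.right).injective).1 h)

lemma En_mono {P P' : Set (FreeGroup α)} (h : (P \ P').Finite) {q : FreeGroup α ⋊[θ] N} {i : Fin 3}
    (h1 : En θ ε q i P) : En θ ε q i P' := by
  have := finite_ends h (thne q (ε i)) q.left
  filter_upwards [h1, this] with M h2 h3
  rw [ac_pow] at h2 ⊢
  by_contra h4
  exact h3 ⟨h2, h4⟩

lemma En_disj {P P' : Set (FreeGroup α)} (h : (P ∩ P').Finite) {q : FreeGroup α ⋊[θ] N} {i : Fin 3}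
    (h1 : En θ ε q i P) (h2 : En θ ε q i P') : False := by
  have := finite_ends h (thne q (ε i)) q.left
  obtain ⟨M, h1, h2, h3⟩ := (h1.and (h2.and this)).exists
  rw [ac_pow] at h1 h2
  exact h3 ⟨h1, h2⟩

lemma En_compl {P : Set (FreeGroup α)} (h : AI P) (q : FreeGroup α ⋊[θ] N) (i : Fin 3) :
    En θ ε q i Pᶜ ↔ ¬ En θ ε q i P := by
  constructor
  · intro h1 h2
    exact En_disj (by rw [compl_inter_self]; exact finite_empty) h1 h2
  · intro h1
    rcases h.ends (thne q (ε i)) q.left with h2 | h2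
    · refine (h1 ?_).elim
      simpa only [En, ac_pow] using h2
    · simpa only [En, ac_pow, mem_compl_iff] using h2

lemma hat_mono {P P' : Set (FreeGroup α)} (h : (P \ P').Finite) : hat θ ε P ⊆ hat θ ε P' := by
  rintro q ⟨i, j, hij, h1, h2⟩
  exact ⟨i, j, hij, En_mono h h1, En_mono h h2⟩

lemma hat_sub {P P' : Set (FreeGroup α)} (h : P ⊆ P') : hat θ ε P ⊆ hat θ ε P' :=
  hat_mono (by rw [sdiff_eq_empty.2 h]; exact finite_empty)

lemma hat_compl {P : Set (FreeGroup α)} (h : AI P) : hat θ ε Pᶜ = (hat θ ε P)ᶜ := by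
  ext q
  simp only [hat, mem_compl_iff, mem_ofPred_eq, En_compl h]
  simp only [Fin.exists_fin_succ, Fin.exists_fin_zero, Fin.forall_fin_succ]
  simp
  tauto

lemma hat_sm (q p : FreeGroup α ⋊[θ] N) (P : Set (FreeGroup α)) : p ∈ hat θ ε (sm θ q P) ↔ q⁻¹ * p ∈ hat θ ε P := by
  simp only [hat, mem_ofPred_eq, En, mem_sm, ac_mul]

lemma hat_tr (q : FreeGroup α ⋊[θ] N) (P : Set (FreeGroup α)) : tr q (hat θ ε P) = hat θ ε (sm θ q P) := by
  ext p; rw [hat_sm, mem_tr]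

lemma ltr_pow_mem (s : α × Bool) (M : ℕ) : ltr s ^ (M+1) ∈ Hf s := by
  induction M with
  | zero => simpa using ltr_mem_Hf s
  | succ M ih =>
    rw [pow_succ', mul_mem_Hf]
    exact fun h => il_ne s (Hf_unique h ih)

lemma one_hat_Cyl (hε : Function.Injective ε) {t : List (α × Bool)} (ht : t ≠ []) :
    (1 : FreeGroup α ⋊[θ] N) ∉ hat θ ε (Cyl t) := by
  rintro ⟨i, j, hij, h1, h2⟩
  obtain ⟨a, t', rfl⟩ := List.exists_cons_of_ne_nil ht
  obtain ⟨M, h1, h2, h3⟩ := (h1.and (h2.and (Filter.eventually_ge_atTop 1))).exists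
  obtain ⟨M, rfl⟩ := Nat.exists_eq_add_of_le' h3
  rw [ac_one] at h1 h2
  exact hij (hε ((Hf_unique (ltr_pow_mem _ M) (Cyl_head h1)).trans
    (Hf_unique (ltr_pow_mem _ M) (Cyl_head h2)).symm))

lemma AI_Cyl_of {v : FreeGroup α} {s : α × Bool} {t : List (α × Bool)} (h : HT v s = (Cyl t)ᶜ) : AI (Cyl t) := by
  rw [← compl_compl (Cyl t), ← h]; exact (AI_HT v s).compl

lemma faithful (hε : Function.Injective ε) (v w : FreeGroup α) (s : α × Bool) :
    (SemidirectProduct.inl v : FreeGroup α ⋊[θ] N) ∈ hat θ ε (HT w s) ↔ v ∈ HT w s := by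
  have key : ∀ w : FreeGroup α, (1 : FreeGroup α ⋊[θ] N) ∈ hat θ ε (HT w s) ↔ 1 ∈ HT w s := by
    intro w
    obtain ⟨t, ht, ht', h | h⟩ := HT_form w s
    · rw [h]
      have : (1 : FreeGroup α) ∉ Cyl t := by
        intro h1; rw [mem_Cyl, FreeGroup.toWord_one] at h1
        exact ht' (List.prefix_nil.1 h1)
      simp [this, one_hat_Cyl hε ht']
    · have : (1 : FreeGroup α) ∉ Cyl t := by
        intro h1; rw [mem_Cyl, FreeGroup.toWord_one] at h1
        exact ht' (List.prefix_nil.1 h1)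
      rw [h, hat_compl (AI_Cyl_of h)]
      simp [this, one_hat_Cyl hε ht']
  have e : HT w s = HT (v * (v⁻¹ * w)) s := by rw [mul_inv_cancel_left]
  rw [e, ← sm_HT (θ := θ), hat_sm, inv_mul_cancel, key, mem_sm, ← map_inv, ac_inl, inv_mul_cancel]

variable [Finite α]

lemma Tfin (hε : Function.Injective ε) (q : FreeGroup α ⋊[θ] N) :
    {t | FreeGroup.IsReduced t ∧ q ∈ hat θ ε (Cyl t)}.Finite := by
  have hf : (⋃ i : Fin 3, ⋃ r : α × Bool, {w | ¬ (w ∈ sm θ q (Hf (ε i)) ↔ w * ltr r ∈ sm θ q (Hf (ε i)))}).Finite := by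
    refine finite_iUnion fun i => finite_iUnion fun r => ?_
    have := AI_HT 1 (ε i)
    rw [HT_one] at this
    exact this.sm q (ltr r)
  obtain ⟨B, hB⟩ := (hf.image (fun w => w.toWord.length)).bddAbove
  refine (List.finite_length_le (α × Bool) B).subset ?_
  rintro t ⟨ht, i, j, hij, h1, h2⟩
  by_contra hlen
  have hlen : B < t.length := by simpa using hlen
  have hc := Cyl_conn (P := sm θ q (Hf (ε i))) ht (by
    intro w hw r _
    by_contra hn
    have h3 : w.toWord.length ≤ B := hB ⟨w, mem_iUnion.2 ⟨i, mem_iUnion.2 ⟨r, hn⟩⟩, rfl⟩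
    have := (mem_Cyl.1 hw).length_le
    omega)
  obtain ⟨M, h1, h2, h3⟩ := (h1.and (h2.and (Filter.eventually_ge_atTop 1))).exists
  obtain ⟨M, rfl⟩ := Nat.exists_eq_add_of_le' h3
  have e := (hc _ h1).trans (hc _ h2).symm
  rw [mem_sm, mem_sm, ← ac_mul, ← ac_mul, inv_mul_cancel, ac_one, ac_one] at e
  exact hij (hε (Hf_unique (e.1 (ltr_pow_mem _ M)) (ltr_pow_mem _ M)))

variable (θ ε) in
def cuts : Set (Set (FreeGroup α ⋊[θ] N)) := {E | ∃ v s, E = hat θ ε (HT v s)}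

lemma cuts_sys (hε : Function.Injective ε) : CutSys (cuts θ ε) where
  nest := by
    rintro _ ⟨v, s, rfl⟩ _ ⟨v', s', rfl⟩
    rcases HT_nest v v' s s' with h | h | h | h
    · exact Or.inl (hat_sub h)
    · exact Or.inr (Or.inl (hat_sub h))
    · refine Or.inr (Or.inr (Or.inl ?_))
      have h1 : hat θ ε (HT v s) ⊆ hat θ ε (HT v' s')ᶜ := hat_sub (fun x hx hx' => h x ⟨hx, hx'⟩)
      rw [hat_compl (AI_HT _ _)] at h1
      exact fun x hx => h1 hx.1 hx.2
    · refine Or.inr (Or.inr (Or.inr ?_))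
      have h1 : hat θ ε (HT v' s')ᶜ ⊆ hat θ ε (HT v s) := hat_sub (fun x hx => (h x).resolve_right hx)
      rw [hat_compl (AI_HT _ _)] at h1
      intro x
      by_cases hx : x ∈ hat θ ε (HT v' s')
      · exact Or.inr hx
      · exact Or.inl (h1 hx)
  fin := by
    intro x y
    refine (((Tfin (θ := θ) hε y).image (fun t => hat θ ε (Cyl t))).union
      ((Tfin (θ := θ) hε x).image (fun t => hat θ ε (Cyl t)ᶜ))).subset ?_
    rintro _ ⟨⟨v, s, rfl⟩, hx, hy⟩
    obtain ⟨t, ht, -, h | h⟩ := HT_form v s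
    · left; rw [h] at hy ⊢; exact ⟨t, ⟨ht, hy⟩, rfl⟩
    · right; rw [h] at hx ⊢
      refine ⟨t, ⟨ht, ?_⟩, rfl⟩
      rw [hat_compl (AI_Cyl_of h)] at hx
      exact not_not.1 hx
  c3 := by
    rintro _ ⟨v, s, rfl⟩ x y hx hy
    refine ⟨SemidirectProduct.inl v, ?_⟩
    rintro _ ⟨v', s', rfl⟩
    rw [faithful hε]
    constructor
    · intro hz hx'
      rcases HT_nest v v' s s' with h | h | h | h
      · exact hat_sub h
      · exact (HT_base v s (h hz)).elim
      · have h1 : v * ltr s ∉ HT v' s' := fun h' => h _ ⟨HT_tip v s, h'⟩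
        have h2 : v ∉ (HT v' s')ᶜ := fun h => h hz
        have h3 : v * ltr s ∈ (HT v' s')ᶜ := h1
        rw [HT_compl] at h2 h3
        obtain ⟨e1, e2⟩ := edgeHT h2 h3
        have e3 : HT v s = (HT v' s')ᶜ := by rw [HT_compl, e1, e2]
        rw [e3, hat_compl (AI_HT _ _)] at hx
        exact (hx hx').elim
      · have h1 : hat θ ε (HT v' s')ᶜ ⊆ hat θ ε (HT v s) := hat_sub (fun x hx => (h x).resolve_right hx)
        rw [hat_compl (AI_HT _ _)] at h1
        exact (hx (h1 hx')).elim
    · intro hz hy'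
      rcases HT_nest v v' s s' with h | h | h | h
      · obtain ⟨e1, e2⟩ := edgeHT hz (h (HT_tip v s))
        rw [e1, e2]
      · exact hat_sub h
      · have h1 : hat θ ε (HT v s) ⊆ hat θ ε (HT v' s')ᶜ := hat_sub (fun x hx hx' => h x ⟨hx, hx'⟩)
        rw [hat_compl (AI_HT _ _)] at h1
        exact (h1 hy hy').elim
      · exact ((h v).elim (HT_base v s) hz).elim

lemma hat_le (hε : Function.Injective ε) {v w : FreeGroup α} {s r : α × Bool}
    (h : hat θ ε (HT v s) ⊆ hat θ ε (HT w r)) : HT v s ⊆ HT w r := by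
  intro x hx
  exact (faithful (θ := θ) hε _ _ _).1 (h ((faithful hε _ _ _).2 hx))

theorem hat_wall (hε : Function.Injective ε) (g : FreeGroup α) (s0 : α × Bool) (h1 : HT g s0 ⊆ Hf s0)
    (h2 : ¬ Hf s0 ⊆ HT g s0)
    (SW : ∀ q : FreeGroup α ⋊[θ] N, ∃ v s, (sm θ (q * SemidirectProduct.inl g) (Hf s0) \ HT v s).Finite ∧
      (HT v s \ sm θ q (Hf s0)).Finite)
    (R : ∀ q : FreeGroup α ⋊[θ] N, SemidirectProduct.rightHom q ≠ 1 → ∀ a b : ℤ, a ≠ 0 → b ≠ 0 →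
      (q * SemidirectProduct.inl g * q⁻¹) ^ a ≠ (SemidirectProduct.inl g) ^ b) :
    WallData (SemidirectProduct.rightHom : FreeGroup α ⋊[θ] N →* N) (cuts θ ε) (hat θ ε (Hf s0))
      (SemidirectProduct.inl g) := by
  have inl_of : ∀ f : FreeGroup α ⋊[θ] N, SemidirectProduct.rightHom f = 1 → ∃ u, f = SemidirectProduct.inl u := by
    intro f hf
    have : f ∈ (SemidirectProduct.rightHom : FreeGroup α ⋊[θ] N →* N).ker := hf
    rw [← SemidirectProduct.range_inl_eq_ker_rightHom] at this
    obtain ⟨u, hu⟩ := this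
    exact ⟨u, hu.symm⟩
  have e1 : ∀ u v s, tr (SemidirectProduct.inl u : FreeGroup α ⋊[θ] N) (hat θ ε (HT v s)) = hat θ ε (HT (u * v) s) := by
    intro u v s; rw [hat_tr, sm_HT]
  have e2 : tr (SemidirectProduct.inl g : FreeGroup α ⋊[θ] N) (hat θ ε (Hf s0)) = hat θ ε (HT g s0) := by
    rw [← HT_one, e1, mul_one]
  refine ⟨cuts_sys hε, ?_, ?_, ?_, ⟨1, s0, congrArg _ (HT_one s0).symm⟩, SemidirectProduct.rightHom_inl g,
    ?_, ?_, ?_, ?_, R⟩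
  · rintro _ ⟨v, s, rfl⟩
    exact ⟨_, _, by rw [← HT_compl, hat_compl (AI_HT _ _)]⟩
  · rintro f _ hf ⟨v, s, rfl⟩
    obtain ⟨u, rfl⟩ := inl_of f hf
    exact ⟨_, _, e1 u v s⟩
  · rintro f _ hf ⟨v, s, rfl⟩ h
    obtain ⟨u, rfl⟩ := inl_of f hf
    rw [e1] at h
    have := (HT_inj ((hat_le hε h.subset).antisymm (hat_le hε h.superset))).1
    have hu : u = 1 := by simpa using this
    rw [hu, map_one]
  · rw [e2]; exact hat_sub h1
  · rw [e2, ← HT_one]; intro h; exact h2 (by rw [← HT_one]; exact hat_le hε h)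
  · rw [← HT_one, ← map_one (SemidirectProduct.inl : FreeGroup α →* FreeGroup α ⋊[θ] N), faithful hε, HT_one]
    exact one_notin_Hf s0
  · intro q
    obtain ⟨v, s, h1, h2⟩ := SW q
    refine ⟨_, ⟨v, s, rfl⟩, ?_, ?_⟩
    · rw [hat_tr]; exact hat_mono h1
    · rw [hat_tr]; exact hat_mono h2

end Hats

section Leaf
variable {α : Type} [DecidableEq α] 

def Pl (P : Set (FreeGroup α)) (v : FreeGroup α) (s : α × Bool) : Prop := (HT v s \ P).Finite
def Mi (P : Set (FreeGroup α)) (v : FreeGroup α) (s : α × Bool) : Prop := (HT v s ∩ P).Finite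

lemma HT_inf (v : FreeGroup α) (s : α × Bool) : (HT v s).Infinite := by
  have hne : ltr s ≠ 1 := fun h => one_notin_Hf s (h ▸ ltr_mem_Hf s)
  have hinj : Function.Injective fun N : ℕ => (v * ltr s) * ltr s ^ N := pow_inj' hne _
  refine infinite_of_injective_forall_mem hinj ?_
  intro N
  rw [mem_HT]
  have e : v⁻¹ * (v * ltr s * ltr s ^ N) = ltr s * ltr s ^ N := by group
  rw [e]
  induction N with
  | zero => simpa using ltr_mem_Hf s
  | succ N ih =>
    rw [mul_mem_Hf, pow_succ']
    exact fun h => il_ne s (Hf_unique h (ih (by group)))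

lemma not_Pl_Mi {P : Set (FreeGroup α)} {v : FreeGroup α} {s : α × Bool} (h1 : Pl P v s) (h2 : Mi P v s) : False := by
  refine HT_inf v s ((h1.union h2).subset ?_)
  intro x hx
  by_cases h : x ∈ P
  · exact Or.inr ⟨hx, h⟩
  · exact Or.inl ⟨hx, h⟩

lemma HT_conn {P : Set (FreeGroup α)} {v : FreeGroup α} {s : α × Bool}
    (h : ∀ w ∈ HT v s, ∀ r, (w ∈ P ↔ w * ltr r ∈ P)) : Pl P v s ∨ Mi P v s := by
  have key := Cyl_conn (P := {w | v * w ∈ P}) (t := [s]) FreeGroup.IsReduced.singleton (by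
    intro w hw r _
    rw [Cyl_single] at hw
    have := h (v * w) (by rw [mem_HT, inv_mul_cancel_left]; exact hw) r
    rwa [mul_assoc] at this)
  rw [Cyl_single] at key
  have key2 : ∀ w ∈ HT v s, (w ∈ P ↔ v * FreeGroup.mk [s] ∈ P) := by
    intro w hw
    have := key (v⁻¹ * w) hw
    simpa using this
  by_cases h0 : v * FreeGroup.mk [s] ∈ P
  · left
    have : HT v s \ P = ∅ := by
      ext w; simp only [Set.mem_sdiff, mem_empty_iff_false, iff_false]; rintro ⟨h1, h2⟩; exact h2 ((key2 w h1).2 h0)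
    rw [Pl, this]; exact finite_empty
  · right
    have : HT v s ∩ P = ∅ := by
      ext w; simp only [mem_inter_iff, mem_empty_iff_false, iff_false]; rintro ⟨h1, h2⟩; exact h0 ((key2 w h1).1 h2)
    rw [Mi, this]; exact finite_empty

lemma HT_split {v w : FreeGroup α} {s : α × Bool} (hw : w ∈ HT v s) :
    w = v * ltr s ∨ ∃ r, r ≠ il s ∧ w ∈ HT (v * ltr s) r := by
  by_cases h : w = v * ltr s
  · exact Or.inl h
  · obtain ⟨r, hr⟩ := HT_cover _ _ h
    refine Or.inr ⟨r, ?_, hr⟩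
    rintro rfl
    rw [← HT_compl] at hr
    exact hr hw

variable [Finite α]
lemma leaf {P : Set (FreeGroup α)} : ∀ (N : ℕ) (v : FreeGroup α) (s : α × Bool),
    (∀ d, (∃ r, ¬ (d ∈ P ↔ d * ltr r ∈ P)) → d ∈ HT v s → (v⁻¹ * d).toWord.length ≤ N) →
    ¬ Pl P v s → ¬ Mi P v s → ∃ v1 s1, HT v1 s1 ⊆ HT v s ∧
      (∀ r, r ≠ il s1 → Pl P (v1 * ltr s1) r ∨ Mi P (v1 * ltr s1) r) ∧
      (∃ r, r ≠ il s1 ∧ Pl P (v1 * ltr s1) r) ∧ (∃ r, r ≠ il s1 ∧ Mi P (v1 * ltr s1) r) := by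
  intro N
  induction N with
  | zero =>
    intro v s hd h1 h2
    exfalso
    rcases HT_conn (P := P) (v := v) (s := s) (by
      intro w hw r
      by_contra hc
      have := hd w ⟨r, hc⟩ hw
      rw [mem_HT, mem_Hf] at hw
      rw [List.eq_nil_of_length_eq_zero (Nat.le_zero.1 this)] at hw
      simp at hw) with h | h
    · exact h1 h
    · exact h2 h
  | succ N ih =>
    intro v s hd h1 h2
    by_cases hm : ∃ r, r ≠ il s ∧ ¬ Pl P (v * ltr s) r ∧ ¬ Mi P (v * ltr s) r
    · obtain ⟨r, hr, h3, h4⟩ := hm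
      obtain ⟨v1, s1, h5, h6⟩ := ih (v * ltr s) r (by
        intro d hdd hdr
        have h7 := hd d hdd (HT_sub hr hdr)
        have e : v⁻¹ * d = ltr s * ((v * ltr s)⁻¹ * d) := by group
        rw [e, ltr_mul_word (fun h => hr (Hf_unique hdr h))] at h7
        simpa using h7) h3 h4
      exact ⟨v1, s1, h5.trans (HT_sub hr), h6⟩
    · push Not at hm
      have hall : ∀ r, r ≠ il s → Pl P (v * ltr s) r ∨ Mi P (v * ltr s) r := by
        intro r hr
        by_cases h : Pl P (v * ltr s) r
        · exact Or.inl h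
        · exact Or.inr (hm r hr h)
      refine ⟨v, s, Subset.rfl, hall, ?_, ?_⟩
      · by_contra hc
        push Not at hc
        apply h2
        refine ((finite_singleton (v * ltr s)).union (finite_iUnion (fun r : {r // r ≠ il s} =>
          (show (HT (v * ltr s) r.1 ∩ P).Finite from (hall r.1 r.2).resolve_left (hc _ r.2))))).subset ?_
        rintro w ⟨hw, hwP⟩
        rcases HT_split hw with h | ⟨r, hr, h⟩
        · exact Or.inl h
        · exact Or.inr (mem_iUnion.2 ⟨⟨r, hr⟩, h, hwP⟩)
      · by_contra hc
        push Not at hc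
        apply h1
        refine ((finite_singleton (v * ltr s)).union (finite_iUnion (fun r : {r // r ≠ il s} =>
          (show (HT (v * ltr s) r.1 \ P).Finite from (hall r.1 r.2).resolve_right (hc _ r.2))))).subset ?_
        rintro w ⟨hw, hwP⟩
        rcases HT_split hw with h | ⟨r, hr, h⟩
        · exact Or.inl h
        · exact Or.inr (mem_iUnion.2 ⟨⟨r, hr⟩, h, hwP⟩)

/-- a vertex is good outside a set of excluded directions -/
def GoodV (P : Set (FreeGroup α)) (v : FreeGroup α) (X : Set (α × Bool)) : Prop :=
  (∀ r, r ∉ X → Pl P v r ∨ Mi P v r) ∧ (∃ r, r ∉ X ∧ Pl P v r) ∧ (∃ r, r ∉ X ∧ Mi P v r)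

lemma leaf_main {P : Set (FreeGroup α)} (hP : AI P) (v : FreeGroup α) (s : α × Bool) 
    (h1 : ¬ Pl P v s) (h2 : ¬ Mi P v s) : ∃ v1 s1, HT v1 s1 ⊆ HT v s ∧ GoodV P (v1 * ltr s1) {il s1} := by
  have hf : (⋃ r : α × Bool, {w | ¬ (w ∈ P ↔ w * ltr r ∈ P)}).Finite := finite_iUnion fun r => hP _
  obtain ⟨B, hB⟩ := (hf.image (fun d => (v⁻¹ * d).toWord.length)).bddAbove
  obtain ⟨v1, s1, h3, h4, h5⟩ := leaf (P := P) B v s (by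
    rintro d ⟨r, hr⟩ -
    exact hB ⟨d, mem_iUnion.2 ⟨r, hr⟩, rfl⟩) h1 h2
  exact ⟨v1, s1, h3, h4, h5⟩

lemma dich {P : Set (FreeGroup α)} (hP : AI P) (i1 : P.Infinite) (i2 : Pᶜ.Infinite) :
    (∃ v, GoodV P v ∅) ∨ ∃ v β v' β', GoodV P v {β} ∧ GoodV P v' {β'} ∧ ∀ r, r ≠ β → HT v r ⊆ HT v' β' := by
  by_cases hm : ∃ s, ¬ Pl P 1 s ∧ ¬ Mi P 1 s
  · obtain ⟨s, h1, h2⟩ := hm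
    obtain ⟨v1, s1, -, hg⟩ := leaf_main hP 1 s h1 h2
    by_cases hb : Pl P (v1 * ltr s1) (il s1) ∨ Mi P (v1 * ltr s1) (il s1)
    · left
      refine ⟨v1 * ltr s1, ?_, ?_, ?_⟩
      · intro r _
        by_cases hr : r = il s1
        · rw [hr]; exact hb
        · exact hg.1 r hr
      · obtain ⟨r, -, h⟩ := hg.2.1; exact ⟨r, id, h⟩
      · obtain ⟨r, -, h⟩ := hg.2.2; exact ⟨r, id, h⟩
    · right
      push Not at hb
      obtain ⟨v2, s2, hs, hg2⟩ := leaf_main hP _ _ hb.1 hb.2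
      refine ⟨_, _, _, _, hg, hg2, ?_⟩
      intro r hr
      rw [← HT_compl]
      intro x hx hx2
      exact HT_disj hr (hs hx2) hx
  · left
    push Not at hm
    have hall : ∀ r, Pl P 1 r ∨ Mi P 1 r := fun r => or_iff_not_imp_left.2 (hm r)
    refine ⟨1, fun r _ => hall r, ?_, ?_⟩
    · by_contra hc
      push Not at hc
      refine i1 (((finite_singleton 1).union (finite_iUnion (fun r =>
          (show (HT 1 r ∩ P).Finite from (hall r).resolve_left (hc r id))))).subset ?_)
      intro w hw
      by_cases h : w = 1
      · exact Or.inl h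
      · obtain ⟨r, hr⟩ := HT_cover _ _ h
        exact Or.inr (mem_iUnion.2 ⟨r, hr, hw⟩)
    · by_contra hc
      push Not at hc
      refine i2 (((finite_singleton 1).union (finite_iUnion (fun r =>
          (show (HT 1 r \ P).Finite from (hall r).resolve_right (hc r id))))).subset ?_)
      intro w hw
      by_cases h : w = 1
      · exact Or.inl h
      · obtain ⟨r, hr⟩ := HT_cover _ _ h
        exact Or.inr (mem_iUnion.2 ⟨r, hr, hw⟩)
end Leaf

section AxisS
variable {α : Type} [DecidableEq α]

structure Axis (α : Type) [DecidableEq α] where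
  lam : ℤ → α × Bool
  p : ℤ → FreeGroup α
  l : ℕ
  hl : 0 < l
  p0 : p 0 = 1
  ps : ∀ i, p (i + 1) = p i * ltr (lam i)
  per : ∀ i, p (i + l) = p l * p i
  lper : ∀ i, lam (i + l) = lam i
  red : ∀ i, lam (i + 1) ≠ il (lam i)

namespace Axis

def g (X : Axis α) : FreeGroup α := X.p X.l
def K (X : Axis α) (i : ℤ) : Set (FreeGroup α) := HT (X.p i) (X.lam i)

lemma K_succ (X : Axis α) (i : ℤ) : X.K (i + 1) ⊆ X.K i := by
  rw [K, K, X.ps]; exact HT_sub (X.red i)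

lemma K_anti (X : Axis α) {i j : ℤ} (h : i ≤ j) : X.K j ⊆ X.K i := by
  obtain ⟨k, rfl⟩ := Int.le.dest h
  clear h
  induction k with
  | zero => simp
  | succ k ih =>
    push_cast
    rw [← add_assoc]
    exact (X.K_succ _).trans ih

lemma p_mem (X : Axis α) (i j : ℤ) : X.p j ∈ X.K i ↔ i < j := by
  constructor
  · intro h
    by_contra h1
    exact HT_base _ _ (X.K_anti (not_lt.1 h1) h)
  · intro h
    have h1 : X.p ((j - 1) + 1) ∈ X.K (j - 1) := by rw [X.ps]; exact HT_tip _ _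
    rw [sub_add_cancel] at h1
    exact X.K_anti (by omega) h1

lemma p_inj (X : Axis α) {i j : ℤ} (h : X.p i = X.p j) : i = j := by
  have h1 := X.p_mem i j
  have h2 := X.p_mem j i
  rw [← h, X.p_mem] at h1
  rw [h, X.p_mem] at h2
  omega

lemma pper_nat (X : Axis α) (i : ℤ) (t : ℕ) : X.p (i + t * X.l) = X.g ^ t * X.p i := by
  induction t generalizing i with
  | zero => simp
  | succ t ih =>
    have : i + ((t + 1 : ℕ) : ℤ) * X.l = (i + t * X.l) + X.l := by push_cast; ring
    rw [this, X.per, ih, pow_succ', mul_assoc]; rfl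

lemma pper (X : Axis α) (i : ℤ) (t : ℤ) : X.p (i + t * X.l) = X.g ^ t * X.p i := by
  obtain ⟨k, rfl | rfl⟩ := t.eq_nat_or_neg
  · rw [X.pper_nat, zpow_natCast]
  · have := X.pper_nat (i + -(k:ℤ) * X.l) k
    rw [show i + -(k:ℤ) * X.l + k * X.l = i by ring] at this
    rw [this, zpow_neg, zpow_natCast, inv_mul_cancel_left]

lemma gpow (X : Axis α) (t : ℤ) : X.g ^ t = X.p (t * X.l) := by
  have := X.pper 0 t
  rw [zero_add, X.p0, mul_one] at this
  exact this.symm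

lemma g_ne (X : Axis α) : X.g ≠ 1 := by
  intro h
  rw [g, ← X.p0] at h
  have := X.p_inj h
  have := X.hl
  omega

lemma K_compl (X : Axis α) (i : ℤ) : (X.K (i - 1))ᶜ = HT (X.p i) (il (X.lam (i - 1))) := by
  rw [K, HT_compl, ← X.ps, sub_add_cancel]

lemma end_pos (X : Axis α) (v : FreeGroup α) (i t : ℤ) :
    v * (X.p i)⁻¹ * X.g ^ t ∈ HT v (X.lam i) ↔ i < t * X.l := by
  have h := HT_mul (v * (X.p i)⁻¹) (X.p i) (v * (X.p i)⁻¹ * X.g ^ t) (X.lam i)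
  rw [inv_mul_cancel_right, inv_mul_cancel_left, X.gpow] at h
  rw [X.gpow, h]
  exact X.p_mem _ _

lemma end_neg (X : Axis α) (v : FreeGroup α) (i t : ℤ) :
    v * (X.p i)⁻¹ * X.g ^ t ∈ HT v (il (X.lam (i - 1))) ↔ ¬ (i - 1 < t * X.l) := by
  have h := HT_mul (v * (X.p i)⁻¹) (X.p i) (v * (X.p i)⁻¹ * X.g ^ t) (il (X.lam (i - 1)))
  rw [inv_mul_cancel_right, inv_mul_cancel_left, X.gpow] at h
  rw [X.gpow, h, ← K_compl, mem_compl_iff, X.p_mem]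

lemma g_pow_inj (X : Axis α) {a b : ℤ} (h : X.g ^ a = X.g ^ b) : a = b := by
  rw [X.gpow, X.gpow] at h
  have := X.p_inj h
  have h2 : (X.l : ℤ) ≠ 0 := by have := X.hl; omega
  exact mul_right_cancel₀ h2 this

lemma coset (X : Axis α) {v : FreeGroup α} {i j t : ℤ} (hi : 0 ≤ i) (hi' : i < X.l)
    (hj : 0 ≤ j) (hj' : j < X.l) (h : v * (X.p i)⁻¹ = v * (X.p j)⁻¹ * X.g ^ t) : i = j := by
  have h1 : X.p j = X.g ^ t * X.p i := by
    have := congrArg (fun x => X.p j * v⁻¹ * x * X.p i) h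
    simp only [mul_assoc, inv_mul_cancel, mul_one, inv_mul_cancel_left, mul_inv_cancel_left] at this
    exact this
  rw [← X.pper] at h1
  have h2 := X.p_inj h1
  have : t = 0 := by
    have hl := X.hl
    by_contra h3
    rcases lt_or_gt_of_ne h3 with h4 | h4
    · nlinarith
    · nlinarith
  subst this
  omega
end Axis

/-- separation of the two ends of the coset line -/
def sep (u : FreeGroup α) (P : Set (FreeGroup α)) (h : FreeGroup α) : Prop :=
  ((∀ᶠ N : ℕ in Filter.atTop, h * u ^ N ∈ P) ∧ (∀ᶠ N : ℕ in Filter.atTop, h * u⁻¹ ^ N ∉ P)) ∨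
  ((∀ᶠ N : ℕ in Filter.atTop, h * u ^ N ∉ P) ∧ (∀ᶠ N : ℕ in Filter.atTop, h * u⁻¹ ^ N ∈ P))

lemma ev_not {p : ℕ → Prop} (h1 : ∀ᶠ N in Filter.atTop, p N) (h2 : ∀ᶠ N in Filter.atTop, ¬ p N) : False := by
  obtain ⟨N, h3, h4⟩ := (h1.and h2).exists
  exact h4 h3

lemma Axis.ev_pos (X : Axis α) (v : FreeGroup α) (i : ℤ) :
    ∀ᶠ N : ℕ in Filter.atTop, v * (X.p i)⁻¹ * X.g ^ N ∈ HT v (X.lam i) := by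
  filter_upwards [Filter.eventually_gt_atTop i.natAbs] with N hN
  have := X.end_pos v i N
  rw [zpow_natCast] at this
  rw [this]
  have := X.hl
  have h1 : (N : ℤ) * 1 ≤ N * X.l := mul_le_mul_of_nonneg_left (by omega) (by omega)
  omega

lemma Axis.ev_neg (X : Axis α) (v : FreeGroup α) (i : ℤ) :
    ∀ᶠ N : ℕ in Filter.atTop, v * (X.p i)⁻¹ * X.g⁻¹ ^ N ∈ HT v (il (X.lam (i - 1))) := by
  filter_upwards [Filter.eventually_gt_atTop (i.natAbs + 1)] with N hN
  have := X.end_neg v i (-(N:ℤ))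
  rw [zpow_neg, zpow_natCast, ← inv_pow] at this
  rw [this]
  have := X.hl
  have h1 : (N : ℤ) * 1 ≤ N * X.l := mul_le_mul_of_nonneg_left (by omega) (by omega)
  rw [neg_mul]
  omega

lemma Pl.ev {P : Set (FreeGroup α)} {v h u : FreeGroup α} {s : α × Bool} (hp : Pl P v s) (hu : u ≠ 1)
    (he : ∀ᶠ N : ℕ in Filter.atTop, h * u ^ N ∈ HT v s) : ∀ᶠ N : ℕ in Filter.atTop, h * u ^ N ∈ P := by
  filter_upwards [he, finite_ends hp hu h] with N h1 h2
  by_contra h3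
  exact h2 ⟨h1, h3⟩

lemma Mi.ev {P : Set (FreeGroup α)} {v h u : FreeGroup α} {s : α × Bool} (hp : Mi P v s) (hu : u ≠ 1)
    (he : ∀ᶠ N : ℕ in Filter.atTop, h * u ^ N ∈ HT v s) : ∀ᶠ N : ℕ in Filter.atTop, h * u ^ N ∉ P := by
  filter_upwards [he, finite_ends hp hu h] with N h1 h2
  intro h3
  exact h2 ⟨h1, h3⟩

def opp (A B : Finset (α × Bool)) (s t : α × Bool) : Prop := (s ∈ A ∧ t ∈ B) ∨ (s ∈ B ∧ t ∈ A)

lemma Axis.sep_of (X : Axis α) {P : Set (FreeGroup α)} {v : FreeGroup α} {i : ℤ} {A B : Finset (α × Bool)}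
    (hA : ∀ r ∈ A, Pl P v r) (hB : ∀ r ∈ B, Mi P v r) (h : opp A B (il (X.lam (i - 1))) (X.lam i)) :
    sep X.g P (v * (X.p i)⁻¹) := by
  have hg := X.g_ne
  have hg' : X.g⁻¹ ≠ 1 := inv_ne_one.2 hg
  rcases h with ⟨h1, h2⟩ | ⟨h1, h2⟩
  · exact Or.inr ⟨(hB _ h2).ev hg (X.ev_pos v i), (hA _ h1).ev hg' (X.ev_neg v i)⟩
  · exact Or.inl ⟨(hA _ h2).ev hg (X.ev_pos v i), (hB _ h1).ev hg' (X.ev_neg v i)⟩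

lemma Axis.lper' (X : Axis α) (i : ℤ) (t : ℤ) : X.lam (i + t * X.l) = X.lam i := by
  induction t with
  | zero => simp
  | succ t ih => rw [← ih, ← X.lper (i + t * X.l)]; congr 1; ring
  | pred t ih => rw [← ih, ← X.lper (i + (-t - 1) * X.l)]; congr 1; ring

lemma Axis.cover (X : Axis α) {s : α × Bool} {h : FreeGroup α} (hs : sep X.g (Hf s) h) :
    ∃ i : ℕ, i < X.l ∧ ((X.lam i = s ∧ ∃ t : ℤ, h = (X.p i)⁻¹ * X.g ^ t) ∨
      (X.lam i = il s ∧ ∃ t : ℤ, h = ltr s * (X.p i)⁻¹ * X.g ^ t)) := by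
  have h1 : ∃ j, ¬ (h * X.p j ∈ Hf s ↔ h * X.p (j + 1) ∈ Hf s) := by
    by_contra hc
    push Not at hc
    have h2 : ∀ j, (h * X.p j ∈ Hf s ↔ h * X.p 0 ∈ Hf s) := by
      intro j
      induction j with
      | zero => rfl
      | succ t ih => rw [← hc, ih]
      | pred t ih => rw [hc, sub_add_cancel, ih]
    have h3 : ∀ t : ℤ, (h * X.g ^ t ∈ Hf s ↔ h * X.p 0 ∈ Hf s) := fun t => by rw [X.gpow]; exact h2 _
    have h4 : ∀ N : ℕ, (h * X.g ^ N ∈ Hf s ↔ h * X.p 0 ∈ Hf s) := fun N => by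
      have := h3 N; rwa [zpow_natCast] at this
    have h5 : ∀ N : ℕ, (h * X.g⁻¹ ^ N ∈ Hf s ↔ h * X.p 0 ∈ Hf s) := fun N => by
      have := h3 (-N); rwa [zpow_neg, zpow_natCast, ← inv_pow] at this
    rw [sep] at hs
    simp only [h4, h5, Filter.eventually_const] at hs
    tauto
  obtain ⟨j, hj⟩ := h1
  have hl := X.hl
  have hj0 : 0 ≤ j % X.l := Int.emod_nonneg _ (by omega)
  have hj1 : j % X.l < X.l := Int.emod_lt_of_pos _ (by omega)
  have hjj : j = ((j % X.l).toNat : ℤ) + (j / X.l) * X.l := by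
    rw [Int.toNat_of_nonneg hj0]; have := Int.emod_add_mul_ediv j X.l; linarith
  refine ⟨(j % X.l).toNat, by omega, ?_⟩
  generalize hii : (j % X.l).toNat = i at hjj
  generalize htt : j / X.l = t at hjj
  have hlam : X.lam j = X.lam i := by rw [hjj, X.lper']
  have hp : (X.p j)⁻¹ = (X.p i)⁻¹ * X.g ^ (-t) := by rw [hjj, X.pper, mul_inv_rev, zpow_neg]
  rw [X.ps, ← mul_assoc] at hj
  by_cases h0 : h * X.p j ∈ Hf s
  · right
    have h1 : h * X.p j * ltr (X.lam j) ∉ Hf s := by tauto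
    obtain ⟨h2, h3⟩ := edgeL (r := il (X.lam j)) h1 (by rw [ltr_il, mul_inv_cancel_right]; exact h0)
    refine ⟨by rw [← hlam, ← h3, il_il], -t, ?_⟩
    rw [mul_assoc, ← hp, ← h3, ltr_il, ← mul_inv_rev]
    rw [mul_assoc] at h2
    exact eq_inv_of_mul_eq_one_left h2
  · left
    have h1 : h * X.p j * ltr (X.lam j) ∈ Hf s := by tauto
    obtain ⟨h2, h3⟩ := edgeL h0 h1
    refine ⟨by rw [← hlam, h3], -t, ?_⟩
    rw [← hp]
    exact eq_inv_of_mul_eq_one_left h2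

structure Axis.Good (X : Axis α) [Fintype α] (M : ℕ) : Prop where
  low : ∀ A B : Finset (α × Bool), Disjoint A B → ∃ S : Finset ℤ,
    (∀ i ∈ S, 1 ≤ i ∧ i < X.l ∧ opp A B (il (X.lam (i - 1))) (X.lam i)) ∧ 4 * (A.card * B.card) ≤ S.card
  up : ∀ a : α, ((Finset.range X.l).filter fun i : ℕ => (X.lam i).1 = a).card ≤ M
  card : M < 16 * (Fintype.card α - 1)
  two : 2 ≤ Fintype.card α

lemma Axis.coverF (X : Axis α) [Fintype α] {M : ℕ} (G : X.Good M) (s : α × Bool) :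
    ∃ T : Finset (FreeGroup α), T.card ≤ M ∧ ∀ h, sep X.g (Hf s) h → ∃ c ∈ T, ∃ t : ℤ, h = c * X.g ^ t := by
  classical
  refine ⟨((Finset.range X.l).filter fun i : ℕ => (X.lam i).1 = s.1).image
    (fun i : ℕ => if X.lam i = s then (X.p i)⁻¹ else ltr s * (X.p i)⁻¹), 
    Finset.card_image_le.trans (G.up s.1), ?_⟩
  intro h hs
  obtain ⟨i, hi, ⟨h1, t, h2⟩ | ⟨h1, t, h2⟩⟩ := X.cover hs
  · exact ⟨_, Finset.mem_image_of_mem _ (Finset.mem_filter.2 ⟨Finset.mem_range.2 hi, by rw [h1]⟩), t, by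
      rw [if_pos h1]; exact h2⟩
  · refine ⟨_, Finset.mem_image_of_mem _ (Finset.mem_filter.2 ⟨Finset.mem_range.2 hi, by rw [h1]; rfl⟩), t, ?_⟩
    rw [if_neg (by rw [h1]; exact il_ne s)]; exact h2

def aeq (P Q : Set (FreeGroup α)) : Prop := (P \ Q).Finite ∧ (Q \ P).Finite

/-- pairwise inequivalent -/
def ineq (u : FreeGroup α) (T : Finset (FreeGroup α)) : Prop :=
  ∀ h ∈ T, ∀ h' ∈ T, ∀ t : ℤ, h = h' * u ^ t → h = h'

lemma aeq_one [Finite α] {P : Set (FreeGroup α)} {v : FreeGroup α} {r : α × Bool} (h1 : Pl P v r)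
    (h2 : ∀ r', r' ≠ r → Mi P v r') : aeq P (HT v r) := by
  refine ⟨?_, h1⟩
  have hf : (⋃ r' : {r' : α × Bool // r' ≠ r}, HT v r'.1 ∩ P).Finite := finite_iUnion fun r' => h2 _ r'.2
  refine (hf.union (finite_singleton v)).subset ?_
  rintro w ⟨hw, hw2⟩
  by_cases hv : w = v
  · exact Or.inr hv
  · obtain ⟨s, hs⟩ := HT_cover v w hv
    left
    refine mem_iUnion.2 ⟨⟨s, ?_⟩, hs, hw⟩
    rintro rfl
    exact hw2 hs

lemma aeq_compl {P Q : Set (FreeGroup α)} (h : aeq Pᶜ Q) : aeq P Qᶜ := by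
  refine ⟨h.2.subset ?_, h.1.subset ?_⟩
  · rintro w ⟨h1, h2⟩; exact ⟨by simpa using h2, by simpa using h1⟩
  · rintro w ⟨h1, h2⟩; exact ⟨h2, h1⟩

lemma lowS (X : Axis α) [Fintype α] {M : ℕ} (G : X.Good M) {P : Set (FreeGroup α)} {v : FreeGroup α}
    {Y : Set (α × Bool)} (hY : GoodV P v Y) : ∃ A B : Finset (α × Bool), Disjoint A B ∧ 1 ≤ A.card ∧
     1 ≤ B.card ∧ (∀ r ∈ A, Pl P v r) ∧ (∀ r ∈ B, Mi P v r) ∧ (∀ r, r ∉ Y ↔ (r ∈ A ∨ r ∈ B)) ∧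
     ∃ S : Finset ℤ, 4 * (A.card * B.card) ≤ S.card ∧ (∀ i ∈ S, 1 ≤ i ∧ i < X.l ∧ X.lam i ∉ Y ∧
      il (X.lam (i - 1)) ∉ Y ∧
      sep X.g P (v * (X.p i)⁻¹)) := by
  classical
  obtain ⟨h1, ⟨ra, ha, ha'⟩, ⟨rb, hb, hb'⟩⟩ := hY
  have hd : Disjoint (Finset.univ.filter fun r => r ∉ Y ∧ Pl P v r) (Finset.univ.filter fun r => r ∉ Y ∧ Mi P v r) := by
    rw [Finset.disjoint_left]
    intro r hr hr'
    simp only [Finset.mem_filter, Finset.mem_univ, true_and] at hr hr'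
    exact not_Pl_Mi hr.2 hr'.2
  obtain ⟨S, hS, hc⟩ := G.low _ _ hd
  refine ⟨_, _, hd, Finset.card_pos.2 ⟨ra, by simp [ha, ha']⟩, Finset.card_pos.2 ⟨rb, by simp [hb, hb']⟩, 
    by simp, by simp, ?_, S, hc, ?_⟩
  · intro r
    have := h1 r
    simp only [Finset.mem_filter, Finset.mem_univ, true_and]
    tauto
  · intro i hi
    obtain ⟨h2, h3, h4⟩ := hS i hi
    refine ⟨h2, h3, ?_, ?_, X.sep_of (by simp) (by simp) h4⟩
    · simp only [opp, Finset.mem_filter, Finset.mem_univ, true_and] at h4; tauto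
    · simp only [opp, Finset.mem_filter, Finset.mem_univ, true_and] at h4; tauto

lemma lowT (X : Axis α) {v : FreeGroup α} {S : Finset ℤ} (hS : ∀ i ∈ S, 1 ≤ i ∧ i < X.l) :
    ineq X.g (S.image fun i => v * (X.p i)⁻¹) ∧ (S.image fun i => v * (X.p i)⁻¹).card = S.card := by
  refine ⟨?_, Finset.card_image_of_injOn ?_⟩
  · intro h hh h' hh' t ht
    obtain ⟨i, hi, rfl⟩ := Finset.mem_image.1 hh
    obtain ⟨j, hj, rfl⟩ := Finset.mem_image.1 hh'
    have h1 := hS i hi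
    have h2 := hS j hj
    rw [X.coset (by omega) h1.2 (by omega) h2.2 ht]
  · intro i hi j hj hij
    have h1 := hS i hi
    have h2 := hS j hj
    exact X.coset (v := v) (t := 0) (by omega) h1.2 (by omega) h2.2 (by simpa using hij)

lemma lower (X : Axis α) [Fintype α] {M : ℕ} (G : X.Good M) {P : Set (FreeGroup α)} (hP : AI P)
    (i1 : P.Infinite) (i2 : Pᶜ.Infinite) : (∃ v r, aeq P (HT v r)) ∨
    ∃ T : Finset (FreeGroup α), M < T.card ∧ ineq X.g T ∧ ∀ h ∈ T, sep X.g P h := by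
  classical
  have hM := G.card
  have h2 := G.two
  rcases dich hP i1 i2 with ⟨v, hv⟩ | ⟨v, β, v', β', hv, hv', hsub⟩
  · obtain ⟨A, B, hd, hA1, hB1, hA, hB, hAB, S, hS, hS'⟩ := lowS X G hv
    have hun : A ∪ B = Finset.univ := by
      ext r; have := hAB r; simp at this; simpa using this
    have hc : A.card + B.card = 2 * Fintype.card α := by
      rw [← Finset.card_union_of_disjoint hd, hun, Finset.card_univ, Fintype.card_prod, Fintype.card_bool, mul_comm]
    by_cases ha : A.card = 1
    · left
      obtain ⟨r, rfl⟩ := Finset.card_eq_one.1 ha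
      refine ⟨v, r, aeq_one (hA r (by simp)) ?_⟩
      intro r' hr'
      have := (hAB r').1 (by simp)
      simp only [Finset.mem_singleton, hr', false_or] at this
      exact hB _ this
    by_cases hb : B.card = 1
    · left
      obtain ⟨r, rfl⟩ := Finset.card_eq_one.1 hb
      refine ⟨v * ltr r, il r, ?_⟩
      rw [← HT_compl]
      apply aeq_compl
      refine aeq_one ?_ ?_
      · exact (hB r (by simp)).subset (by rintro w ⟨h1, h2⟩; exact ⟨h1, by simpa using h2⟩)
      · intro r' hr'
        have := (hAB r').1 (by simp)
        simp only [Finset.mem_singleton, hr', or_false] at this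
        exact (hA _ this).subset (by rintro w ⟨h1, h2⟩; exact ⟨h1, h2⟩)
    right
    obtain ⟨hT1, hT2⟩ := lowT X (v := v) (S := S) (fun i hi => ⟨(hS' i hi).1, (hS' i hi).2.1⟩)
    refine ⟨_, ?_, hT1, ?_⟩
    · rw [hT2]
      have h3 : 2 ≤ A.card := by omega
      have h4 : 2 ≤ B.card := by omega
      obtain ⟨a, ha⟩ := Nat.exists_eq_add_of_le h3
      obtain ⟨b, hb⟩ := Nat.exists_eq_add_of_le h4
      rw [ha, hb] at hS
      have : (2 + a) * (2 + b) = 4 + 2 * a + 2 * b + a * b := by ring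
      omega
    · intro h hh
      obtain ⟨i, hi, rfl⟩ := Finset.mem_image.1 hh
      exact (hS' i hi).2.2.2.2
  · right
    have key : ∀ {v β}, GoodV P v {β} → ∃ S : Finset ℤ, 8 * (Fintype.card α - 1) ≤ S.card ∧
       (∀ i ∈ S, 1 ≤ i ∧ i < X.l ∧ X.lam i ∉ ({β} : Set (α × Bool)) ∧
      il (X.lam (i - 1)) ∉ ({β} : Set (α × Bool)) ∧  sep X.g P (v * (X.p i)⁻¹)) := by
      intro v β hv
      obtain ⟨A, B, hd, hA1, hB1, hA, hB, hAB, S, hS, hS'⟩ := lowS X G hv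
      refine ⟨S, ?_, hS'⟩
      have hun : A ∪ B = Finset.univ.erase β := by
        ext r; have := hAB r; simp at this; simpa using this.symm
      have hc : A.card + B.card = 2 * Fintype.card α - 1 := by
        rw [← Finset.card_union_of_disjoint hd, hun, Finset.card_erase_of_mem (Finset.mem_univ _), Finset.card_univ, Fintype.card_prod, Fintype.card_bool, mul_comm]
      obtain ⟨a, ha⟩ := Nat.exists_eq_add_of_le hA1
      obtain ⟨b, hb⟩ := Nat.exists_eq_add_of_le hB1
      rw [ha, hb] at hS
      have : (1 + a) * (1 + b) = 1 + a + b + a * b := by ring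
      omega
    obtain ⟨S, hS, hS'⟩ := key hv
    obtain ⟨S1, hS1, hS1'⟩ := key hv'
    obtain ⟨hT1, hT2⟩ := lowT X (v := v) (S := S) (fun i hi => ⟨(hS' i hi).1, (hS' i hi).2.1⟩)
    obtain ⟨hU1, hU2⟩ := lowT X (v := v') (S := S1) (fun i hi => ⟨(hS1' i hi).1, (hS1' i hi).2.1⟩)
    have hx : ∀ i ∈ S, ∀ j ∈ S1, ∀ t : ℤ, v * (X.p i)⁻¹ ≠ v' * (X.p j)⁻¹ * X.g ^ t := by
      intro i hi j hj t ht
      have e1 := X.ev_pos v i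
      obtain ⟨N, hN⟩ := Filter.eventually_atTop.1 (X.ev_pos v i)
      obtain ⟨N', hN'⟩ := Filter.eventually_atTop.1 (X.ev_pos v' j)
      have h3 := hN (N + N' + t.natAbs) (by omega)
      have h4 := hN' (N + N' + t.natAbs + t).toNat (by omega)
      have h5 : v' * (X.p j)⁻¹ * X.g ^ (N + N' + t.natAbs + t).toNat = v * (X.p i)⁻¹ * X.g ^ (N + N' + t.natAbs) := by
        rw [ht, ← zpow_natCast, ← zpow_natCast, mul_assoc _ (X.g ^ t), ← zpow_add]
        congr 2
        have := neg_abs_le t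
        push_cast
        rw [Int.toNat_of_nonneg (by omega)]
        ring
      rw [h5] at h4
      exact HT_disj (fun h => (hS1' j hj).2.2.1 h) (hsub _ (fun h => (hS' i hi).2.2.1 h) h3) h4
    refine ⟨(S.image fun i => v * (X.p i)⁻¹) ∪ (S1.image fun i => v' * (X.p i)⁻¹), ?_, ?_, ?_⟩
    · rw [Finset.card_union_of_disjoint, hT2, hU2]
      · omega
      · rw [Finset.disjoint_left]
        intro h hh hh'
        obtain ⟨i, hi, rfl⟩ := Finset.mem_image.1 hh
        obtain ⟨j, hj, hij⟩ := Finset.mem_image.1 hh'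
        exact hx i hi j hj 0 (by simpa using hij.symm)
    · intro h hh h' hh' t ht
      rcases Finset.mem_union.1 hh with h1 | h1 <;> rcases Finset.mem_union.1 hh' with h2 | h2
      · exact hT1 _ h1 _ h2 t ht
      · obtain ⟨i, hi, rfl⟩ := Finset.mem_image.1 h1
        obtain ⟨j, hj, rfl⟩ := Finset.mem_image.1 h2
        exact absurd ht (hx i hi j hj t)
      · obtain ⟨i, hi, rfl⟩ := Finset.mem_image.1 h2
        obtain ⟨j, hj, rfl⟩ := Finset.mem_image.1 h1
        refine absurd ?_ (hx i hi j hj (-t))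
        rw [ht, mul_assoc _ (X.g ^ t), ← zpow_add]; simp
      · exact hU1 _ h1 _ h2 t ht
    · intro h hh
      rcases Finset.mem_union.1 hh with h1 | h1
      · obtain ⟨i, hi, rfl⟩ := Finset.mem_image.1 h1
        exact (hS' i hi).2.2.2.2
      · obtain ⟨i, hi, rfl⟩ := Finset.mem_image.1 h1
        exact (hS1' i hi).2.2.2.2

end AxisS

section CountS
variable {α : Type} [DecidableEq α]

lemma sep_inv {u : FreeGroup α} {P : Set (FreeGroup α)} {h : FreeGroup α} (hs : sep u P h) : sep u⁻¹ P h := by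
  rw [sep] at *
  rw [inv_inv]
  tauto

lemma sep_pow {u : FreeGroup α} {P : Set (FreeGroup α)} {h : FreeGroup α} {k : ℕ} (hk : 0 < k) (hs : sep u P h) :
    sep (u ^ k) P h := by
  have ht : Filter.Tendsto (fun N : ℕ => k * N) Filter.atTop Filter.atTop :=
    Filter.tendsto_id.const_mul_atTop' hk
  have e : ∀ N : ℕ, (u ^ k) ^ N = u ^ (k * N) := fun N => (pow_mul _ _ _).symm
  have e' : ∀ N : ℕ, (u ^ k)⁻¹ ^ N = u⁻¹ ^ (k * N) := fun N => by rw [← inv_pow, pow_mul]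
  rw [sep] at *
  simp only [e, e']
  rcases hs with ⟨h1, h2⟩ | ⟨h1, h2⟩
  · exact Or.inl ⟨ht.eventually h1, ht.eventually h2⟩
  · exact Or.inr ⟨ht.eventually h1, ht.eventually h2⟩

lemma sep_of_pow {u : FreeGroup α} (hu : u ≠ 1) {P : Set (FreeGroup α)} (hP : AI P) {h : FreeGroup α} {k : ℕ}
    (hk : 0 < k) (hs : sep (u ^ k) P h) : sep u P h := by
  have ht : Filter.Tendsto (fun N : ℕ => k * N) Filter.atTop Filter.atTop :=
    Filter.tendsto_id.const_mul_atTop' hk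
  have e : ∀ N : ℕ, (u ^ k) ^ N = u ^ (k * N) := fun N => (pow_mul _ _ _).symm
  have e' : ∀ N : ℕ, (u ^ k)⁻¹ ^ N = u⁻¹ ^ (k * N) := fun N => by rw [← inv_pow, pow_mul]
  have key : ∀ {w : FreeGroup α} {Q : Set (FreeGroup α)}, AI Q → w ≠ 1 → (∀ᶠ N : ℕ in Filter.atTop, h * w ^ (k * N) ∈ Q) →
     ∀ᶠ N : ℕ in Filter.atTop, h * w ^ N ∈ Q := by
    intro w Q hQ hw h1
    rcases hQ.ends hw h with h2 | h2
    · exact h2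
    · exact (ev_not h1 (ht.eventually h2)).elim
  have hu' := inv_ne_one.2 hu
  rw [sep] at *
  simp only [e, e'] at hs
  rcases hs with ⟨h1, h2⟩ | ⟨h1, h2⟩
  · exact Or.inl ⟨key hP hu h1, key hP.compl hu' h2⟩
  · exact Or.inr ⟨key hP.compl hu h1, key hP hu' h2⟩

lemma sep_mul {u : FreeGroup α} {P : Set (FreeGroup α)} {h : FreeGroup α} (hs : sep u P h) (j : ℕ) :
    sep u P (h * u ^ j) := by
  have t1 : Filter.Tendsto (fun N : ℕ => j + N) Filter.atTop Filter.atTop :=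
    Filter.tendsto_atTop_mono (fun N => Nat.le_add_left N j) Filter.tendsto_id
  have key : ∀ {Q : Set (FreeGroup α)}, (∀ᶠ N : ℕ in Filter.atTop, h * u ^ N ∈ Q) → 
     ∀ᶠ N : ℕ in Filter.atTop, h * u ^ j * u ^ N ∈ Q := by
    intro Q h1
    filter_upwards [t1.eventually h1] with N hN
    rwa [mul_assoc, ← pow_add]
  have key' : ∀ {Q : Set (FreeGroup α)}, (∀ᶠ N : ℕ in Filter.atTop, h * u⁻¹ ^ N ∈ Q) → 
     ∀ᶠ N : ℕ in Filter.atTop, h * u ^ j * u⁻¹ ^ N ∈ Q := by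
    intro Q h1
    obtain ⟨B, hB⟩ := Filter.eventually_atTop.1 h1
    filter_upwards [Filter.eventually_ge_atTop (B + j)] with N hN
    obtain ⟨m, rfl⟩ := Nat.exists_eq_add_of_le' (show j ≤ N by omega)
    have := hB m (by omega)
    rw [pow_add, mul_assoc, ← pow_mul_comm, ← mul_assoc (u ^ j), inv_pow u j, mul_inv_cancel, one_mul]
    exact this
  rcases hs with ⟨h1, h2⟩ | ⟨h1, h2⟩
  · exact Or.inl ⟨key h1, key' (Q := Pᶜ) h2⟩
  · exact Or.inr ⟨key (Q := Pᶜ) h1, key' h2⟩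

lemma sep_map {u : FreeGroup α} {P : Set (FreeGroup α)} {h : FreeGroup α} (ψ : MulAut (FreeGroup α))
    (hs : sep (ψ u) {w | ψ⁻¹ w ∈ P} h) : sep u P (ψ⁻¹ h) := by
  rw [sep] at *
  simpa only [mem_ofPred_eq, map_mul, map_pow, map_inv, MulAut.inv_apply_self] using hs

lemma count (X : Axis α) [Fintype α] {M : ℕ} (G : X.Good M) (ψ : MulAut (FreeGroup α)) (s : α × Bool) {a : ℕ} {b : ℤ}
    (ha : 0 < a) (hab : a ≤ b.natAbs) (h : (ψ X.g) ^ a = X.g ^ b) (T : Finset (FreeGroup α))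
    (hT : ineq X.g T) (hs : ∀ x ∈ T, sep X.g {w | ψ⁻¹ w ∈ Hf s} x) : T.card ≤ M := by
  classical
  have hg := X.g_ne
  have hP : AI {w | ψ⁻¹ w ∈ Hf s} := by
    have := (AI_HT 1 s).affine 1 ψ⁻¹
    simpa [HT_one] using this
  obtain ⟨U, hU, hU'⟩ := X.coverF G s
  have h1 : ∀ x, sep X.g {w | ψ⁻¹ w ∈ Hf s} x → ∃ c ∈ U, ∃ e : ℤ, x = ψ c * (ψ X.g) ^ e := by
    intro x hx
    have hγ : ψ X.g ≠ 1 := by simpa using hg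
    have h2 : sep (X.g ^ b) {w | ψ⁻¹ w ∈ Hf s} x := by
      have := sep_pow (k := b.natAbs) (by omega) hx
      obtain ⟨k, rfl | rfl⟩ := b.eq_nat_or_neg
      · simpa using this
      · rw [zpow_neg]; simpa using sep_inv this
    rw [← h] at h2
    have h3 := sep_map ψ (sep_of_pow hγ hP ha h2)
    obtain ⟨c, hc, t, ht⟩ := hU' _ h3
    refine ⟨c, hc, t, ?_⟩
    rw [← map_zpow, ← map_mul, ← ht, MulAut.apply_inv_self]
  have h2 : ∀ y : FreeGroup α × ℕ, y ∈ T ×ˢ Finset.range b.natAbs → ∃ c ∈ U, ∃ e : ℤ, y.1 * X.g ^ y.2 = ψ c * (ψ X.g) ^ e := by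
    intro y hy
    exact h1 _ (sep_mul (hs _ (Finset.mem_product.1 hy).1) _)
  choose! c hc e he using h2
  have h3 : (T ×ˢ Finset.range b.natAbs).card ≤ (U ×ˢ (Finset.range a)).card := by
    refine Finset.card_le_card_of_injOn (fun y => (c y, (e y % a).toNat)) ?_ ?_
    · intro y hy
      have h4 : 0 ≤ e y % a := Int.emod_nonneg _ (by omega)
      have h5 : e y % a < a := Int.emod_lt_of_pos _ (by omega)
      exact Finset.mem_coe.2 (Finset.mem_product.2 ⟨hc y hy, Finset.mem_range.2 (by simp only; omega)⟩)
    · rintro ⟨x, i⟩ hy ⟨x', i'⟩ hy' hyy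
      simp only [Prod.mk.injEq] at hyy
      have h4 := he _ hy
      have h5 := he _ hy'
      have hy1 := Finset.mem_product.1 hy
      have hy1' := Finset.mem_product.1 hy'
      simp only at h4 h5 hy1 hy1'
      have h6 : e (x, i) % a = e (x', i') % a := by
        have h4 : 0 ≤ e (x, i) % a := Int.emod_nonneg _ (by omega)
        have h5 : 0 ≤ e (x', i') % a := Int.emod_nonneg _ (by omega)
        omega
      obtain ⟨t, ht⟩ := (Int.emod_eq_emod_iff_emod_sub_eq_zero.1 h6) |> Int.dvd_of_emod_eq_zero
      have h7 : x * X.g ^ i = x' * X.g ^ i' * X.g ^ (b * t) := by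
        rw [zpow_mul, ← h, h5, h4, ← zpow_natCast, ← zpow_mul, mul_assoc, ← zpow_add, hyy.1]
        congr 2; omega
      have h8 : x = x' * X.g ^ ((i':ℤ) + b * t - i) := by
        rw [zpow_sub, zpow_add, zpow_natCast, zpow_natCast, ← mul_assoc, ← mul_assoc, ← h7, mul_inv_cancel_right]
      have h9 := hT x hy1.1 x' hy1'.1 _ h8
      subst h9
      have h10 : X.g ^ ((i':ℤ) + b * t - i) = X.g ^ (0:ℤ) := by
        rw [zpow_zero]; exact (mul_eq_left.1 h8.symm)
      have h11 := X.g_pow_inj h10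
      have h12 := Finset.mem_range.1 hy1.2
      have h13 := Finset.mem_range.1 hy1'.2
      have h14 : b ∣ (i:ℤ) - i' := ⟨t, by omega⟩
      have h15 : (i:ℤ) - i' = 0 := Int.eq_zero_of_abs_lt_dvd (Int.natAbs_dvd.2 h14) (by
        rw [abs_lt]; constructor <;> omega)
      have : i = i' := by omega
      rw [this]
  rw [Finset.card_product, Finset.card_product, Finset.card_range, Finset.card_range] at h3
  have h4 : T.card * a ≤ M * a := (Nat.mul_le_mul_left _ hab).trans (h3.trans (Nat.mul_le_mul_right _ hU))
  exact Nat.le_of_mul_le_mul_right h4 ha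

/-- automorphisms sending a power of g to a power of g are rigid -/
lemma rigid0 (X : Axis α) [Fintype α] {M : ℕ} (G : X.Good M) (ψ : MulAut (FreeGroup α)) {a : ℕ} {b : ℤ}
    (ha : 0 < a) (hab : a ≤ b.natAbs) (h : (ψ X.g) ^ a = X.g ^ b) (s : α × Bool) :
    ∃ v r, aeq {w | ψ⁻¹ w ∈ Hf s} (HT v r) := by
  have hP : AI {w | ψ⁻¹ w ∈ Hf s} := by
    have := (AI_HT 1 s).affine 1 ψ⁻¹
    simpa [HT_one] using this
  have hinf : ∀ v r, {w | ψ⁻¹ w ∈ HT v r}.Infinite := by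
    intro v r
    exact (HT_inf v r).preimage (f := ⇑(ψ⁻¹)) (by
      intro x _; exact (ψ⁻¹).surjective x)
  rcases lower X G hP (by have := hinf 1 s; rwa [HT_one] at this) (by
    have := hinf (ltr s) (il s)
    rw [← one_mul (ltr s), ← HT_compl, HT_one] at this
    exact this) with h1 | ⟨T, h1, h2, h3⟩
  · exact h1
  · have := count X G ψ s ha hab h T h2 h3
    omega
end CountS

section RigidS
variable {α : Type} [DecidableEq α] [Fintype α]

lemma four (h2 : 2 ≤ Fintype.card α) (a b : α × Bool) : ∃ r : α × Bool, r ≠ a ∧ r ≠ b := by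
  have : ({a, b} : Finset (α × Bool)) ≠ Finset.univ := by
    intro h
    have h3 := congrArg Finset.card h
    have h4 : ({a, b} : Finset (α × Bool)).card ≤ 2 := Finset.card_le_two
    rw [Finset.card_univ, Fintype.card_prod, Fintype.card_bool] at h3
    omega
  by_contra hc
  push Not at hc
  apply this
  ext r
  have := hc r
  simp only [Finset.mem_insert, Finset.mem_singleton, Finset.mem_univ, iff_true]
  tauto

lemma HT_dir {v w : FreeGroup α} {s : α × Bool} (hw : w ∈ HT v s) :
    ∃ r0, ∀ r, r ≠ r0 → HT w r ⊆ HT v s := by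
  have hne : v ≠ w := by rintro rfl; exact HT_base _ _ hw
  obtain ⟨r0, h0⟩ := HT_cover w v hne
  refine ⟨r0, fun r hr => ?_⟩
  have hv : v ∉ HT w r := HT_disj hr h0
  intro x hx
  by_contra hxs
  rcases HT_nest w v r s with h | h | h | h
  · exact hxs (h hx)
  · exact HT_base _ _ (h hw)
  · by_cases h3 : w * ltr r ∈ HT v s
    · exact h _ ⟨HT_tip w r, h3⟩
    · obtain ⟨h4, -⟩ := edgeHT (r := il r) h3 (by rw [ltr_il, mul_inv_cancel_right]; exact hw)
      rw [← h4] at hv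
      exact hv (HT_tip _ _)
  · exact (h v).elim hv (HT_base v s)

lemma HT_dis (h2 : 2 ≤ Fintype.card α) {v v' : FreeGroup α} {s s' : α × Bool} (h : (HT v s ∩ HT v' s').Finite)
    {w : FreeGroup α} (h1 : w ∈ HT v s) (h1' : w ∈ HT v' s') : False := by
  obtain ⟨r0, h3⟩ := HT_dir h1
  obtain ⟨r1, h4⟩ := HT_dir h1'
  obtain ⟨r, h5, h6⟩ := four h2 r0 r1
  exact HT_inf w r (h.subset fun x hx => ⟨(h3 r h5) hx, (h4 r h6) hx⟩)

lemma HT_aeq (h2 : 2 ≤ Fintype.card α) {v v' : FreeGroup α} {s s' : α × Bool} (h : aeq (HT v s) (HT v' s')) :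
    v = v' ∧ s = s' := by
  have key : ∀ {v v' : FreeGroup α} {s s' : α × Bool}, (HT v s \ HT v' s').Finite → HT v s ⊆ HT v' s' := by
    intro v v' s s' h w hw
    by_contra h3
    rw [sdiff_eq, HT_compl] at h
    exact HT_dis h2 h hw (by rw [← HT_compl]; exact h3)
  exact HT_inj ((key h.1).antisymm (key h.2))

lemma grow {x : FreeGroup α} {r : α × Bool} (h : x⁻¹ ∉ Hf r) : x.norm < (x * ltr r).norm := by
  rw [← FreeGroup.norm_inv_eq (x := x * ltr r), ← FreeGroup.norm_inv_eq (x := x), mul_inv_rev, ← ltr_il]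
  rw [FreeGroup.norm, FreeGroup.norm, ltr_mul_word (by rwa [il_il])]
  simp

lemma rigid1 (h2 : 2 ≤ Fintype.card α) (v : α × Bool → FreeGroup α) (r : α × Bool → α × Bool)
    (hd : ∀ s s', s ≠ s' → (HT (v s) (r s) ∩ HT (v s') (r s')).Finite)
    (hc : {w | ∀ s, w ∉ HT (v s) (r s)}.Finite) : ∃ x, ∀ s, v s = x := by
  classical
  have hd' : ∀ s s' w, s ≠ s' → w ∈ HT (v s) (r s) → w ∈ HT (v s') (r s') → False :=
    fun s s' w h h3 h4 => HT_dis h2 (hd s s' h) h3 h4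
  have hvX : ∀ s s', v s ∉ HT (v s') (r s') := by
    intro s s' h
    have hne : s ≠ s' := by rintro rfl; exact HT_base _ _ h
    obtain ⟨h3, h4⟩ := edgeHT (w := v s * ltr (r s)) (v := v s') (s := r s') (r := il (r s))
      (fun h3 => hd' s s' _ hne (HT_tip _ _) h3) (by rw [ltr_il, mul_inv_cancel_right]; exact h)
    have h5 : HT (v s') (r s') = (HT (v s) (r s))ᶜ := by rw [HT_compl, h3, h4]
    obtain ⟨s3, h6, h7⟩ := four h2 s s'
    have h8 := HT_tip (v s3) (r s3)
    by_cases h9 : v s3 * ltr (r s3) ∈ HT (v s) (r s)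
    · exact hd' _ _ _ h6 h8 h9
    · exact hd' _ _ _ h7 h8 (by rw [h5]; exact h9)
  have hne : Nonempty (α × Bool) := by
    rw [← Fintype.card_pos_iff, Fintype.card_prod, Fintype.card_bool]; omega
  obtain ⟨s0⟩ := hne
  obtain ⟨x, hxX, hmax⟩ := Set.exists_max_image _ FreeGroup.norm hc ⟨v s0, fun s => hvX s0 s⟩
  have hdir : ∀ q, x⁻¹ ∉ Hf q → ∃ s, v s = x ∧ r s = q := by
    intro q hq
    have h3 := grow hq
    have h4 : x * ltr q ∉ {w | ∀ s, w ∉ HT (v s) (r s)} := fun h => by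
      have := hmax _ h; omega
    simp only [mem_ofPred_eq, not_forall, not_not] at h4
    obtain ⟨s, hs⟩ := h4
    obtain ⟨h5, h6⟩ := edgeHT (hxX s) hs
    exact ⟨s, h5.symm, h6.symm⟩
  obtain ⟨r0, hr0⟩ : ∃ r0, ∀ q, q ≠ r0 → x⁻¹ ∉ Hf q := by
    by_cases h : ∃ q, x⁻¹ ∈ Hf q
    · obtain ⟨q, hq⟩ := h
      exact ⟨q, fun q' h h' => h (Hf_unique h' hq)⟩
    · push Not at h
      exact ⟨s0, fun q _ => h q⟩
  have hdir' : ∀ q, q ≠ r0 → ∃ s, v s = x ∧ r s = q := fun q hq => hdir q (hr0 q hq)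
  have hcard : 2 * Fintype.card α - 1 ≤ (Finset.univ.filter fun s => v s = x).card := by
    have h3 : Finset.univ.erase r0 ⊆ (Finset.univ.filter fun s => v s = x).image r := by
      intro q hq
      obtain ⟨s, h4, h5⟩ := hdir' q (Finset.ne_of_mem_erase hq)
      exact Finset.mem_image.2 ⟨s, by simp [h4], h5⟩
    have h4 := (Finset.card_le_card h3).trans Finset.card_image_le
    rwa [Finset.card_erase_of_mem (Finset.mem_univ _), Finset.card_univ, Fintype.card_prod, Fintype.card_bool, mul_comm] at h4
  refine ⟨x, fun s => ?_⟩
  by_contra hs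
  have huniq : ∀ s', v s' ≠ x → s' = s := by
    intro s' hs'
    by_contra hne
    have h3 : (Finset.univ.filter fun s => v s = x) ⊆ (Finset.univ.erase s).erase s' := by
      intro q hq
      simp only [Finset.mem_filter, Finset.mem_univ, true_and] at hq
      simp only [Finset.mem_erase, Finset.mem_univ, and_true]
      exact ⟨by rintro rfl; exact hs' hq, by rintro rfl; exact hs hq⟩
    have h4 := Finset.card_le_card h3
    rw [Finset.card_erase_of_mem (by simp [hne]), Finset.card_erase_of_mem (Finset.mem_univ _), Finset.card_univ, Fintype.card_prod, Fintype.card_bool] at h4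
    omega
  have hsub : HT (v s) (r s) ⊆ HT x r0 := by
    intro w hw
    have hwx : w ≠ x := by rintro rfl; exact hxX s hw
    obtain ⟨q, hq⟩ := HT_cover x w hwx
    by_cases h : q = r0
    · rwa [← h]
    · obtain ⟨s', h4, h5⟩ := hdir' q h
      refine (hd' s s' w ?_ hw (by rwa [h4, h5])).elim
      rintro rfl; exact hs h4
  by_cases hr : ∃ s', v s' = x ∧ r s' = r0
  · obtain ⟨s', h3, h4⟩ := hr
    exact hd' s s' _ (by rintro rfl; exact hs h3) (HT_tip _ _) (by rw [h3, h4]; exact hsub (HT_tip _ _))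
  · push Not at hr
    refine hs (HT_aeq h2 (s := r s) (s' := r0) ⟨?_, ?_⟩).1
    · rw [sdiff_eq_empty.2 hsub]; exact finite_empty
    · refine hc.subset ?_
      rintro w ⟨h3, h4⟩ s'
      by_cases h5 : v s' = x
      · rw [h5]
        exact HT_disj (fun h => hr s' h5 h) h3
      · rw [huniq s' h5]; exact h4

lemma mulaut_ext {τ τ' : MulAut (FreeGroup α)} (h : ∀ a, τ (ltr (a, true)) = τ' (ltr (a, true))) : τ = τ' := by
  have : τ.toMonoidHom = τ'.toMonoidHom := FreeGroup.ext_hom _ _ (fun a => h a)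
  ext w
  exact DFunLike.congr_fun this w

lemma rigid2 (h2 : 2 ≤ Fintype.card α) (ψ : MulAut (FreeGroup α))
    (h : ∀ s : α × Bool, ∃ v r, aeq {w | ψ⁻¹ w ∈ Hf s} (HT v r)) :
    ∃ k, 0 < k ∧ ψ ^ k ∈ (MulAut.conj : FreeGroup α →* MulAut (FreeGroup α)).range := by
  choose v r hvr using h
  have hd : ∀ s s', s ≠ s' → (HT (v s) (r s) ∩ HT (v s') (r s')).Finite := by
    intro s s' hne
    refine ((hvr s).2.union (hvr s').2).subset ?_
    rintro w ⟨h3, h4⟩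
    by_cases h5 : ψ⁻¹ w ∈ Hf s
    · exact Or.inr ⟨h4, fun h6 => hne (Hf_unique h5 h6)⟩
    · exact Or.inl ⟨h3, h5⟩
  have hc : {w | ∀ s, w ∉ HT (v s) (r s)}.Finite := by
    have : (⋃ s, {w | ψ⁻¹ w ∈ Hf s} \ HT (v s) (r s)).Finite := finite_iUnion fun s => (hvr s).1
    refine (this.union (finite_singleton 1)).subset ?_
    intro w hw
    by_cases h1 : w = 1
    · exact Or.inr h1
    · left
      obtain ⟨s, hs⟩ := HT_cover 1 (ψ⁻¹ w) (by simpa using h1)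
      rw [HT_one] at hs
      exact mem_iUnion.2 ⟨s, hs, hw s⟩
  obtain ⟨x, hx⟩ := rigid1 h2 v r hd hc
  simp only [hx] at hvr hd
  have hinj : Function.Injective r := by
    intro s s' hss
    by_contra hne
    have := hd s s' hne
    rw [hss, inter_self] at this
    exact HT_inf _ _ this
  have hψ : ∀ s, ψ (ltr s) = x * ltr (r s) * x⁻¹ := by
    intro s
    have e1 : aeq {w | ψ⁻¹ w ∈ Hf (il s)} (HT ((ψ (ltr s))⁻¹ * (x * ltr (r s))) (il (r s))) := by
      have e2 : {w | ψ⁻¹ w ∈ Hf (il s)} = {w | ψ (ltr s) * w ∈ ({w | ψ⁻¹ w ∈ Hf s})ᶜ} := by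
        ext w
        simp only [mem_ofPred_eq, mem_compl_iff, map_mul, MulAut.inv_apply_self, mul_mem_Hf, not_not]
      have e3 : HT ((ψ (ltr s))⁻¹ * (x * ltr (r s))) (il (r s)) = {w | ψ (ltr s) * w ∈ (HT x (r s))ᶜ} := by
        ext w
        rw [HT_mul, HT_compl, inv_inv]; rfl
      rw [e2, e3]
      refine ⟨?_, ?_⟩
      · refine ((hvr s).2.preimage (f := fun w => ψ (ltr s) * w) (fun a _ b _ hab => mul_left_cancel hab)).subset ?_
        rintro w ⟨h3, h4⟩
        simp only [mem_ofPred_eq, mem_compl_iff, not_not] at h3 h4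
        exact ⟨h4, h3⟩
      · refine ((hvr s).1.preimage (f := fun w => ψ (ltr s) * w) (fun a _ b _ hab => mul_left_cancel hab)).subset ?_
        rintro w ⟨h3, h4⟩
        simp only [mem_ofPred_eq, mem_compl_iff, not_not] at h3 h4
        exact ⟨h4, h3⟩
    have e4 : aeq (HT ((ψ (ltr s))⁻¹ * (x * ltr (r s))) (il (r s))) (HT x (r (il s))) := by
      have e5 := hvr (il s)
      refine ⟨(e1.2.union e5.1).subset ?_, (e1.1.union e5.2).subset ?_⟩
      · rintro w ⟨h3, h4⟩
        by_cases h5 : w ∈ {w | ψ⁻¹ w ∈ Hf (il s)}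
        · exact Or.inr ⟨h5, h4⟩
        · exact Or.inl ⟨h3, h5⟩
      · rintro w ⟨h3, h4⟩
        by_cases h5 : w ∈ {w | ψ⁻¹ w ∈ Hf (il s)}
        · exact Or.inl ⟨h5, h4⟩
        · exact Or.inr ⟨h3, h5⟩
    have e6 := (HT_aeq h2 e4).1
    rw [inv_mul_eq_iff_eq_mul] at e6
    rw [e6, mul_inv_cancel_right]
  set τ : MulAut (FreeGroup α) := MulAut.conj x⁻¹ * ψ with hτ
  have hτs : ∀ s, τ (ltr s) = ltr (r s) := by
    intro s
    rw [hτ, MulAut.mul_apply, hψ, MulAut.conj_apply]; group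
  have hτk : ∀ (k : ℕ) s, (τ ^ k) (ltr s) = ltr (r^[k] s) := by
    intro k
    induction k with
    | zero => intro s; simp
    | succ k ih => intro s; rw [pow_succ, MulAut.mul_apply, hτs, ih, Function.iterate_succ_apply]
  have hconj : ∀ k : ℕ, ∃ y, ψ ^ k = MulAut.conj y * τ ^ k := by
    intro k
    induction k with
    | zero => exact ⟨1, by simp⟩
    | succ k ih =>
      obtain ⟨y, hy⟩ := ih
      refine ⟨y * (τ ^ k) x, ?_⟩
      rw [pow_succ, hy]
      have e7 : ψ = MulAut.conj x * τ := by rw [hτ, ← mul_assoc, ← map_mul]; simp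
      conv_lhs => rw [e7]
      ext w
      simp only [MulAut.mul_apply, MulAut.conj_apply, map_mul, map_inv, mul_inv_rev, pow_succ, mul_assoc]
  let σ : Equiv.Perm (α × Bool) := Equiv.ofBijective r ((Finite.injective_iff_bijective).1 hinj)
  refine ⟨orderOf σ, orderOf_pos σ, ?_⟩
  obtain ⟨y, hy⟩ := hconj (orderOf σ)
  refine ⟨y, ?_⟩
  rw [hy]
  have : τ ^ orderOf σ = 1 := by
    apply mulaut_ext
    intro a
    rw [hτk]
    have h5 := pow_orderOf_eq_one σ
    have h6 := DFunLike.congr_fun h5 (a, true)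
    rw [Equiv.Perm.coe_pow] at h6
    rw [MulAut.one_apply]
    exact congrArg ltr h6
  rw [this, mul_one]

lemma rigid (X : Axis α) {M : ℕ} (G : X.Good M) (ψ : MulAut (FreeGroup α)) {a b : ℤ}
    (ha : a ≠ 0) (hb : b ≠ 0) (h : (ψ X.g) ^ a = X.g ^ b) : 
    ∃ k, 0 < k ∧ ψ ^ k ∈ (MulAut.conj : FreeGroup α →* MulAut (FreeGroup α)).range := by
  have key : ∀ (ψ : MulAut (FreeGroup α)) (a b : ℤ), a ≠ 0 → a.natAbs ≤ b.natAbs → (ψ X.g) ^ a = X.g ^ b → 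
    ∃ k, 0 < k ∧ ψ ^ k ∈ (MulAut.conj : FreeGroup α →* MulAut (FreeGroup α)).range := by
    intro ψ a b ha hab h
    apply rigid2 G.two
    intro s
    obtain ⟨k, rfl | rfl⟩ := a.eq_nat_or_neg
    · exact rigid0 X G ψ (a := k) (b := b) (by omega) (by omega) (by rwa [zpow_natCast] at h) s
    · refine rigid0 X G ψ (a := k) (b := -b) (by omega) (by omega) ?_ s
      rw [zpow_neg, ← h, zpow_neg, inv_inv, zpow_natCast]
  rcases le_total a.natAbs b.natAbs with h1 | h1
  · exact key ψ a b ha h1 h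
  · obtain ⟨k, hk, y, hy⟩ := key ψ⁻¹ b a hb h1 (by
      have := congrArg (⇑(ψ⁻¹)) h
      rw [map_zpow, map_zpow, MulAut.inv_apply_self] at this
      exact this.symm)
    refine ⟨k, hk, y⁻¹, ?_⟩
    rw [map_inv, hy, inv_pow, inv_inv]
end RigidS

section WordS
variable {α : Type} [DecidableEq α]

def acount {β : Type} (Q : β → β → Prop) [DecidableRel Q] : List β → ℕ
  | [] => 0
  | [_] => 0
  | a :: b :: t => (if Q a b then 1 else 0) + acount Q (b :: t)

lemma acount_append {β : Type} (Q : β → β → Prop) [DecidableRel Q] (L L' : List β) :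
    acount Q L + acount Q L' ≤ acount Q (L ++ L') := by
  induction L with
  | nil => simp [acount]
  | cons a L ih =>
    cases L with
    | nil =>
      cases L' with
      | nil => simp [acount]
      | cons b t => simp [acount]
    | cons b t =>
      simp only [List.cons_append, acount] at ih ⊢
      omega

lemma acount_flatMap {β γ : Type} (Q : β → β → Prop) [DecidableRel Q] (f : γ → List β) (l : List γ) :
    (l.map fun x => acount Q (f x)).sum ≤ acount Q (l.flatMap f) := by
  induction l with
  | nil => simp
  | cons a l ih =>
    simp only [List.map_cons, List.sum_cons, List.flatMap_cons]
    have := acount_append Q (f a) (l.flatMap f)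
    omega

lemma acount_card {β : Type} (Q : β → β → Prop) [DecidableRel Q] (d : β) (L : List β) :
    acount Q L = ((Finset.range (L.length - 1)).filter fun i => Q (L.getD i d) (L.getD (i + 1) d)).card := by
  rw [Finset.card_filter]
  induction L with
  | nil => simp [acount]
  | cons a L ih =>
    cases L with
    | nil => simp [acount]
    | cons b t =>
      rw [acount, ih]
      simp only [List.length_cons, Nat.add_sub_cancel]
      rw [Finset.sum_range_succ', add_comm]
      simp

lemma countP_card {β : Type} (Q : β → Prop) [DecidablePred Q] (d : β) (L : List β) :
    ((Finset.range L.length).filter fun i => Q (L.getD i d)).card = L.countP (fun x => decide (Q x)) := by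
  rw [Finset.card_filter]
  induction L with
  | nil => simp
  | cons a L ih =>
    rw [List.length_cons, Finset.sum_range_succ', List.countP_cons]
    simp only [List.getD_cons_succ, ih, List.getD_cons_zero, decide_eq_true_eq]

def mkAxis (d : α × Bool) (L : List (α × Bool)) (hne : L ≠ [])
    (h1 : ∀ i, i + 1 < L.length → L.getD (i + 1) d ≠ il (L.getD i d))
    (h2 : L.getD 0 d ≠ il (L.getD (L.length - 1) d)) : Axis α := by
  have hl : 0 < L.length := List.length_pos_iff.2 hne
  have hl' : (0 : ℤ) < L.length := by omega
  have hstep : ∀ i : ℤ, (i % L.length + 1 < L.length ∧ (i + 1) % L.length = i % L.length + 1 ∧ (i + 1) / L.length = i / L.length)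
      ∨ (i % L.length + 1 = L.length ∧ (i + 1) % L.length = 0 ∧ (i + 1) / L.length = i / L.length + 1) := by
    intro i
    have e := Int.emod_add_mul_ediv i L.length
    have e0 := Int.emod_nonneg i hl'.ne'
    have e1 := Int.emod_lt_of_pos i hl'
    generalize i % L.length = r at *
    generalize i / L.length = q at *
    have e2 : i + 1 = (r + 1) + L.length * q := by omega
    rcases lt_or_eq_of_le (show r + 1 ≤ L.length by omega) with h | h
    · left
      refine ⟨h, ?_, ?_⟩
      · rw [e2, Int.add_mul_emod_self_left, Int.emod_eq_of_lt (by omega) h]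
      · rw [e2, Int.add_mul_ediv_left _ _ hl'.ne', Int.ediv_eq_zero_of_lt (by omega) h, zero_add]
    · right
      refine ⟨h, ?_, ?_⟩
      · rw [e2, Int.add_mul_emod_self_left, h, Int.emod_self]
      · rw [e2, Int.add_mul_ediv_left _ _ hl'.ne', h, Int.ediv_self hl'.ne', add_comm]
  have htake : ∀ k : ℕ, k < L.length → FreeGroup.mk (L.take (k + 1)) = FreeGroup.mk (L.take k) * ltr (L.getD k d) := by
    intro k hk
    rw [List.take_add_one, ← FreeGroup.mul_mk, ltr]
    congr 2
    simp [hk]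
  have e1 : (L.length : ℤ) % L.length = 0 := Int.emod_self
  have e2 : (L.length : ℤ) / L.length = 1 := Int.ediv_self hl'.ne'
  exact
  { lam := fun i => L.getD (i % L.length).toNat d
    p := fun i => FreeGroup.mk L ^ (i / L.length) * FreeGroup.mk (L.take (i % L.length).toNat)
    l := L.length
    hl := hl
    p0 := by simp [FreeGroup.one_eq_mk]
    ps := by
      intro i
      have e0 := Int.emod_nonneg i hl'.ne'
      have e1 := Int.emod_lt_of_pos i hl'
      rw [mul_assoc, ← htake _ (by omega)]
      rcases hstep i with ⟨a, b, c⟩ | ⟨a, b, c⟩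
      · rw [b, c]
        congr 3
        omega
      · rw [b, c, show (i % L.length).toNat + 1 = L.length by omega, zpow_add]
        simp [← FreeGroup.one_eq_mk]
    per := by
      intro i
      rw [Int.add_emod_right, Int.add_ediv_of_dvd_right (dvd_refl _), e1, e2]
      simp only [Int.toNat_zero, List.take_zero, zpow_one]
      rw [add_comm, zpow_add, zpow_one, ← FreeGroup.one_eq_mk, mul_one, mul_assoc]
    lper := by
      intro i
      rw [Int.add_emod_right]
    red := by
      intro i
      have e0 := Int.emod_nonneg i hl'.ne'
      rcases hstep i with ⟨a, b, c⟩ | ⟨a, b, c⟩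
      · rw [b, show (i % L.length + 1).toNat = (i % L.length).toNat + 1 by omega]
        exact h1 _ (by omega)
      · rw [b, show (i % L.length).toNat = L.length - 1 by omega]
        exact h2 }

def blk (x : α × α) : List (α × Bool) :=
  [(x.1, true), (x.2, true), (x.1, true), (x.2, true), (x.1, true)] ++
    if x.1 = x.2 then [] else [(x.1, true), (x.2, false), (x.1, true), (x.2, false), (x.1, true)]

def LL (α : Type) [DecidableEq α] [Fintype α] : List (α × Bool) := (Finset.univ : Finset (α × α)).toList.flatMap blk

def okL (L : List (α × Bool)) : Prop := L.IsChain (fun a b => b ≠ il a) ∧ (∀ a ∈ L.head?, a.2 = true) ∧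
  (∀ a ∈ L.getLast?, a.2 = true)

lemma okL_append {L L' : List (α × Bool)} (h : okL L) (h' : okL L') : okL (L ++ L') := by
  refine ⟨?_, ?_, ?_⟩
  · rw [List.isChain_append]
    refine ⟨h.1, h'.1, fun x hx y hy e => ?_⟩
    have h1 := h.2.2 x hx
    have h2 := h'.2.1 y hy
    rw [e] at h2
    simp [il, h1] at h2
  · intro a ha
    rw [List.head?_append] at ha
    rcases Option.or_eq_some_iff.1 ha with h1 | h1
    · exact h.2.1 _ h1
    · exact h'.2.1 _ h1.2
  · intro a ha
    rw [List.getLast?_append] at ha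
    rcases Option.or_eq_some_iff.1 ha with h1 | h1
    · exact h'.2.2 _ h1
    · exact h.2.2 _ h1.2

lemma okL_blk (x : α × α) : okL (blk x) := by
  unfold blk okL
  split_ifs with h
  · simp [il, h]
  · simp [il, h, Ne.symm h]

lemma okL_LL [Fintype α] : okL (LL α) := by
  unfold LL
  induction (Finset.univ : Finset (α × α)).toList with
  | nil => simp [okL]
  | cons a l ih => rw [List.flatMap_cons]; exact okL_append (okL_blk a) ih

lemma LL_ne [Fintype α] (a : α) : LL α ≠ [] := by
  intro h
  rw [LL, List.flatMap_eq_nil_iff] at h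
  have := h (a, a) (by simp)
  simp [blk] at this

lemma LL_up [Fintype α] (a : α) : (LL α).countP (fun x => decide (x.1 = a)) ≤ 10 * Fintype.card α - 5 := by
  rw [LL, List.countP_flatMap]
  rw [Finset.sum_map_toList]
  have h : ∀ x : α × α, (blk x).countP (fun x => decide (x.1 = a)) + 5 * (if x = (a, a) then 1 else 0) =
     6 * (if x.1 = a then 1 else 0) + 4 * (if x.2 = a then 1 else 0) := by
    rintro ⟨i, j⟩
    unfold blk
    by_cases h1 : i = j
    · subst h1
      by_cases h2 : i = a <;> simp [List.countP_cons, h2]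
    · by_cases h2 : i = a
      · have h3 : j ≠ a := by rintro rfl; exact h1 h2
        have h4 : ¬ a = j := fun h => h3 h.symm
        simp [List.countP_cons, h1, h2, h3, h4]
      · by_cases h3 : j = a
        · simp [List.countP_cons, h1, h2, h3]
        · simp [List.countP_cons, h1, h2, h3]
  have h1 := Finset.sum_congr (rfl : (Finset.univ : Finset (α × α)) = Finset.univ) (fun x _ => h x)
  rw [Finset.sum_add_distrib, Finset.sum_add_distrib, ← Finset.mul_sum, ← Finset.mul_sum, ← Finset.mul_sum,
    Fintype.sum_prod_type (f := fun x : α × α => if x.1 = a then 1 else 0),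
    Fintype.sum_prod_type (f := fun x : α × α => if x.2 = a then 1 else 0)] at h1
  simp only [Finset.sum_const, Finset.sum_ite_eq', Finset.mem_univ, if_true, Finset.card_univ, smul_eq_mul, mul_one, Finset.sum_ite_irrel, Finset.sum_const_zero] at h1
  have e5 : ∑ x : α, ∑ y : α, (if x = a then 1 else 0) = Fintype.card α := by
    rw [Finset.sum_comm]; simp
  rw [e5] at h1
  simp only [Function.comp_def]
  omega

lemma LL_low [Fintype α] [∀ A B : Finset (α × Bool), DecidableRel (fun s t => opp A B (il s) t)] (A B : Finset (α × Bool)) (hAB : Disjoint A B) :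
    4 * (A.card * B.card) ≤ acount (fun s t => opp A B (il s) t) (LL α) := by
  classical
  refine le_trans ?_ (acount_flatMap _ blk _)
  rw [Finset.sum_map_toList]
  set q : α × Bool → α × Bool → ℕ := fun s t => if opp A B s t then 1 else 0 with hq
  have q0 : ∀ s, q s s = 0 := by
    intro s
    rw [hq]
    apply if_neg
    rintro (⟨h1, h2⟩ | ⟨h1, h2⟩)
    · exact (Finset.disjoint_left.1 hAB h1 h2).elim
    · exact (Finset.disjoint_left.1 hAB h2 h1).elim
  have qs : ∀ s t, q s t = q t s := by
    intro s t
    rw [hq]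
    simp only [opp]
    congr 1
    apply propext
    tauto
  have h1 : ∀ x : α × α, acount (fun s t => opp A B (il s) t) (blk x) ≥
      2 * (q (x.1, false) (x.2, true) + q (x.1, true) (x.2, false) + q (x.1, false) (x.2, false) + q (x.1, true) (x.2, true)) := by
    rintro ⟨i, j⟩
    unfold blk
    have e1 := qs (j, false) (i, true)
    have e2 := qs (j, true) (i, true)
    simp only [hq] at e1 e2
    by_cases h : i = j
    · subst h
      have e3 := q0 (i, true)
      have e4 := q0 (i, false)
      simp only [hq] at e3 e4
      simp only [if_true, List.append_nil, acount, il, Bool.not_true, hq, e3, e4, e1]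
      omega
    · simp only [h, if_false, List.cons_append, List.nil_append, acount, il, Bool.not_true, Bool.not_false, hq, e1, e2]
      omega
  have h2 : ∑ x : α × α, (q (x.1, false) (x.2, true) + q (x.1, true) (x.2, false) + q (x.1, false) (x.2, false) + q (x.1, true) (x.2, true))
     = ∑ s, ∑ t, q s t := by
    simp only [Fintype.sum_prod_type, Fintype.sum_bool, Finset.sum_add_distrib]
    ring
  have h3 : ∑ s, ∑ t, q s t = 2 * (A.card * B.card) := by
    rw [← Fintype.sum_prod_type', hq, ← Finset.card_filter]
    have : (Finset.univ.filter fun x : (α × Bool) × (α × Bool) => opp A B x.1 x.2) = A ×ˢ B ∪ B ×ˢ A := by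
      ext x; rw [Finset.mem_filter, Finset.mem_union, Finset.mem_product, Finset.mem_product, opp]; simp
    rw [this, Finset.card_union_of_disjoint, Finset.card_product, Finset.card_product]
    · ring
    · rw [Finset.disjoint_left]
      intro x h1 h2
      exact Finset.disjoint_left.1 hAB (Finset.mem_product.1 h1).1 (Finset.mem_product.1 h2).1
  refine le_trans ?_ (Finset.sum_le_sum fun x _ => h1 x)
  rw [← Finset.mul_sum, h2, h3]
  omega

lemma exists_axis [Fintype α] (h2 : 2 ≤ Fintype.card α) : ∃ X : Axis α, X.Good (10 * Fintype.card α - 5) := by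
  classical
  have : Nonempty α := by rw [← Fintype.card_pos_iff]; omega
  obtain ⟨a⟩ := this
  have hok := okL_LL (α := α)
  have hne := LL_ne a
  have hl : 0 < (LL α).length := List.length_pos_iff.2 hne
  let X := mkAxis (a, true) (LL α) hne (by
      intro i hi
      have := List.isChain_iff_getElem.1 hok.1 i hi
      rw [List.getD_eq_getElem _ _ hi, List.getD_eq_getElem _ _ (by omega)]
      exact this) (by
      intro e
      have e1 := hok.2.1 ((LL α).getD 0 (a, true)) (by
        rw [List.getD_eq_getElem _ _ hl, List.head?_eq_getElem?]
        simp [hl])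
      have e2 := hok.2.2 ((LL α).getD ((LL α).length - 1) (a, true)) (by
        rw [List.getD_eq_getElem _ _ (by omega), List.getLast?_eq_getElem?]
        simp [hl])
      rw [e] at e1
      simp only [il, e2] at e1
      simp at e1)
  have hXl : X.l = (LL α).length := rfl
  have hlam : ∀ i : ℕ, i < (LL α).length → X.lam i = (LL α).getD i (a, true) := by
    intro i hi
    show (LL α).getD ((i : ℤ) % ((LL α).length : ℤ)).toNat (a, true) = _
    rw [Int.emod_eq_of_lt (by omega) (by omega), Int.toNat_natCast]
  refine ⟨X, ?_, ?_, by omega, h2⟩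
  · intro A B hAB
    have h3 := LL_low A B hAB
    rw [acount_card _ (a, true)] at h3
    refine ⟨((Finset.range ((LL α).length - 1)).filter fun i => opp A B (il ((LL α).getD i (a, true)))
       ((LL α).getD (i + 1) (a, true))).image (fun i : ℕ => (i : ℤ) + 1), ?_, ?_⟩
    · intro i hi
      obtain ⟨k, hk, rfl⟩ := Finset.mem_image.1 hi
      obtain ⟨h4, h5⟩ := Finset.mem_filter.1 hk
      have h6 := Finset.mem_range.1 h4
      refine ⟨by omega, by rw [hXl]; omega, ?_⟩
      rw [add_sub_cancel_right, hlam k (by omega)]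
      have := hlam (k + 1) (by omega)
      push_cast at this
      rw [this]
      exact h5
    · rw [Finset.card_image_of_injective _ (fun i j h => by simpa using h)]
      exact h3
  · intro b
    refine le_trans (le_of_eq ?_) (LL_up b)
    rw [← countP_card _ (a, true)]
    congr 1
    apply Finset.filter_congr
    intro i hi
    rw [hlam i (Finset.mem_range.1 hi)]
end WordS

section BackS
variable {α : Type} [DecidableEq α] [Fintype α]

lemma sw_core (X : Axis α) {P : Set (FreeGroup α)} {v : FreeGroup α} {i : ℤ} (hi : 1 ≤ i) (hi' : i < X.l)
    (h1 : Pl P v (X.lam i)) (h2 : Mi P v (il (X.lam (i - 1)))) :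
    (X.K X.l \ {x | v * (X.p i)⁻¹ * x ∈ P}).Finite ∧ ({x | v * (X.p i)⁻¹ * x ∈ P} \ X.K 0).Finite := by
  have e : ∀ x s, x ∈ HT (X.p i) s → v * (X.p i)⁻¹ * x ∈ HT v s := by
    intro x s hx
    have h := HT_mul (v * (X.p i)⁻¹) (X.p i) (v * (X.p i)⁻¹ * x) s
    rw [inv_mul_cancel_right, inv_mul_cancel_left] at h
    exact h.2 hx
  refine ⟨?_, ?_⟩
  · refine (h1.preimage (f := fun x => v * (X.p i)⁻¹ * x) (fun a _ b _ h => mul_left_cancel h)).subset ?_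
    rintro x ⟨h3, h4⟩
    exact ⟨e _ _ (X.K_anti hi'.le h3), h4⟩
  · refine (h2.preimage (f := fun x => v * (X.p i)⁻¹ * x) (fun a _ b _ h => mul_left_cancel h)).subset ?_
    rintro x ⟨h3, h4⟩
    refine ⟨e _ _ ?_, h3⟩
    rw [← X.K_compl]
    exact fun h => h4 (X.K_anti (by omega) h)

lemma sw (X : Axis α) {M : ℕ} (G : X.Good M) (ψ : MulAut (FreeGroup α)) :
    ∃ a σ, (X.K X.l \ {x | ψ⁻¹ x ∈ HT a σ}).Finite ∧ ({x | ψ⁻¹ x ∈ HT a σ} \ X.K 0).Finite := by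
  set s := X.lam 0
  have hP : AI {w | ψ⁻¹ w ∈ HT 1 s} := by
    have := (AI_HT 1 s).affine 1 ψ⁻¹
    simpa [HT_one] using this
  have hinf : ∀ v r, {w | ψ⁻¹ w ∈ HT v r}.Infinite := by
    intro v r
    exact (HT_inf v r).preimage (f := ⇑(ψ⁻¹)) (by
      intro x _; exact (ψ⁻¹).surjective x)
  have hcm : {w | ψ⁻¹ w ∈ HT 1 s}ᶜ = {w | ψ⁻¹ w ∈ HT (1 * ltr s) (il s)} := by
    rw [← HT_compl]; rfl
  obtain ⟨v, s1, s2, h1, h2⟩ : ∃ v s1 s2, Pl {w | ψ⁻¹ w ∈ HT 1 s} v s1 ∧ Mi {w | ψ⁻¹ w ∈ HT 1 s} v s2 := by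
    rcases dich hP (hinf _ _) (by rw [hcm]; exact hinf _ _) with ⟨v, -, ⟨s1, -, h1⟩, ⟨s2, -, h2⟩⟩ |
      ⟨v, β, v', β', ⟨-, ⟨s1, -, h1⟩, ⟨s2, -, h2⟩⟩, -⟩
    · exact ⟨v, s1, s2, h1, h2⟩
    · exact ⟨v, s1, s2, h1, h2⟩
  have hne : s1 ≠ s2 := by rintro rfl; exact not_Pl_Mi h1 h2
  obtain ⟨S, hS, hc⟩ := G.low {s1} {s2} (by simpa using hne)
  have : S.Nonempty := by rw [← Finset.card_pos]; simp at hc; omega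
  obtain ⟨i, hi⟩ := this
  obtain ⟨h3, h4, h5⟩ := hS i hi
  have htr : ∀ b σ, {x | v * (X.p i)⁻¹ * x ∈ {w | ψ⁻¹ w ∈ HT b σ}} = {x | ψ⁻¹ x ∈ HT ((ψ⁻¹ (v * (X.p i)⁻¹))⁻¹ * b) σ} := by
    intro b σ
    ext x
    simp only [mem_ofPred_eq]
    rw [HT_mul, inv_inv, map_mul ψ⁻¹ (v * (X.p i)⁻¹) x]
  simp only [opp, Finset.mem_singleton] at h5
  rcases h5 with ⟨h5, h6⟩ | ⟨h5, h6⟩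
  · have := sw_core X (P := {w | ψ⁻¹ w ∈ HT 1 s}ᶜ) (v := v) h3 h4 (by
      rw [h6]; exact h2.subset (by rintro w ⟨h7, h8⟩; exact ⟨h7, by simpa using h8⟩)) (by
      rw [h5]; exact h1)
    rw [hcm, htr] at this
    exact ⟨_, _, this⟩
  · have := sw_core X (P := {w | ψ⁻¹ w ∈ HT 1 s}) (v := v) h3 h4 (by rw [h6]; exact h1) (by rw [h5]; exact h2)
    rw [htr] at this
    exact ⟨_, _, this⟩

lemma conj_mul_pow (x : FreeGroup α) (τ : MulAut (FreeGroup α)) (k : ℕ) :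
    ∃ y, (MulAut.conj x * τ) ^ k = MulAut.conj y * τ ^ k := by
  induction k with
  | zero => exact ⟨1, by simp⟩
  | succ k ih =>
    obtain ⟨y, hy⟩ := ih
    refine ⟨y * (τ ^ k) x, ?_⟩
    rw [pow_succ, hy]
    ext w
    simp only [MulAut.mul_apply, MulAut.conj_apply, map_mul, map_inv, mul_inv_rev, pow_succ, mul_assoc]

lemma K_l (X : Axis α) : X.K X.l = HT X.g (X.lam 0) := by
  rw [Axis.K]
  have := X.lper 0
  rw [zero_add] at this
  rw [this]; rfl

lemma K_0 (X : Axis α) : X.K 0 = Hf (X.lam 0) := by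
  rw [Axis.K, X.p0, HT_one]

theorem backward (h2 : 2 ≤ Fintype.card α) {N : Type} [Group N] (θ : N →* MulAut (FreeGroup α))
    (hθ : ∀ k, k ≠ 1 → ∀ m : ℕ, 0 < m → (θ k) ^ m ∉ (MulAut.conj : FreeGroup α →* MulAut (FreeGroup α)).range) :
    ∃ (Y : Type) (_ : MetricSpace Y) (ρ : (FreeGroup α ⋊[θ] N) →* (Y ≃ᵢ Y)),
      HyperbolicGeodesicSpace Y ∧ IsAcylindrical ρ ∧
      ∃ y : Y, ¬ Bornology.IsBounded (Set.range fun g : (FreeGroup α ⋊[θ] N) => ρ g y) := by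
  obtain ⟨X, G⟩ := exists_axis h2
  obtain ⟨e0⟩ : Nonempty (Fin 3 ↪ α × Bool) := by
    apply Function.Embedding.nonempty_of_card_le
    rw [Fintype.card_fin, Fintype.card_prod, Fintype.card_bool]; omega
  refine (hat_wall (θ := θ) (ε := e0) e0.injective X.g (X.lam 0) ?_ ?_ ?_ ?_).main
  · rw [← K_l, ← K_0]; exact X.K_anti (by omega)
  · rw [← K_l, ← K_0]
    intro h
    have := h ((X.p_mem 0 X.l).2 (by have := X.hl; omega))
    rw [X.p_mem] at this
    exact lt_irrefl _ this
  · intro q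
    obtain ⟨a, σ, h3, h4⟩ := sw X G (θ q⁻¹.right)
    have hinj : Function.Injective (ac θ q⁻¹) := by
      intro x y h
      simpa [ac] using h
    have hs : ∀ w, w ∈ HT (((θ q⁻¹.right)⁻¹ q⁻¹.left)⁻¹ * a) σ ↔ ac θ q⁻¹ w ∈ {x | (θ q⁻¹.right)⁻¹ x ∈ HT a σ} := by
      intro w
      rw [HT_mul, inv_inv]
      simp only [mem_ofPred_eq, ac]
      rw [map_mul (θ q⁻¹.right)⁻¹, MulAut.inv_apply_self]
    refine ⟨((θ q⁻¹.right)⁻¹ q⁻¹.left)⁻¹ * a, σ, ?_, ?_⟩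
    · refine (h3.preimage (f := ac θ q⁻¹) hinj.injOn).subset ?_
      rintro w ⟨h5, h6⟩
      refine ⟨?_, fun h => h6 ((hs w).2 h)⟩
      rw [mem_sm, mul_inv_rev, ac_mul, ← map_inv, ac_inl] at h5
      rw [K_l, mem_HT]; exact h5
    · refine (h4.preimage (f := ac θ q⁻¹) hinj.injOn).subset ?_
      rintro w ⟨h5, h6⟩
      refine ⟨(hs w).1 h5, fun h => h6 ?_⟩
      rw [K_0] at h; exact h
  · intro q hq a b ha hb h
    have h3 : q * SemidirectProduct.inl X.g * q⁻¹ = SemidirectProduct.inl ((MulAut.conj q.left * θ q.right) X.g) := by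
      ext
      · simp [mul_assoc]
      · simp
    have h' : (SemidirectProduct.inl (((MulAut.conj q.left * θ q.right) X.g) ^ a) : FreeGroup α ⋊[θ] N) = SemidirectProduct.inl (X.g ^ b) := by
      rw [map_zpow SemidirectProduct.inl, map_zpow SemidirectProduct.inl, ← h3]; exact h
    have h4 := SemidirectProduct.inl_injective h'
    obtain ⟨k, hk, y, hy⟩ := rigid X G (MulAut.conj q.left * θ q.right) ha hb h4
    obtain ⟨z, hz⟩ := conj_mul_pow q.left (θ q.right) k
    refine hθ q.right hq k hk ⟨z⁻¹ * y, ?_⟩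
    rw [map_mul, hy, hz, map_inv, inv_mul_cancel_left]

lemma pow_mem_Hf {s : α × Bool} {w : FreeGroup α} (hw : w ∉ Hf (il s)) (a : ℕ) (ha : 0 < a) : ltr s ^ a * w ∈ Hf s := by
  induction a with
  | zero => omega
  | succ a ih =>
    rw [pow_succ', mul_assoc, mul_mem_Hf]
    rcases Nat.eq_zero_or_pos a with h | h
    · subst h; simpa using hw
    · intro h1
      exact il_ne s (Hf_unique h1 (ih h))

theorem not_vc (h2 : 2 ≤ Fintype.card α) {N : Type} [Group N] (θ : N →* MulAut (FreeGroup α)) :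
    ¬ VirtuallyCyclic (FreeGroup α ⋊[θ] N) := by
  rintro ⟨H, hf, hc⟩
  obtain ⟨x, y, hxy⟩ := Fintype.exists_pair_of_one_lt_card (α := α) (by omega)
  obtain ⟨a, ha, -, ha'⟩ := H.exists_pow_mem_of_index_ne_zero hf.index_ne_zero (SemidirectProduct.inl (ltr (x, true)))
  obtain ⟨b, hb, -, hb'⟩ := H.exists_pow_mem_of_index_ne_zero hf.index_ne_zero (SemidirectProduct.inl (ltr (y, true)))
  obtain ⟨z, hz⟩ := hc.exists_generator
  obtain ⟨i, hi⟩ := Subgroup.mem_zpowers_iff.1 (hz ⟨_, ha'⟩)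
  obtain ⟨j, hj⟩ := Subgroup.mem_zpowers_iff.1 (hz ⟨_, hb'⟩)
  have h3 : (⟨_, ha'⟩ : H) * ⟨_, hb'⟩ = ⟨_, hb'⟩ * ⟨_, ha'⟩ := by
    rw [← hi, ← hj, ← zpow_add, ← zpow_add, add_comm]
  have h4 := congrArg Subtype.val h3
  simp only [Subgroup.coe_mul, ← map_pow, ← map_mul] at h4
  have h5 := SemidirectProduct.inl_injective h4
  have key : ∀ (x y : α) (a b : ℕ), x ≠ y → 0 < a → 0 < b → ltr (x, true) ^ a * ltr (y, true) ^ b ∈ Hf (x, true) := by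
    intro x y a b hxy ha hb
    refine pow_mem_Hf ?_ a ha
    intro h
    have h1 := pow_mem_Hf (s := (y, true)) (one_notin_Hf _) b hb
    rw [mul_one] at h1
    have := Hf_unique h h1
    simp [il] at this
  have h6 := key x y a b hxy ha hb
  rw [h5] at h6
  have := Hf_unique h6 (key y x b a hxy.symm hb ha)
  simp at this
  exact hxy this
end BackS

section Fwd
variable {Y : Type*} [MetricSpace Y] {δ : ℝ}

lemma fw_step (hd : 0 ≤ δ) (hY : GromovHyperbolic Y δ) (u : Y ≃ᵢ Y) {B : ℝ} {y y' p : Y}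
    (h1 : dist y (u y) ≤ B) (h2 : dist y' (u y') ≤ B) (hp : dist y p + dist p y' = dist y y')
    (hK : 2 * B + 4 * δ + 1 ≤ dist y p) (hK' : 2 * B + 4 * δ + 1 ≤ dist p y') :
    2 * dist p (u p) - 6 * δ ≤ dist p (u (u p)) := by
  have a1 : dist y (u p) ≤ dist y p + B := by
    have := dist_triangle y (u y) (u p)
    rw [u.dist_eq] at this; linarith
  have a2 : dist y' (u p) ≤ dist y' p + B := by
    have := dist_triangle y' (u y') (u p)
    rw [u.dist_eq] at this; linarith
  have key : ∀ y : Y, dist y (u y) ≤ B → 2 * B + 4 * δ + 1 ≤ dist y p → dist p (u p) ≤ B + 2 * δ →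
      dist p (u p) + dist y p ≤ dist y (u p) + 2 * δ → 2 * dist p (u p) - 6 * δ ≤ dist p (u (u p)) := by
    intro y h1 hK hk h
    have h3 := hY y (u p) (u y) (u (u p))
    rw [u.dist_eq, u.dist_eq, u.dist_eq] at h3
    have h4 := dist_triangle y p (u (u p))
    rcases le_max_iff.1 (show _ ≤ max (dist y (u y) + dist p (u p)) (dist y (u (u p)) + dist p y) from sub_le_iff_le_add.2 h3) with h5 | h5
    · have := dist_triangle y (u p) p
      rw [dist_comm (u p) p] at this
      linarith [dist_nonneg (x := p) (y := u p)]
    · rw [dist_comm p y] at h5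
      linarith
  have h3 := hY p (u p) y y'
  have c1 := dist_comm p y
  have c2 := dist_comm p y'
  have c3 := dist_comm (u p) y
  have c4 := dist_comm (u p) y'
  rcases le_max_iff.1 (sub_le_iff_le_add.2 h3) with h5 | h5
  · exact key y' h2 (by linarith) (by linarith) (by linarith)
  · exact key y h1 (by linarith) (by linarith) (by linarith)

lemma fw_l2g (hd : 0 ≤ δ) (hY : GromovHyperbolic Y δ) {P : ℕ → Y} {E : ℕ → ℝ} {κ : ℝ}
    (hE : ∀ i n, dist (P i) (P (i + n)) = E n) (h1 : E 1 = κ) (h2 : 2 * κ - 6 * δ ≤ E 2)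
    (hk : 10 * δ + 1 ≤ κ) (n : ℕ) : E n + κ - 8 * δ ≤ E (n + 1) := by
  induction n with
  | zero =>
    have := hE 0 0
    simp at this
    simp [← this, h1, hd]
  | succ n ih =>
    have h := hY (P 0) (P (0 + (n + 1))) (P (0 + n)) (P (0 + (n + 2)))
    have e1 := hE n 2
    have e2 := hE n 1
    have e3 := hE (n + 1) 1
    rw [hE, hE, hE] at h
    simp only [zero_add] at h
    rw [e1, e3, h1, dist_comm (P (n + 1)) (P n), e2, h1] at h
    rcases le_max_iff.1 (sub_le_iff_le_add.2 h) with h5 | h5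
    · linarith
    · show _ ≤ E (n + 2)
      linarith

lemma fw_add (hd : 0 ≤ δ) (hY : GromovHyperbolic Y δ) {P : ℕ → Y} {E : ℕ → ℝ} {κ : ℝ}
    (hE : ∀ i n, dist (P i) (P (i + n)) = E n) (h1 : E 1 = κ) (h2 : 2 * κ - 6 * δ ≤ E 2)
    (hk : 10 * δ + 1 ≤ κ) (m n : ℕ) : E m + E n - 10 * δ ≤ E (m + n) := by
  have hg := fw_l2g hd hY hE h1 h2 hk
  rcases n with _ | n
  · have := hE 0 0
    simp at this
    simp [← this, hd]
  have h := hY (P 0) (P (0 + (m + 1))) (P m) (P (m + (n + 1)))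
  have e1 := hE 0 m
  have e2 := hE 0 (m + (n + 1))
  have e3 := hE m 1
  have e4 := hE (m + 1) n
  rw [hE, hE] at h
  simp only [zero_add] at *
  rw [e1, show m + (n + 1) = m + 1 + n by ring, e4, dist_comm (P (m + 1)) (P m), e3] at h
  rw [show m + (n + 1) = m + 1 + n by ring] at *
  rw [e2] at h
  have := hg m
  have := hg n
  rcases le_max_iff.1 (sub_le_iff_le_add.2 h) with h5 | h5
  · linarith
  · linarith

lemma fw_lin (hd : 0 ≤ δ) (hY : GromovHyperbolic Y δ) {P : ℕ → Y} {E : ℕ → ℝ} {κ : ℝ}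
    (hE : ∀ i n, dist (P i) (P (i + n)) = E n) (h1 : E 1 = κ) (h2 : 2 * κ - 6 * δ ≤ E 2)
    (hk : 10 * δ + 1 ≤ κ) (n : ℕ) : (n : ℝ) ≤ E n := by
  induction n with
  | zero =>
    have := hE 0 0
    simp at this
    simp [← this]
  | succ n ih =>
    have := fw_l2g hd hY hE h1 h2 hk n
    push_cast
    linarith

lemma fw_near (hd : 0 ≤ δ) (hY : GromovHyperbolic Y δ) {P Q : ℕ → Y} {E : ℕ → ℝ} {κ D : ℝ}
    (hE : ∀ i n, dist (P i) (P (i + n)) = E n) (h1 : E 1 = κ) (h2 : 2 * κ - 6 * δ ≤ E 2)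
    (hk : 10 * δ + 1 ≤ κ) (hQ : ∀ i j, dist (Q i) (Q j) = dist (P i) (P j))
    (hD : ∀ i, dist (P i) (Q i) = D) : ∃ m i : ℕ, dist (P m) (Q i) ≤ κ + 16 * δ := by
  have hl := fw_lin hd hY hE h1 h2 hk
  have ha := fw_add hd hY hE h1 h2 hk
  obtain ⟨m, hm⟩ := exists_nat_gt (2 * D + 10 * δ + 10)
  have hD0 : 0 ≤ D := by rw [← hD 0]; exact dist_nonneg
  have em := hl m
  have em2 := ha m m
  have p0m : dist (P 0) (P m) = E m := by simpa using hE 0 m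
  have p02 : dist (P 0) (P (m + m)) = E (m + m) := by simpa using hE 0 (m + m)
  have pm2 : dist (P m) (P (m + m)) = E m := hE m m
  have t1 : dist (P m) (Q (m + m)) + E (m + m) ≤ E m + dist (P 0) (Q (m + m)) + 2 * δ := by
    have h := hY (P m) (Q (m + m)) (P 0) (P (m + m))
    rw [p02, dist_comm (P m) (P 0), p0m, dist_comm (Q (m + m)) (P (m + m)), hD, pm2, dist_comm (Q (m + m)) (P 0)] at h
    have t := dist_triangle (P m) (Q (m + m)) (P (m + m))
    rw [dist_comm (Q (m + m)) (P (m + m)), hD, pm2] at t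
    rcases le_max_iff.1 (sub_le_iff_le_add.2 h) with h5 | h5
    · linarith
    · linarith
  have t2 : dist (P m) (Q 0) + dist (P 0) (Q (m + m)) ≤ E m + E (m + m) + 2 * δ := by
    have h := hY (P m) (Q 0) (P 0) (Q (m + m))
    rw [dist_comm (P m) (P 0), p0m, dist_comm (Q 0) (P 0), hD, hQ, p02] at h
    have t := dist_triangle (P m) (Q 0) (P 0)
    rw [dist_comm (P m) (P 0), p0m, dist_comm (Q 0) (P 0), hD] at t
    have s := dist_triangle (P 0) (Q (m + m)) (P (m + m))
    rw [dist_comm (Q (m + m)) (P (m + m)), hD, p02] at s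
    have r := dist_triangle (P m) (P (m + m)) (Q (m + m))
    rw [hD, pm2] at r
    rcases le_max_iff.1 (sub_le_iff_le_add.2 h) with h5 | h5
    · linarith
    · linarith
  have hE0 : E 0 = 0 := by simpa using (hE 0 0).symm
  have hs : ∀ i, E (i + 1) ≤ E i + κ := by
    intro i
    have := dist_triangle (P 0) (P (0 + i)) (P (0 + i + 1))
    rw [hE, hE, h1, add_assoc, hE] at this
    exact this
  have hex : ∃ i ≤ m + m, E i ≤ dist (P m) (Q 0) ∧ (i = m + m ∨ dist (P m) (Q 0) ≤ E i + κ) := by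
    by_contra hcon
    push Not at hcon
    have : ∀ i ≤ m + m, E i ≤ dist (P m) (Q 0) := by
      intro i
      induction i with
      | zero => intro _; rw [hE0]; exact dist_nonneg
      | succ i ih =>
        intro hi
        have := (hcon i (by omega) (ih (by omega))).2
        linarith [hs i]
    exact (hcon _ le_rfl (this _ le_rfl)).1 rfl
  obtain ⟨i, hi, h3, h4⟩ := hex
  refine ⟨m, i, ?_⟩
  rcases h4 with h4 | h4
  · subst h4
    linarith
  · obtain ⟨j, hj⟩ := Nat.exists_eq_add_of_le hi
    have h := hY (P m) (Q i) (Q 0) (Q (m + m))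
    rw [hQ, hQ, hQ, p02] at h
    have e1 : dist (P i) (P (m + m)) = E j := by rw [hj, hE]
    have e2 : dist (P i) (P 0) = E i := by rw [dist_comm]; simpa using hE 0 i
    rw [e1, e2] at h
    have := ha i j
    rw [← hj] at this
    rcases le_max_iff.1 (sub_le_iff_le_add.2 h) with h5 | h5
    · linarith
    · linarith

theorem fw_main {G : Type*} [Group G] (ρ : G →* (Y ≃ᵢ Y)) (hY : HyperbolicGeodesicSpace Y) (hA : IsAcylindrical ρ)
    {y : Y} (hy : ¬ Bornology.IsBounded (Set.range fun g : G => ρ g y)) {z : G} (hz : ∀ g, z * g = g * z)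
    (hinf : Function.Injective (fun j : ℕ => z ^ j)) : VirtuallyCyclic G := by
  classical
  obtain ⟨hg, δ, hd, hδ⟩ := hY
  have ap : ∀ (g h : G) (x : Y), ρ (g * h) x = ρ g (ρ h x) := by
    intro g h x; rw [map_mul]; rfl
  have com : ∀ (w g : G), (w * g = g * w) → ∀ x, dist (ρ g x) (ρ w (ρ g x)) = dist x (ρ w x) := by
    intro w g h x
    rw [← ap, h, ap, (ρ g).dist_eq]
  obtain ⟨L, hL, N, hN⟩ := hA (10 * δ + 1) (by linarith)
  obtain ⟨B, hB⟩ : ∃ B : ℝ, ∀ j ∈ Finset.range (N + 1), dist y (ρ (z ^ j) y) ≤ B :=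
    ⟨∑ j ∈ Finset.range (N + 1), dist y (ρ (z ^ j) y), fun j hj =>
      Finset.single_le_sum (f := fun j => dist y (ρ (z ^ j) y)) (fun _ _ => dist_nonneg) hj⟩
  have hB0 : 0 ≤ B := le_trans dist_nonneg (hB 0 (by simp))
  have hzj : ∀ (j : ℕ) (g : G), z ^ j * g = g * z ^ j := fun j g => (Commute.pow_left (hz g) j)
  set K : ℝ := 2 * B + 4 * δ + 1 with hK
  obtain ⟨g0, hg0⟩ : ∃ g, L + 2 * K < dist y (ρ g y) := by
    by_contra hcon
    push Not at hcon
    refine hy ((Metric.isBounded_closedBall (x := y) (r := L + 2 * K)).subset ?_)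
    rintro _ ⟨g, rfl⟩
    rw [mem_closedBall, dist_comm]
    exact hcon g
  obtain ⟨c, c0, c1, hc⟩ := hg y (ρ g0 y)
  set D := dist y (ρ g0 y) with hD
  have hKp : 0 < K := by linarith
  have mid : ∀ s, K ≤ s → s ≤ D - K → dist y (c s) = s ∧ dist (c s) (ρ g0 y) = D - s := by
    intro s h1 h2
    have i0 : (0 : ℝ) ∈ Icc 0 D := ⟨le_rfl, dist_nonneg⟩
    have i1 : D ∈ Icc 0 D := ⟨dist_nonneg, le_rfl⟩
    have is : s ∈ Icc 0 D := ⟨by linarith, by linarith⟩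
    have e1 := hc 0 i0 s is
    have e2 := hc s is D i1
    rw [c0, zero_sub, abs_neg, abs_of_nonneg is.1] at e1
    rw [c1, abs_sub_comm, abs_of_nonneg (by linarith [is.2])] at e2
    exact ⟨e1, e2⟩
  obtain ⟨j, hj, p, hp1, hp2, hp3, hp4⟩ : ∃ j ∈ Finset.range (N + 1), ∃ p, dist y p + dist p (ρ g0 y) = D ∧
      K ≤ dist y p ∧ K ≤ dist p (ρ g0 y) ∧ 10 * δ + 1 ≤ dist p (ρ (z ^ j) p) := by
    by_contra hcon
    push Not at hcon
    have m1 := mid K le_rfl (by linarith)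
    have m2 := mid (D - K) (by linarith) le_rfl
    have hdd : dist (c K) (c (D - K)) = D - K - K := by
      rw [hc K ⟨by linarith, by linarith⟩ (D - K) ⟨by linarith, by linarith⟩, abs_sub_comm, abs_of_nonneg (by linarith)]
    obtain ⟨s, hs, hs'⟩ := hN (c K) (c (D - K)) (by rw [hdd]; linarith)
    have hsub : (Finset.range (N + 1)).image (fun j : ℕ => z ^ j) ⊆ s := by
      intro x hx
      obtain ⟨j, hj, rfl⟩ := Finset.mem_image.1 hx
      exact hs' _ (hcon j hj (c K) (by linarith) (by linarith) (by linarith))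
        (hcon j hj (c (D - K)) (by linarith) (by linarith) (by linarith))
    have := Finset.card_le_card hsub
    rw [Finset.card_image_of_injective _ hinf, Finset.card_range] at this
    omega
  set w := z ^ j with hw
  have hwc : ∀ g, w * g = g * w := hzj j
  have hst := fw_step hd hδ (ρ w) (hB j hj) (by rw [com _ _ (hwc g0)]; exact hB j hj) hp1 hp2 hp3
  let P : ℕ → Y := fun i => ρ (w ^ i) p
  let E : ℕ → ℝ := fun i => dist p (ρ (w ^ i) p)
  have hE : ∀ i n, dist (P i) (P (i + n)) = E n := by
    intro i n
    simp only [P, E]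
    rw [pow_add, ap, (ρ (w ^ i)).dist_eq]
  have h1 : E 1 = dist p (ρ w p) := by simp [E]
  have h2 : 2 * dist p (ρ w p) - 6 * δ ≤ E 2 := by
    simp only [E]; rw [pow_two, ap]; exact hst
  have hlin := fw_lin hd hδ hE h1 h2 hp4
  set κ := dist p (ρ w p) with hκ
  have hwi : ∀ (i : ℕ) (g : G), g * w ^ i = w ^ i * g := fun i g => (Commute.pow_right (hwc g).symm i)
  obtain ⟨L', hL', N', hN'⟩ := hA (κ + 16 * δ + 1) (by linarith)
  obtain ⟨M, hM⟩ := exists_nat_gt L'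
  obtain ⟨s, -, hs⟩ := hN' p (ρ (w ^ M) p) (lt_of_lt_of_le hM (hlin M))
  have hfin : ∀ g, dist p (ρ g p) < κ + 16 * δ + 1 → g ∈ s := by
    intro g h
    refine hs g h ?_
    rw [com _ _ (hwi M g)]; exact h
  refine ⟨Subgroup.zpowers w, ?_, inferInstance⟩
  have : Finite (G ⧸ Subgroup.zpowers w) := by
    refine Finite.of_surjective (fun h : s => (QuotientGroup.mk h.1 : G ⧸ Subgroup.zpowers w)) ?_
    intro x
    obtain ⟨g, rfl⟩ := QuotientGroup.mk_surjective x
    obtain ⟨m, i, hmi⟩ := fw_near (Q := fun i => ρ g (P i)) (D := dist p (ρ g p)) hd hδ hE h1 h2 hp4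
      (fun i j => (ρ g).dist_eq _ _) (fun i => com _ _ (hwi i g) p)
    have hm : dist p (ρ ((w ^ m)⁻¹ * (g * w ^ i)) p) < κ + 16 * δ + 1 := by
      rw [← (ρ (w ^ m)).dist_eq, ← ap, mul_inv_cancel_left, ap]
      exact lt_of_le_of_lt hmi (by linarith)
    refine ⟨⟨_, hfin _ hm⟩, ?_⟩
    rw [eq_comm, QuotientGroup.eq]
    refine ⟨(i : ℤ) - m, ?_⟩
    have h5 : g * (w ^ m)⁻¹ = (w ^ m)⁻¹ * g := (Commute.inv_right (hwi m g))
    show w ^ ((i : ℤ) - m) = g⁻¹ * ((w ^ m)⁻¹ * (g * w ^ i))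
    rw [← mul_assoc (w ^ m)⁻¹, ← h5, mul_assoc, inv_mul_cancel_left, sub_eq_neg_add, zpow_add, zpow_neg, zpow_natCast, zpow_natCast]
  exact Subgroup.finiteIndex_of_finite_quotient
end Fwd

section Fin
lemma free_center {α : Type} [DecidableEq α] {x y : α} (hxy : x ≠ y) {c : FreeGroup α} (hc : ∀ g, c * g = g * c) : c = 1 := by
  have key : ∀ a : α, c ∉ Hf (a, true) → c ∉ Hf (a, false) → c = 1 := by
    intro a h1 h2
    refine (edgeL (r := (a, true)) h1 ?_).1
    rw [hc, mul_mem_Hf]; exact h2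
  by_contra h
  have h2 : ∀ a, ∃ b, c ∈ Hf (a, b) := by
    intro a
    by_contra h3
    push Not at h3
    exact h (key a (h3 _) (h3 _))
  obtain ⟨b, hb⟩ := h2 x
  obtain ⟨b', hb'⟩ := h2 y
  exact hxy (congrArg Prod.fst (Hf_unique hb hb'))

theorem fw_final {n : ℕ} (hn : 2 ≤ n) (φ : MulAut (FreeGroup (Fin n)))
    (h : AcylindricallyHyperbolic (FreeGroup (Fin n) ⋊[(zpowersHom (MulAut (FreeGroup (Fin n)))) φ] Multiplicative ℤ))
    (k : ℕ) (hk : 0 < k) : φ ^ k ∉ (MulAut.conj : FreeGroup (Fin n) →* MulAut (FreeGroup (Fin n))).range := by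
  rintro ⟨w, hw⟩
  generalize hθ : (zpowersHom (MulAut (FreeGroup (Fin n)))) φ = θ at h
  obtain ⟨hvc, Y, _, ρ, hY, hA, y, hy⟩ := h
  have hwx : ∀ x, (φ ^ k) x = w * x * w⁻¹ := by intro x; rw [← hw]; rfl
  have hφw : φ w = w := by
    have h0 : (⟨0, by omega⟩ : Fin n) ≠ ⟨1, by omega⟩ := by simp
    have := free_center h0 (c := w⁻¹ * φ w) (by
      intro g
      have e : φ ((φ ^ k) (φ⁻¹ g)) = (φ ^ k) g := by
        rw [← MulAut.mul_apply, ← MulAut.mul_apply, ← pow_succ', pow_succ, mul_assoc, mul_inv_cancel, mul_one]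
      rw [hwx, hwx, map_mul, map_mul, map_inv, MulAut.apply_inv_self] at e
      calc w⁻¹ * φ w * g = w⁻¹ * (φ w * g * (φ w)⁻¹) * φ w := by group
        _ = g * (w⁻¹ * φ w) := by rw [e]; group)
    exact (inv_mul_eq_one.1 this).symm
  have hθa : ∀ m : Multiplicative ℤ, θ m = φ ^ (Multiplicative.toAdd m) := fun m => by rw [← hθ]; exact zpowersHom_apply _ _ _
  have hzw : ∀ m : ℤ, (φ ^ m) w = w := by
    intro m
    have : φ ∈ MulAction.stabilizer (MulAut (FreeGroup (Fin n))) w := hφw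
    exact Subgroup.zpow_mem _ this m
  let z : FreeGroup (Fin n) ⋊[θ] Multiplicative ℤ := ⟨w⁻¹, Multiplicative.ofAdd (k : ℤ)⟩
  refine hvc (fw_main ρ hY hA hy (z := z) ?_ ?_)
  · intro g
    ext
    · simp only [SemidirectProduct.mul_left, z, hθa, toAdd_ofAdd, zpow_natCast, hwx, map_inv, hzw]
      group
    · simp [z, mul_comm]
  · intro i j hij
    have h1 := congrArg (SemidirectProduct.rightHom) hij
    simp only [map_pow, z, SemidirectProduct.rightHom_eq_right] at h1
    have h2 := congrArg Multiplicative.toAdd h1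
    simp only [toAdd_pow, toAdd_ofAdd, nsmul_eq_mul] at h2
    have h3 : (k : ℤ) ≠ 0 := by exact_mod_cast hk.ne'
    exact_mod_cast mul_right_cancel₀ h3 h2

theorem bw_final {n : ℕ} (hn : 2 ≤ n) (φ : MulAut (FreeGroup (Fin n)))
    (h : ∀ k : ℕ, 0 < k → φ ^ k ∉ (MulAut.conj : FreeGroup (Fin n) →* MulAut (FreeGroup (Fin n))).range) :
    AcylindricallyHyperbolic (FreeGroup (Fin n) ⋊[(zpowersHom (MulAut (FreeGroup (Fin n)))) φ] Multiplicative ℤ) := by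
  refine ⟨not_vc (by simpa using hn) _, backward (by simpa using hn) _ ?_⟩
  intro m hm K hK hin
  rw [zpowersHom_apply] at hin
  have hm0 : Multiplicative.toAdd m ≠ 0 := fun h => hm (by simpa using h)
  refine h ((Multiplicative.toAdd m).natAbs * K) (Nat.mul_pos (Int.natAbs_pos.2 hm0) hK) ?_
  rw [pow_mul]
  rcases Int.natAbs_eq (Multiplicative.toAdd m) with e | e
  · rw [e, zpow_natCast] at hin
    exact hin
  · rw [e, zpow_neg, zpow_natCast, inv_pow] at hin
    exact (Subgroup.inv_mem_iff _).1 hin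
end Fin

/-- For `n ≥ 2` and an automorphism `φ` of the free group `F n`, the semidirect product
`F n ⋊_φ ℤ` is acylindrically hyperbolic if and only if the image of `φ` in
`Out(F n)` has infinite order, i.e. no positive power of `φ` is an inner
automorphism. -/
theorem freeByCyclic_acylindricallyHyperbolic_iff (n : ℕ) (hn : 2 ≤ n)
    (φ : MulAut (FreeGroup (Fin n))) :
    AcylindricallyHyperbolic
        (FreeGroup (Fin n) ⋊[(zpowersHom (MulAut (FreeGroup (Fin n)))) φ] Multiplicative ℤ) ↔
      ∀ k : ℕ, 0 < k →
        φ ^ k ∉ (MulAut.conj : FreeGroup (Fin n) →* MulAut (FreeGroup (Fin n))).range := 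
  ⟨fun h => fw_final hn φ h, fun h => bw_final hn φ h⟩
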